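/- Let K/F be a CM quadratic extension of a totally real field and let (V_1,h_1), (V_2,h_2) be nondegenerate K-Hermitian spaces of even dimension m. Then (V_1,h_1) and (V_2,h_2) are F-conformal if and only if sgn_σ(h_1) = ± sgn_σ(h_2) for every real embedding σ of F and det h_1 = det h_2 in F^×/N_{K/F}(K^×). -/

import Mathlib

open Matrix

/-- `HermSig m A p q` : the complex matrix `A` is Hermitian with signature `(p,q)`
    (p positive eigenvalues, q negative eigenvalues). -/
def HermSig (m : ℕ) (A : Matrix (Fin m) (Fin m) ℂ) (p q : ℕ) : Prop :=
  ∃ hA : A.IsHermitian,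
    p = Fintype.card {i // 0 < hA.eigenvalues i} ∧
    q = Fintype.card {i // hA.eigenvalues i < 0}

namespace Lh
set_option linter.unusedSectionVars false
open IsDedekindDomain NumberField HeightOneSpectrum
open scoped WithZero

section basics
variable {E : Type*} [Field E] [NumberField E]

abbrev Pl (E : Type*) [Field E] := HeightOneSpectrum (𝓞 E)

lemma four_le_one (v : Pl E) : v.valuation E 4 ≤ 1 := by
  have := v.valuation_le_one (K := E) (4 : 𝓞 E)
  change v.valuation E (algebraMap (𝓞 E) E 4) ≤ 1 at this
  rwa [map_ofNat] at this

lemma two_le_one (v : Pl E) : v.valuation E 2 ≤ 1 := by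
  have := v.valuation_le_one (K := E) (2 : 𝓞 E)
  change v.valuation E (algebraMap (𝓞 E) E 2) ≤ 1 at this
  rwa [map_ofNat] at this

lemma four_eq (v : Pl E) : v.valuation E 4 = v.valuation E 2 ^ 2 := by
  rw [← map_pow]; norm_num

/-- strong local square -/
def IsQ (v : Pl E) (u : E) : Prop := ∃ t : E, v.valuation E (u * t ^ 2 - 1) < v.valuation E 4

lemma IsQ.eq_one {v : Pl E} {u t : E} (h : v.valuation E (u * t ^ 2 - 1) < v.valuation E 4) :
    v.valuation E (u * t ^ 2) = 1 := by
  have h1 := h.trans_le (four_le_one v)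
  have : v.valuation E ((u * t ^ 2 - 1) + 1) = v.valuation E 1 := by
    apply Valuation.map_add_eq_of_lt_right
    rw [map_one]; exact h1
  simpa using this

lemma IsQ.ne_zero {v : Pl E} {u : E} (h : IsQ v u) : u ≠ 0 := by
  obtain ⟨t, ht⟩ := h
  rintro rfl
  have := IsQ.eq_one ht
  simp at this

lemma IsQ.sq {v : Pl E} {x : E} (hx : x ≠ 0) : IsQ v (x ^ 2) := by
  refine ⟨x⁻¹, ?_⟩
  have : x ^ 2 * x⁻¹ ^ 2 - 1 = 0 := by field_simp; simp
  rw [this, map_zero]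
  exact (Valuation.pos_iff _).2 (by norm_num)

lemma IsQ.mul {v : Pl E} {x y : E} (hx : IsQ v x) (hy : IsQ v y) : IsQ v (x * y) := by
  obtain ⟨t, ht⟩ := hx
  obtain ⟨s, hs⟩ := hy
  refine ⟨t * s, ?_⟩
  have : x * y * (t * s) ^ 2 - 1 = (x * t ^ 2 - 1) * (y * s ^ 2) + (y * s ^ 2 - 1) := by ring
  rw [this]
  refine Valuation.map_add_lt _ ?_ hs
  rw [map_mul, IsQ.eq_one hs, mul_one]; exact ht

lemma IsQ.inv {v : Pl E} {x : E} (hx : IsQ v x) : IsQ v x⁻¹ := by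
  have h0 := hx.ne_zero
  obtain ⟨t, ht⟩ := hx
  refine ⟨x * t, ?_⟩
  have : x⁻¹ * (x * t) ^ 2 - 1 = x * t ^ 2 - 1 := by field_simp
  rw [this]; exact ht

lemma IsQ.mul_sq_iff {v : Pl E} {x y : E} (hy : y ≠ 0) : IsQ v (x * y ^ 2) ↔ IsQ v x := by
  refine ⟨fun h => ?_, fun h => h.mul (IsQ.sq hy)⟩
  have := h.mul (IsQ.sq (v := v) hy).inv
  rwa [mul_assoc, mul_inv_cancel₀ (by positivity), mul_one] at this

lemma IsQ.of_mul {v : Pl E} {x y : E} (h : IsQ v (x * y)) (hy : IsQ v y) : IsQ v x := by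
  have := h.mul hy.inv
  rwa [mul_assoc, mul_inv_cancel₀ hy.ne_zero, mul_one] at this

/-- if x is close to y then x/y is a Q. -/
lemma IsQ.of_close {v : Pl E} {x y : E} (hy : y ≠ 0)
    (h : v.valuation E (x - y) < v.valuation E (4 * y)) : IsQ v (x * y) := by
  refine ⟨y⁻¹, ?_⟩
  have : x * y * y⁻¹ ^ 2 - 1 = (x - y) * y⁻¹ := by field_simp
  rw [this, map_mul, map_inv₀]
  rw [map_mul] at h
  have hy' : 0 < v.valuation E y := (Valuation.pos_iff _).2 hy
  rw [← div_eq_mul_inv, div_lt_iff₀ hy']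
  exact h

/-- Q_v as a subgroup. -/
def Qs (v : Pl E) : Subgroup Eˣ where
  carrier := {u | IsQ v (u : E)}
  mul_mem' := by
    intro a b ha hb
    simpa using IsQ.mul ha hb
  one_mem' := by simpa using IsQ.sq (v := v) (x := (1 : E)) one_ne_zero
  inv_mem' := by
    intro a ha
    simpa using IsQ.inv ha

@[simp] lemma mem_Qs {v : Pl E} {u : Eˣ} : u ∈ Qs v ↔ IsQ v (u : E) := Iff.rfl

/-- S-units -/
def Us (S : Set (Pl E)) : Subgroup Eˣ where
  carrier := {u | ∀ v ∉ S, v.valuation E (u : E) = 1}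
  mul_mem' := by
    intro a b ha hb v hv
    simp [ha v hv, hb v hv]
  one_mem' := by simp
  inv_mem' := by
    intro a ha v hv
    simp [ha v hv]

lemma mem_Us {S : Set (Pl E)} {u : Eˣ} : u ∈ Us S ↔ ∀ v ∉ S, v.valuation E (u : E) = 1 := Iff.rfl

lemma Us_mono {S T : Set (Pl E)} (h : S ⊆ T) : Us S ≤ Us T :=
  fun _ hu v hv => hu v (fun h' => hv (h h'))

lemma finite_supp {x : E} (hx : x ≠ 0) : {v : Pl E | v.valuation E x ≠ 1}.Finite := by
  refine ((HeightOneSpectrum.Support.finite (R := 𝓞 E) x).union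
    (HeightOneSpectrum.Support.finite (R := 𝓞 E) x⁻¹)).subset ?_
  intro v hv
  rcases lt_or_gt_of_ne hv with h | h
  · right
    change 1 < v.valuation E x⁻¹
    rw [map_inv₀]
    exact (one_lt_inv₀ ((Valuation.pos_iff _).2 hx)).2 h
  · left; exact h

lemma finite_dyadic : {v : Pl E | v.valuation E 2 ≠ 1}.Finite := finite_supp two_ne_zero

/-- unit at v : fraction of two v-units -/
lemma exists_frac {v : Pl E} {x : E} (hx : v.valuation E x = 1) :
    ∃ a b : 𝓞 E, a ∉ v.asIdeal ∧ b ∉ v.asIdeal ∧ x = algebraMap _ E a / algebraMap _ E b := by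
  obtain ⟨n, d, hd⟩ := exists_primeCompl_mul_eq_of_integer v x hx.le
  refine ⟨n, d, ?_, d.2, ?_⟩
  · rw [← valuation_eq_one_iff_notMem (K := E)]
    rw [← hd, map_mul, hx, one_mul, valuation_eq_one_iff_notMem]
    exact d.2
  · rw [eq_div_iff]
    · exact hd
    · intro h
      have : (d : 𝓞 E) = 0 := by simpa using h
      exact d.2 (by rw [this]; exact zero_mem _)

lemma isQ_int_iff {v : Pl E} (h2 : v.valuation E 2 = 1) {a : 𝓞 E} (ha : a ∉ v.asIdeal) :
    IsQ v (algebraMap _ E a) ↔ IsSquare (Ideal.Quotient.mk v.asIdeal a) := by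
  have h4 : v.valuation E 4 = 1 := by rw [four_eq, h2, one_pow]
  have hva := (valuation_eq_one_iff_notMem (K := E) (v := v)).2 ha
  constructor
  · rintro ⟨t, ht⟩
    have h1 := IsQ.eq_one ht
    rw [map_mul, hva, one_mul, map_pow, pow_eq_one_iff_of_nonneg zero_le (by norm_num)] at h1
    obtain ⟨p, q, hp, hq, rfl⟩ := exists_frac h1
    have hvp := (valuation_eq_one_iff_notMem (K := E) (v := v)).2 hp
    have hvq := (valuation_eq_one_iff_notMem (K := E) (v := v)).2 hq
    have hq0 : algebraMap _ E q ≠ 0 := by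
      intro h; rw [h, map_zero] at hvq; exact zero_ne_one hvq
    have key : v.valuation E (algebraMap (𝓞 E) E (a * p ^ 2 - q ^ 2)) < 1 := by
      have : algebraMap (𝓞 E) E (a * p ^ 2 - q ^ 2)
        = (algebraMap (𝓞 E) E a * (algebraMap (𝓞 E) E p / algebraMap (𝓞 E) E q) ^ 2 - 1) *
          (algebraMap (𝓞 E) E q) ^ 2 := by
        push_cast [map_sub, map_mul, map_pow]; field_simp
      rw [this, map_mul, map_pow, hvq, one_pow, mul_one, ← h4]; exact ht
    rw [valuation_lt_one_iff_mem] at key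
    have h' : Ideal.Quotient.mk v.asIdeal a * Ideal.Quotient.mk v.asIdeal p ^ 2
        = Ideal.Quotient.mk v.asIdeal q ^ 2 := by
      rw [← map_pow, ← map_pow, ← map_mul, Ideal.Quotient.eq]; exact key
    have hm : v.asIdeal.IsMaximal := v.isMaximal
    let _ := Ideal.Quotient.field v.asIdeal
    have hp' : Ideal.Quotient.mk v.asIdeal p ≠ 0 := by
      rwa [Ne, Ideal.Quotient.eq_zero_iff_mem]
    refine ⟨Ideal.Quotient.mk v.asIdeal q / Ideal.Quotient.mk v.asIdeal p, ?_⟩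
    field_simp
    exact h'
  · rintro ⟨r, hr⟩
    obtain ⟨r, rfl⟩ := Ideal.Quotient.mk_surjective r
    rw [← map_mul, Ideal.Quotient.eq] at hr
    have hr' : r ∉ v.asIdeal := by
      intro h
      apply ha
      have := v.asIdeal.add_mem hr (v.asIdeal.mul_mem_left r h)
      simpa using this
    have hvr := (valuation_eq_one_iff_notMem (K := E) (v := v)).2 hr'
    have hr0 : algebraMap _ E r ≠ 0 := by
      intro h; rw [h, map_zero] at hvr; exact zero_ne_one hvr
    refine ⟨(algebraMap _ E r)⁻¹, ?_⟩
    rw [← valuation_lt_one_iff_mem (K := E)] at hr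
    have : algebraMap (𝓞 E) E a * (algebraMap (𝓞 E) E r)⁻¹ ^ 2 - 1
        = algebraMap (𝓞 E) E (a - r * r) * ((algebraMap (𝓞 E) E r)⁻¹) ^ 2 := by
      push_cast [map_sub, map_mul]; field_simp
    rw [this, map_mul, map_pow, map_inv₀, hvr, h4]; simpa using hr

instance finite_res (v : Pl E) : Finite (𝓞 E ⧸ v.asIdeal) :=
  Ideal.finiteQuotientOfFreeOfNeBot v.asIdeal v.ne_bot

/-- odd place : the product of two nonsquare units is a square -/
lemma isQ_mul_of_not {v : Pl E} (h2 : v.valuation E 2 = 1) {x y : E}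
    (hx : v.valuation E x = 1) (hy : v.valuation E y = 1) (hxQ : ¬ IsQ v x) (hyQ : ¬ IsQ v y) :
    IsQ v (x * y) := by
  obtain ⟨a, b, ha, hb, rfl⟩ := exists_frac hx
  obtain ⟨c, d, hc, hd, rfl⟩ := exists_frac hy
  have nz : ∀ {q : 𝓞 E}, q ∉ v.asIdeal → algebraMap _ E q ≠ 0 := by
    intro q hq h
    have : q = 0 := by simpa using h
    exact hq (by rw [this]; exact zero_mem _)
  have e1 : ∀ {a b : 𝓞 E}, b ∉ v.asIdeal → (IsQ v (algebraMap _ E a / algebraMap _ E b) ↔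
      IsQ v (algebraMap _ E (a * b))) := by
    intro a b hb
    rw [← IsQ.mul_sq_iff (v := v) (nz hb)]
    have := nz hb
    rw [iff_iff_eq]; congr 1; rw [map_mul]; field_simp
  have hp : ∀ {a b : 𝓞 E}, a ∉ v.asIdeal → b ∉ v.asIdeal → a * b ∉ v.asIdeal := by
    intro a b ha hb h
    rcases v.isPrime.mem_or_mem h with h | h
    · exact ha h
    · exact hb h
  rw [div_mul_div_comm, ← map_mul, ← map_mul, e1 (hp hb hd), isQ_int_iff h2 (hp (hp ha hc) (hp hb hd))]
  rw [e1 hb, isQ_int_iff h2 (hp ha hb)] at hxQ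
  rw [e1 hd, isQ_int_iff h2 (hp hc hd)] at hyQ
  have hm : v.asIdeal.IsMaximal := v.isMaximal
  let _ := Ideal.Quotient.field v.asIdeal
  let _ := Fintype.ofFinite (𝓞 E ⧸ v.asIdeal)
  have : (a * c * (b * d)) = (a * b) * (c * d) := by ring
  rw [this, map_mul]
  classical
  rw [← quadraticChar_neg_one_iff_not_isSquare] at hxQ hyQ
  rw [← quadraticChar_one_iff_isSquare, map_mul, hxQ, hyQ]; · norm_num
  rw [← map_mul, Ne, Ideal.Quotient.eq_zero_iff_mem]; exact hp (hp ha hb) (hp hc hd)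

end basics

section ext
variable {E M : Type*} [Field E] [NumberField E] [Field M] [NumberField M] [Algebra E M]

/-- place below -/
noncomputable def below (E : Type*) {M : Type*} [Field E] [NumberField E] [Field M] [NumberField M] [Algebra E M]
    (P : Pl M) : Pl E := P.under (𝓞 E)

lemma below_val (P : Pl M) : ∃ e : ℕ, e ≠ 0 ∧ ∀ x : E, P.valuation M (algebraMap E M x) =
    (below E P).valuation E x ^ e := by
  have : P.asIdeal.LiesOver (below E P).asIdeal := ⟨rfl⟩
  refine ⟨_, Ideal.IsDedekindDomain.ramificationIdx'_ne_zero_of_liesOver P.asIdeal (below E P).ne_bot, fun x => ?_⟩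
  exact (valuation_liesOver (K := E) M (below E P) P x).symm

lemma below_lt (P : Pl M) (x y : E) : P.valuation M (algebraMap E M x) < P.valuation M (algebraMap E M y) ↔
    (below E P).valuation E x < (below E P).valuation E y := by
  obtain ⟨e, he, h⟩ := below_val (E := E) P
  rw [h, h]; exact pow_lt_pow_iff_left₀ zero_le zero_le he

lemma below_le (P : Pl M) (x y : E) : P.valuation M (algebraMap E M x) ≤ P.valuation M (algebraMap E M y) ↔
    (below E P).valuation E x ≤ (below E P).valuation E y := by
  rw [← not_lt, below_lt, not_lt]

lemma below_eq (P : Pl M) (x y : E) : P.valuation M (algebraMap E M x) = P.valuation M (algebraMap E M y) ↔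
    (below E P).valuation E x = (below E P).valuation E y := by
  rw [le_antisymm_iff, below_le, below_le, ← le_antisymm_iff]

lemma below_eq_one (P : Pl M) (x : E) : P.valuation M (algebraMap E M x) = 1 ↔
    (below E P).valuation E x = 1 := by
  simpa using below_eq P x 1

lemma below_surj (v : Pl E) : ∃ P : Pl M, below E P = v := by
  obtain ⟨P, hP, hv⟩ := v.asIdeal.exists_ideal_over_prime_of_isIntegral_of_isDomain (S := 𝓞 M) (by simp)
  refine ⟨⟨P, hP, ?_⟩, ?_⟩
  · rintro rfl
    apply v.ne_bot
    rw [← hv]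
    exact Ideal.comap_bot_of_injective _ (FaithfulSMul.algebraMap_injective _ _)
  · ext1; exact hv

lemma below_fin (v : Pl E) : {P : Pl M | below E P = v}.Finite := by
  have h := IsDedekindDomain.primesOver_finite v.asIdeal (𝓞 M)
  refine Set.Finite.of_finite_image (f := fun P : Pl M => P.asIdeal) (h.subset ?_) ?_
  · rintro _ ⟨P, hP, rfl⟩
    refine ⟨P.isPrime, ⟨?_⟩⟩
    rw [← hP]; rfl
  · intro P _ Q _ h; exact HeightOneSpectrum.ext h

lemma below_preimage_fin {S : Set (Pl E)} (hS : S.Finite) : {P : Pl M | below E P ∈ S}.Finite := by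
  have : {P : Pl M | below E P ∈ S} = ⋃ v ∈ S, {P : Pl M | below E P = v} := by ext; simp
  rw [this]; exact hS.biUnion fun v _ => below_fin v

lemma IsQ.up {P : Pl M} {u : E} (h : IsQ (below E P) u) : IsQ P (algebraMap E M u) := by
  obtain ⟨t, ht⟩ := h
  refine ⟨algebraMap E M t, ?_⟩
  rw [← below_lt P, map_ofNat] at ht
  simpa using ht

lemma exists_conj (σ : M ≃ₐ[E] M) (P : Pl M) :
    ∃ P' : Pl M, ∀ x, P'.valuation M x = P.valuation M (σ x) := by
  let e : 𝓞 M ≃+* 𝓞 M := NumberField.RingOfIntegers.mapRingEquiv σ.toRingEquiv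
  have he : ∀ a : 𝓞 M, algebraMap _ M (e a) = σ (algebraMap _ M a) := fun a => rfl
  let P' : Pl M := HeightOneSpectrum.comap (e : 𝓞 M →+* 𝓞 M) e.surjective P
  have hmem : ∀ (n : ℕ) (a : 𝓞 M), a ∈ P'.asIdeal ^ n ↔ e a ∈ P.asIdeal ^ n := by
    intro n a
    have h1 : P'.asIdeal = P.asIdeal.map (e.symm : 𝓞 M →+* 𝓞 M) := by
      have := Ideal.map_symm (I := P.asIdeal) e
      exact this.symm
    rw [h1, ← Ideal.map_pow]
    have := Ideal.map_symm (I := P.asIdeal ^ n) e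
    constructor
    · intro h
      have h' : a ∈ Ideal.comap e (P.asIdeal ^ n) := by rw [← this]; exact h
      exact h'
    · intro h
      have h' : a ∈ Ideal.comap e (P.asIdeal ^ n) := h
      rw [← this] at h'; exact h'
  have hIntV : ∀ a : 𝓞 M, P'.intValuation a = P.intValuation (e a) := by
    intro a
    by_cases ha : a = 0
    · simp [ha]
    have ha' : e a ≠ 0 := by simpa using ha
    have h1 := P'.intValuation_eq_exp_neg_multiplicity ha
    have h2 := P.intValuation_eq_exp_neg_multiplicity ha'
    apply le_antisymm
    · rw [h2, intValuation_le_pow_iff_mem, hmem, ← intValuation_le_pow_iff_mem, h2]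
    · rw [h1, intValuation_le_pow_iff_mem, ← hmem, ← intValuation_le_pow_iff_mem, h1]
  refine ⟨P', fun x => ?_⟩
  obtain ⟨a, b, hb, rfl⟩ := IsFractionRing.div_surjective (A := 𝓞 M) x
  rw [map_div₀, map_div₀, map_div₀, ← he, ← he, valuation_of_algebraMap, valuation_of_algebraMap,
    valuation_of_algebraMap, valuation_of_algebraMap, hIntV, hIntV]

end ext
end Lh

namespace Lh
set_option linter.unusedSectionVars false

def sqr (G : Type*) [CommGroup G] : Subgroup G := (powMonoidHom 2 : G →* G).range

lemma mem_sqr {G : Type*} [CommGroup G] {x : G} : x ∈ sqr G ↔ ∃ y, y ^ 2 = x := Iff.rfl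

lemma index_dbl_pi (n : ℕ) :
    (nsmulAddMonoidHom 2 : (Fin n →₀ ℤ) →+ (Fin n →₀ ℤ)).range.index = 2 ^ n := by
  let f : (Fin n →₀ ℤ) →+ (Fin n → ZMod 2) :=
    { toFun := fun x i => (x i : ZMod 2)
      map_zero' := by ext; simp
      map_add' := by intros; ext; simp }
  have hk : f.ker = (nsmulAddMonoidHom 2 : (Fin n →₀ ℤ) →+ (Fin n →₀ ℤ)).range := by
    ext x
    constructor
    · intro h
      have h' : ∀ i, (2 : ℤ) ∣ x i := fun i => by
        have : (x i : ZMod 2) = 0 := congrFun h i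
        exact (ZMod.intCast_zmod_eq_zero_iff_dvd _ 2).1 this
      choose y hy using h'
      refine ⟨Finsupp.equivFunOnFinite.symm y, ?_⟩
      ext i; simp [hy]
    · rintro ⟨y, rfl⟩
      ext i
      have : (2 : ZMod 2) = 0 := by decide
      simp [f, this]
  have hs : Function.Surjective f := by
    intro y
    refine ⟨Finsupp.equivFunOnFinite.symm fun i => (y i).val, ?_⟩
    ext i; simp [f]
  rw [← hk, AddSubgroup.index_ker, AddMonoidHom.range_eq_top.2 hs]
  simp

lemma index_dbl_fin (T : Type*) [AddCommGroup T] [Finite T] :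
    (nsmulAddMonoidHom 2 : T →+ T).range.index = Nat.card (nsmulAddMonoidHom 2 : T →+ T).ker := by
  have h1 := AddSubgroup.card_mul_index (nsmulAddMonoidHom 2 : T →+ T).range
  have h2 := AddSubgroup.card_mul_index (nsmulAddMonoidHom 2 : T →+ T).ker
  rw [AddSubgroup.index_ker] at h2
  have h3 : Nat.card (nsmulAddMonoidHom 2 : T →+ T).range ≠ 0 := Nat.card_pos.ne'
  rw [← h1, mul_comm] at h2
  exact (Nat.mul_left_cancel (Nat.pos_of_ne_zero h3) h2).symm

lemma dbl_equiv {A B : Type*} [AddCommGroup A] [AddCommGroup B] (e : A ≃+ B) :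
    (nsmulAddMonoidHom 2 : A →+ A).range.index = (nsmulAddMonoidHom 2 : B →+ B).range.index ∧
    Nat.card (nsmulAddMonoidHom 2 : A →+ A).ker = Nat.card (nsmulAddMonoidHom 2 : B →+ B).ker := by
  constructor
  · rw [← AddSubgroup.index_comap_of_surjective _ e.surjective (f := e.toAddMonoidHom)]
    congr 1
    ext x
    constructor
    · rintro ⟨y, rfl⟩
      exact ⟨e y, by simp⟩
    · rintro ⟨y, hy⟩
      refine ⟨e.symm y, ?_⟩
      apply e.injective
      simpa using hy
  · refine Nat.card_congr (e.toEquiv.subtypeEquiv ?_)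
    intro a
    simp only [AddMonoidHom.mem_ker, nsmulAddMonoidHom_apply]
    change _ ↔ 2 • (e a) = 0
    rw [← map_nsmul]; exact (map_eq_zero_iff e e.injective).symm

lemma index_dbl (A : Type*) [AddCommGroup A] [Module.Finite ℤ A]
    (h : Nat.card (nsmulAddMonoidHom 2 : A →+ A).ker = 2) :
    (nsmulAddMonoidHom 2 : A →+ A).range.index = 2 ^ (Module.finrank ℤ A + 1) := by
  have : AddGroup.FG A := Module.Finite.iff_addGroup_fg.1 inferInstance
  obtain ⟨n, ι, fι, p, hp, e, ⟨f⟩⟩ := AddCommGroup.equiv_free_prod_directSum_zmod A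
  have hne : ∀ i, NeZero (p i ^ e i) := fun i => ⟨pow_ne_zero _ (hp i).ne_zero⟩
  classical
  let T := DirectSum ι fun i => ZMod (p i ^ e i)
  have hfT : Finite T :=
    Finite.of_equiv (∀ i, ZMod (p i ^ e i)) (DirectSum.addEquivProd (fun i => ZMod (p i ^ e i))).symm.toEquiv
  have f' : A ≃+ (Fin n →₀ ℤ) × T := f
  obtain ⟨h1, h2⟩ := dbl_equiv f'
  have hfr : Module.finrank ℤ A = n := by
    rw [LinearEquiv.finrank_eq (f'.toIntLinearEquiv)]
    have hT : Module.finrank ℤ T = 0 := by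
      have : Module.IsTorsion ℤ T := by
        intro x
        refine ⟨⟨(Nat.card T : ℤ), ?_⟩, ?_⟩
        · simp [Nat.card_pos.ne']
        · change (Nat.card T : ℤ) • x = 0
          rw [natCast_zsmul]; exact card_nsmul_eq_zero'
      exact Module.finrank_eq_zero_iff_isTorsion.2 this
    have hx := (Submodule.finrank_quotient_add_finrank (R := ℤ) (LinearMap.ker (LinearMap.fst ℤ (Fin n →₀ ℤ) T)))
    have e1 := LinearEquiv.finrank_eq ((LinearMap.fst ℤ (Fin n →₀ ℤ) T).quotKerEquivOfSurjective Prod.fst_surjective)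
    have e2 : Module.finrank ℤ (LinearMap.ker (LinearMap.fst ℤ (Fin n →₀ ℤ) T)) = 0 := by
      have : Module.IsTorsion ℤ (LinearMap.ker (LinearMap.fst ℤ (Fin n →₀ ℤ) T)) := by
        intro x
        refine ⟨⟨(Nat.card T : ℤ), ?_⟩, ?_⟩
        · simp [Nat.card_pos.ne']
        · change (Nat.card T : ℤ) • x = 0
          obtain ⟨⟨x1, x2⟩, hx⟩ := x
          have hx' : x1 = 0 := hx
          subst hx'
          ext1
          change (Nat.card T : ℤ) • ((0 : Fin n →₀ ℤ), x2) = 0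
          rw [Prod.smul_mk, smul_zero, natCast_zsmul, card_nsmul_eq_zero']; rfl
      exact (Module.finrank_eq_zero_iff_isTorsion (R := ℤ)
        (M := LinearMap.ker (LinearMap.fst ℤ (Fin n →₀ ℤ) T))).2 this
    rw [← hx, e1, e2]; simp
  rw [h1, hfr]
  have hr : (nsmulAddMonoidHom 2 : (Fin n →₀ ℤ) × T →+ _).range =
      ((nsmulAddMonoidHom 2 : (Fin n →₀ ℤ) →+ _).range).prod (nsmulAddMonoidHom 2 : T →+ _).range := by
    ext ⟨x, y⟩
    constructor
    · rintro ⟨⟨a, b⟩, hab⟩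
      obtain ⟨rfl, rfl⟩ := Prod.mk.inj hab
      exact ⟨⟨a, rfl⟩, ⟨b, rfl⟩⟩
    · rintro ⟨⟨a, ha⟩, ⟨b, hb⟩⟩
      exact ⟨(a, b), Prod.ext ha hb⟩
  rw [hr, AddSubgroup.index_prod, index_dbl_pi, index_dbl_fin, pow_succ]
  congr 1
  refine Eq.trans ?_ (h2.symm.trans h)
  refine Nat.card_congr ⟨fun x => ⟨(0, x.1), Prod.ext (by simp) x.2⟩, fun x => ⟨x.1.2, (Prod.ext_iff.1 x.2).2⟩,
    fun x => rfl, fun x => ?_⟩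
  obtain ⟨⟨a, b⟩, hab⟩ := x
  have ha : 2 • a = 0 := (Prod.ext_iff.1 hab).1
  have : a = 0 := by
    rcases smul_eq_zero.1 ha with h | h
    · norm_num at h
    · exact h
  subst this
  rfl

lemma index_sqr (G : Type*) [CommGroup G] [Module.Finite ℤ (Additive G)]
    (h : ∃ e : G, e ≠ 1 ∧ ∀ x : G, x ^ 2 = 1 ↔ x = 1 ∨ x = e) :
    (sqr G).index = 2 ^ (Module.finrank ℤ (Additive G) + 1) := by
  rw [← index_dbl (Additive G)]
  · rfl
  · obtain ⟨e, he, hx⟩ := h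
    have : ((nsmulAddMonoidHom 2 : Additive G →+ _).ker : Set (Additive G)) = {Additive.ofMul 1, Additive.ofMul e} := by
      ext x
      exact hx x.toMul
    change Nat.card ((nsmulAddMonoidHom 2 : Additive G →+ _).ker : Set (Additive G)) = 2
    rw [this, Nat.card_coe_set_eq, Set.ncard_pair]
    exact fun h => he (Additive.ofMul.injective h).symm
end Lh

namespace Lh
set_option linter.unusedSectionVars false
open IsDedekindDomain NumberField HeightOneSpectrum
open scoped WithZero
open WithZero (exp log exp_le_exp exp_inj log_mul exp_log)

variable {E : Type*} [Field E] [NumberField E]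

/-- the S-class group is trivial -/
def ClOne (S : Set (Pl E)) : Prop :=
  ∀ v : Pl E, v ∉ S → ∃ π : E, v.valuation E π = exp (-1 : ℤ) ∧ ∀ w : Pl E, w ∉ S → w ≠ v → w.valuation E π = 1

lemma ClOne.mono {S T : Set (Pl E)} (h : ClOne S) (hST : S ⊆ T) : ClOne T := by
  intro v hv
  obtain ⟨π, h1, h2⟩ := h v (fun h => hv (hST h))
  exact ⟨π, h1, fun w hw hne => h2 w (fun h => hw (hST h)) hne⟩

lemma le_prime_eq {v w : Pl E} (h : v.asIdeal ≤ w.asIdeal) : w = v := by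
  have := v.isMaximal
  ext1; exact (this.eq_of_le w.isPrime.ne_top h).symm

lemma exists_clOne : ∃ S : Set (Pl E), S.Finite ∧ ClOne S := by
  have hs : ∀ c : ClassGroup (𝓞 E), ∃ I : nonZeroDivisors (Ideal (𝓞 E)), ClassGroup.mk0 I = c :=
    ClassGroup.mk0_surjective
  choose I hI using hs
  refine ⟨⋃ c, {v | v.asIdeal ∣ (I c : Ideal (𝓞 E))}, Set.finite_iUnion fun c => ?_, ?_⟩
  · exact Ideal.finite_factors (nonZeroDivisors.ne_zero (I c).2)
  · intro v hv
    let v0 : nonZeroDivisors (Ideal (𝓞 E)) := ⟨v.asIdeal, mem_nonZeroDivisors_of_ne_zero v.ne_bot⟩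
    let c := (ClassGroup.mk0 v0)⁻¹
    have h1 : ClassGroup.mk0 (v0 * I c) = 1 := by
      rw [map_mul, hI]; exact mul_inv_cancel _
    rw [ClassGroup.mk0_eq_one_iff] at h1
    obtain ⟨a, ha⟩ := h1.principal
    have ha' : v.asIdeal * (I c : Ideal (𝓞 E)) = Ideal.span {a} := ha
    have hm : ∀ w : Pl E, a ∈ w.asIdeal ↔ w = v ∨ w.asIdeal ∣ I c := by
      intro w
      rw [← Ideal.span_singleton_le_iff_mem, ← ha', w.isPrime.mul_le, Ideal.dvd_iff_le]
      constructor
      · rintro (h | h)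
        · exact Or.inl (le_prime_eq h)
        · exact Or.inr h
      · rintro (rfl | h)
        · exact Or.inl le_rfl
        · exact Or.inr h
    have ha0 : a ≠ 0 := by
      rintro rfl
      have : (v0 * I c : Ideal (𝓞 E)) = 0 := by
        rw [show (v0 : Ideal (𝓞 E)) = v.asIdeal from rfl, ha']; simp
      exact nonZeroDivisors.ne_zero (v0 * I c).2 this
    refine ⟨algebraMap _ E a, ?_, ?_⟩
    · rw [valuation_of_algebraMap]
      have h1 : v.intValuation a ≤ exp (-((1 : ℕ) : ℤ)) := by
        rw [intValuation_le_pow_iff_mem, pow_one]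
        exact (hm v).2 (Or.inl rfl)
      have h2 : ¬ v.intValuation a ≤ exp (-((2 : ℕ) : ℤ)) := by
        rw [intValuation_le_pow_iff_mem]
        intro h
        rw [← Ideal.span_singleton_le_iff_mem, ← ha', ← Ideal.dvd_iff_le, pow_two] at h
        have h3 := (mul_dvd_mul_iff_left v.ne_bot).1 h
        apply hv
        exact Set.mem_iUnion.2 ⟨c, h3⟩
      rw [v.intValuation_eq_exp_neg_multiplicity ha0] at h1 h2 ⊢
      rw [exp_le_exp] at h1 h2
      rw [exp_inj]
      push_cast at h1 h2 ⊢
      lia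
    · intro w hw hne
      rw [valuation_eq_one_iff_notMem, hm]
      rintro (h | h)
      · exact hne h
      · exact hw (Set.mem_iUnion.2 ⟨c, h⟩)

lemma exists_pow_principal (v : Pl E) : ∃ a : E, a ≠ 0 ∧ v.valuation E a < 1 ∧ ∀ w, w ≠ v → w.valuation E a = 1 := by
  let v0 : nonZeroDivisors (Ideal (𝓞 E)) := ⟨v.asIdeal, mem_nonZeroDivisors_of_ne_zero v.ne_bot⟩
  have h1 : ClassGroup.mk0 (v0 ^ (Nat.card (ClassGroup (𝓞 E)))) = 1 := by
    rw [map_pow]; exact pow_card_eq_one'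
  have h0 : Nat.card (ClassGroup (𝓞 E)) ≠ 0 := Nat.card_pos.ne'
  generalize Nat.card (ClassGroup (𝓞 E)) = h at h1 h0
  rw [ClassGroup.mk0_eq_one_iff] at h1
  obtain ⟨a, ha⟩ := h1.principal
  have ha' : v.asIdeal ^ h = Ideal.span {a} := ha
  have hm : ∀ w : Pl E, a ∈ w.asIdeal ↔ w = v := by
    intro w
    rw [← Ideal.span_singleton_le_iff_mem, ← ha', w.isPrime.pow_le_iff h0]
    constructor
    · exact fun h => le_prime_eq h
    · rintro rfl; exact le_rfl
  have ha0 : a ≠ 0 := by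
    rintro rfl
    have : v.asIdeal ^ h = 0 := by rw [ha']; simp
    exact v.ne_bot (pow_eq_zero_iff h0 |>.1 this)
  refine ⟨algebraMap _ E a, by simpa using ha0, ?_, fun w hw => ?_⟩
  · rw [valuation_lt_one_iff_mem, hm]
  · rw [valuation_eq_one_iff_notMem, hm]; exact hw

noncomputable def logS (S : Finset (Pl E)) : Additive (Us (E := E) S) →+ (S → ℤ) where
  toFun x v := log ((v : Pl E).valuation E ((x.toMul : Eˣ) : E))
  map_zero' := by ext v; simp
  map_add' x y := by
    ext v
    simp only [toMul_add, Subgroup.coe_mul, Units.val_mul, map_mul, Pi.add_apply]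
    rw [log_mul] <;> simp

lemma mem_ker_logS (S : Finset (Pl E)) (x : Additive (Us (E := E) S)) :
    x ∈ (logS S).ker ↔ ∀ v : Pl E, v.valuation E ((x.toMul : Eˣ) : E) = 1 := by
  rw [AddMonoidHom.mem_ker]
  constructor
  · intro h v
    by_cases hv : v ∈ S
    · have := congrFun h ⟨v, hv⟩
      change log (v.valuation E ((x.toMul : Eˣ) : E)) = 0 at this
      have hne : v.valuation E ((x.toMul : Eˣ) : E) ≠ 0 := by simp
      rw [← exp_log hne, this]; rfl
    · exact x.toMul.2 v (by simpa using hv)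
  · intro h
    ext v
    change log (v.1.valuation E ((x.toMul : Eˣ) : E)) = 0
    rw [h]; simp

noncomputable def unitsToUs (S : Finset (Pl E)) : (𝓞 E)ˣ →* Us (E := E) S where
  toFun u := ⟨Units.map (algebraMap (𝓞 E) E : 𝓞 E →* E) u, by
    intro v _
    change v.valuation E (algebraMap (𝓞 E) E u) = 1
    rw [valuation_eq_one_iff_notMem]
    intro h
    exact v.isPrime.ne_top (Ideal.eq_top_of_isUnit_mem _ h u.isUnit)⟩
  map_one' := by ext; simp
  map_mul' x y := by ext; simp

lemma range_units (S : Finset (Pl E)) :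
    (MonoidHom.toAdditive (unitsToUs S)).range = (logS S).ker := by
  ext x
  rw [mem_ker_logS]
  constructor
  · rintro ⟨u, rfl⟩ v
    change v.valuation E (algebraMap (𝓞 E) E (u.toMul : 𝓞 E)) = 1
    rw [valuation_eq_one_iff_notMem]
    intro h
    exact v.isPrime.ne_top (Ideal.eq_top_of_isUnit_mem _ h (Additive.toMul u).isUnit)
  · intro h
    obtain ⟨a, ha⟩ := mem_integers_of_valuation_le_one E (((x.toMul : Us (E := E) S) : Eˣ) : E) (fun v => (h v).le)
    obtain ⟨b, hb⟩ := mem_integers_of_valuation_le_one E ((((x.toMul : Us (E := E) S) : Eˣ)⁻¹ : Eˣ) : E)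
      (fun v : Pl E => by simp [h v])
    have hab : a * b = 1 := by
      apply FaithfulSMul.algebraMap_injective (𝓞 E) E
      rw [map_mul]
      refine (congrArg₂ (· * ·) ha hb).trans ?_
      simp
    refine ⟨Additive.ofMul ⟨a, b, hab, by rw [mul_comm]; exact hab⟩, ?_⟩
    apply Additive.toMul.injective
    apply Subtype.ext
    ext
    exact ha

lemma unitsToUs_inj (S : Finset (Pl E)) : Function.Injective (unitsToUs S) := by
  intro x y h
  ext
  have := congrArg (fun z : Us (E := E) S => ((z : Eˣ) : E)) h
  exact this

theorem sunit (S : Finset (Pl E)) : Module.Finite ℤ (Additive (Us (E := E) S)) ∧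
    Module.finrank ℤ (Additive (Us (E := E) S)) + 1 = Fintype.card (InfinitePlace E) + S.card := by
  classical
  let φ := (logS S).toIntLinearMap
  have ek : Additive (𝓞 E)ˣ ≃ₗ[ℤ] LinearMap.ker φ := by
    have e1 := (AddMonoidHom.ofInjective (f := MonoidHom.toAdditive (unitsToUs S)) (unitsToUs_inj S))
    have e2 := e1.trans (AddEquiv.addSubgroupCongr (range_units S))
    exact e2.toIntLinearEquiv
  have hk : Module.finrank ℤ (LinearMap.ker φ) = NumberField.Units.rank E := by
    rw [← ek.finrank_eq, NumberField.Units.finrank_eq]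
  have : Module.Finite ℤ (LinearMap.ker φ) := Module.Finite.equiv ek
  have : Module.Finite ℤ (_ ⧸ LinearMap.ker φ) := Module.Finite.equiv φ.quotKerEquivRange.symm
  have hfin : Module.Finite ℤ (Additive (Us (E := E) S)) :=
    Module.Finite.of_submodule_quotient (LinearMap.ker φ)
  refine ⟨hfin, ?_⟩
  rw [← Submodule.finrank_quotient_add_finrank (LinearMap.ker φ), hk, φ.quotKerEquivRange.finrank_eq]
  have hr := Submodule.finrank_quotient_add_finrank (LinearMap.range φ)
  have hq : Module.finrank ℤ ((S → ℤ) ⧸ LinearMap.range φ) = 0 := by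
    rw [Module.finrank_eq_zero_iff_isTorsion]
    have hv : ∀ v : S, ∃ k : ℤ, k ≠ 0 ∧ k • Pi.single v (1 : ℤ) ∈ LinearMap.range φ := by
      intro v
      obtain ⟨a, ha, h1, h2⟩ := exists_pow_principal (v : Pl E)
      refine ⟨log ((v : Pl E).valuation E a), ?_, ?_⟩
      · intro h0
        have hne : (v : Pl E).valuation E a ≠ 0 := by simpa using ha
        rw [← exp_log hne, h0] at h1
        simp at h1
      · refine ⟨Additive.ofMul ⟨Units.mk0 a ha, fun w hw => h2 w ?_⟩, ?_⟩
        · rintro rfl; exact hw v.2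
        · ext w
          change log ((w : Pl E).valuation E a) = _
          by_cases hwv : w = v
          · subst hwv; simp
          · rw [h2 w (fun h => hwv (Subtype.ext h))]
            simp [hwv]
    choose k hk0 hk using hv
    intro x
    induction x using Submodule.Quotient.induction_on with | _ y => ?_
    refine ⟨⟨∏ v, k v, ?_⟩, ?_⟩
    · simp only [mem_nonZeroDivisors_iff_ne_zero]
      exact Finset.prod_ne_zero_iff.2 fun v _ => hk0 v
    · change (∏ v, k v) • (Submodule.Quotient.mk y : (S → ℤ) ⧸ LinearMap.range φ) = 0
      rw [← Submodule.Quotient.mk_smul, Submodule.Quotient.mk_eq_zero]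
      have : (∏ v, k v) • y = ∑ v, ((∏ w ∈ Finset.univ.erase v, k w) * y v) • (k v • Pi.single v (1 : ℤ)) := by
        ext w
        rw [Finset.sum_apply, Finset.sum_eq_single w]
        · simp only [Pi.smul_apply, Pi.single_eq_same, smul_eq_mul, mul_one]
          rw [← Finset.mul_prod_erase _ _ (Finset.mem_univ w)]; ring
        · intro b _ hb
          simp [hb.symm]
        · simp
      rw [this]
      exact Submodule.sum_mem _ fun v _ => Submodule.smul_mem _ _ (hk v)
  rw [hq, zero_add] at hr
  rw [hr]
  simp only [Module.finrank_fintype_fun_eq_card, Fintype.card_coe]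
  have : 0 < Fintype.card (InfinitePlace E) := Fintype.card_pos
  rw [NumberField.Units.rank]
  omega

instance (S : Finset (Pl E)) : Module.Finite ℤ (Additive (Us (E := E) S)) := (sunit S).1

lemma neg_one_us (H : Subgroup Eˣ) (h : (-1 : Eˣ) ∈ H) : ∃ e : H, e ≠ 1 ∧ ∀ x : H, x ^ 2 = 1 ↔ x = 1 ∨ x = e := by
  refine ⟨⟨-1, h⟩, ?_, ?_⟩
  · intro h
    have := congrArg (fun x : H => ((x : Eˣ) : E)) h
    norm_num at this
  · intro x
    constructor
    · intro hx
      have hx' : ((x : Eˣ) : E) ^ 2 = 1 := congrArg (fun x : H => ((x : Eˣ) : E)) hx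
      rcases (sq_eq_one_iff (a := ((x : Eˣ) : E))).1 hx' with h | h
      · left; ext; exact h
      · right; ext; exact h
    · rintro (rfl | rfl)
      · simp
      · ext; simp

theorem index_sqr_us (S : Finset (Pl E)) :
    (sqr (Us (E := E) S)).index = 2 ^ (Fintype.card (InfinitePlace E) + S.card) := by
  rw [index_sqr, (sunit S).2]
  apply neg_one_us
  intro v _
  simp
end Lh

namespace Lh
set_option linter.unusedSectionVars false

section grp
variable {X : Type*} [CommGroup X]

def fixG (σ : X →* X) : Subgroup X where
  carrier := {x | σ x = x}
  mul_mem' := by intro a b ha hb; change σ (a * b) = a * b; rw [map_mul, ha, hb]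
  one_mem' := map_one σ
  inv_mem' := by intro a ha; change σ a⁻¹ = a⁻¹; rw [map_inv, ha]

def nmG (σ : X →* X) : X →* X := MonoidHom.mk' (fun x => x * σ x) (by
  intro a b; rw [map_mul]; exact mul_mul_mul_comm a b (σ a) (σ b))

lemma nmG_apply (σ : X →* X) (x : X) : nmG σ x = x * σ x := rfl

def dvG (σ : X →* X) : X →* X := MonoidHom.mk' (fun x => x * (σ x)⁻¹) (by
  intro a b; rw [map_mul, mul_inv]; exact mul_mul_mul_comm a b (σ a)⁻¹ (σ b)⁻¹)

lemma dvG_apply (σ : X →* X) (x : X) : dvG σ x = x * (σ x)⁻¹ := rfl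

lemma relIndex_sq (H : Subgroup X) : (H.map (powMonoidHom 2)).relIndex H = (sqr H).index := by
  unfold Subgroup.relIndex
  congr 1
  ext x
  rw [Subgroup.mem_subgroupOf, Subgroup.mem_map, mem_sqr]
  constructor
  · rintro ⟨y, hy, h⟩
    exact ⟨⟨y, hy⟩, Subtype.ext h⟩
  · rintro ⟨y, h⟩
    exact ⟨y, y.2, congrArg Subtype.val h⟩

theorem grp [Module.Finite ℤ (Additive X)] (σ : X →* X) (hσσ : ∀ x, σ (σ x) = x)
    (e : X) (he1 : e ≠ 1) (he : ∀ x : X, x ^ 2 = 1 ↔ x = 1 ∨ x = e) (hσe : σ e = e)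
    (h90 : ∀ y, y * σ y = 1 → ∃ x, y = x * (σ x)⁻¹) :
    (nmG σ).range.relIndex (fixG σ) * 2 ^ (Module.finrank ℤ (Additive X) + 1) ≤
      (sqr (fixG σ)).index * 2 ^ (Module.finrank ℤ (Additive (fixG σ))) := by
  set U := fixG σ
  set Y := (nmG σ).ker with hY
  have hNU : (nmG σ).range ≤ U := by
    rintro _ ⟨x, rfl⟩
    change σ (x * σ x) = x * σ x
    rw [map_mul, hσσ, mul_comm]
  have hUN : U.map (powMonoidHom 2) ≤ (nmG σ).range := by
    rintro _ ⟨x, hx, rfl⟩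
    refine ⟨x, ?_⟩
    have hx' : σ x = x := hx
    simp [nmG_apply, hx', pow_two]
  have hdY : (dvG σ).range = Y := by
    ext y
    constructor
    · rintro ⟨x, rfl⟩
      rw [hY, MonoidHom.mem_ker, nmG_apply, dvG_apply, map_mul, map_inv, hσσ]
      group
    · intro hy
      obtain ⟨x, hx⟩ := h90 y hy
      exact ⟨x, hx.symm⟩
  have hcomap : (U.map (powMonoidHom 2)).comap (nmG σ) = (Y.map (powMonoidHom 2)).comap (dvG σ) := by
    ext x
    simp only [Subgroup.mem_comap, Subgroup.mem_map, powMonoidHom_apply, nmG_apply, dvG_apply]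
    constructor
    · rintro ⟨u, hu, h⟩
      have hu' : σ u = u := hu
      refine ⟨x * u⁻¹, ?_, ?_⟩
      · rw [hY, MonoidHom.mem_ker, nmG_apply, map_mul, map_inv, hu', mul_mul_mul_comm, ← h]
        group
      · rw [mul_pow, inv_pow, h, pow_two, mul_inv]
        rw [mul_mul_mul_comm, mul_inv_cancel, one_mul]
    · rintro ⟨y, hy, h⟩
      have hy' : y * σ y = 1 := hy
      have hsy : σ y = y⁻¹ := (inv_eq_of_mul_eq_one_right hy').symm
      refine ⟨x * y⁻¹, ?_, ?_⟩
      · change σ _ = _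
        rw [map_mul, map_inv, hsy, inv_inv]
        have : σ x = x * (y ^ 2)⁻¹ := by rw [h, mul_inv, inv_inv, mul_inv_cancel_left]
        rw [this, pow_two, mul_inv]; group
      · rw [mul_pow, inv_pow, h, pow_two, mul_inv, inv_inv, mul_mul_mul_comm, mul_inv_cancel, one_mul]
  have hidx : (U.map (powMonoidHom 2)).relIndex (nmG σ).range = (sqr Y).index := by
    rw [← Subgroup.index_comap, hcomap, Subgroup.index_comap, hdY, relIndex_sq]
  have hmul := Subgroup.relIndex_mul_relIndex _ _ _ hUN hNU
  rw [hidx, relIndex_sq] at hmul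
  -- ranks
  let ν : Additive X →ₗ[ℤ] Additive X := (MonoidHom.toAdditive (nmG σ)).toIntLinearMap
  have hfk : Module.finrank ℤ (Additive Y) = Module.finrank ℤ (LinearMap.ker ν) := rfl
  have hfinY : Module.Finite ℤ (Additive Y) := by
    have : Module.Finite ℤ (LinearMap.ker ν) := inferInstance
    exact this
  have hUfin : Module.Finite ℤ (AddSubgroup.toIntSubmodule (Subgroup.toAddSubgroup U)) := inferInstance
  have hrU : Module.finrank ℤ (LinearMap.range ν) ≤ Module.finrank ℤ (Additive U) := by
    have hle : LinearMap.range ν ≤ AddSubgroup.toIntSubmodule (Subgroup.toAddSubgroup U) := by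
      rintro _ ⟨x, rfl⟩
      exact hNU ⟨x.toMul, rfl⟩
    exact Submodule.finrank_mono hle
  have hrn := Submodule.finrank_quotient_add_finrank (LinearMap.ker ν)
  rw [ν.quotKerEquivRange.finrank_eq] at hrn
  have hsY : (sqr Y).index = 2 ^ (Module.finrank ℤ (Additive Y) + 1) := by
    apply index_sqr
    refine ⟨⟨e, ?_⟩, ?_, ?_⟩
    · rw [hY, MonoidHom.mem_ker, nmG_apply, hσe, ← pow_two]
      exact (he e).2 (Or.inr rfl)
    · intro h; exact he1 (congrArg Subtype.val h)
    · intro x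
      have := he x
      simp only [Subtype.ext_iff]
      exact this
  rw [← hmul, hsY, mul_comm (2 ^ (Module.finrank ℤ (Additive Y) + 1)), mul_assoc, ← pow_add]
  refine Nat.mul_le_mul_left _ (Nat.pow_le_pow_right (by norm_num) ?_)
  rw [hfk]
  omega
end grp
end Lh

namespace Lh
set_option linter.unusedSectionVars false
open IsDedekindDomain NumberField HeightOneSpectrum
open scoped WithZero
open WithZero (exp log exp_le_exp exp_inj log_mul exp_log)

structure QExt (E M : Type*) [Field E] [Field M] [Algebra E M] (u : E) where
  α : M
  σ : M ≃ₐ[E] M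
  hα : α ^ 2 = algebraMap E M u
  hσ : σ α = -α
  span : ∀ x, ∃ s t : E, x = algebraMap E M s + algebraMap E M t * α
  hu : ¬ IsSquare u

theorem exists_qext.{w} {E : Type w} [Field E] [NumberField E] (u : E) (hu : ¬ IsSquare u) :
    ∃ (M : Type w) (_ : Field M) (_ : NumberField M) (_ : Algebra E M), Nonempty (QExt E M u) := by
  have hf : Fact (∀ r : E, r ^ 2 ≠ u + 0 * r) := ⟨fun r h => hu ⟨r, by rw [← pow_two, h]; ring⟩⟩
  have hα : (QuadraticAlgebra.omega : (QuadraticAlgebra E u 0)) ^ 2 = algebraMap E (QuadraticAlgebra E u 0) u := by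
    rw [pow_two, QuadraticAlgebra.omega_mul_omega_eq_mk]; rfl
  have hnf : NumberField (QuadraticAlgebra E u 0) := by
    have h1 : CharZero (QuadraticAlgebra E u 0) := inferInstance
    have h3 : FiniteDimensional E (QuadraticAlgebra E u 0) := inferInstance
    have : IsScalarTower ℚ E (QuadraticAlgebra E u 0) := inferInstance
    have h4 : FiniteDimensional ℚ (QuadraticAlgebra E u 0) := FiniteDimensional.trans ℚ E (QuadraticAlgebra E u 0)
    exact @NumberField.mk (QuadraticAlgebra E u 0) _ h1 h4
  let σ0 : (QuadraticAlgebra E u 0) →ₐ[E] (QuadraticAlgebra E u 0) := QuadraticAlgebra.lift ⟨-QuadraticAlgebra.omega, by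
    rw [neg_mul_neg, QuadraticAlgebra.omega_mul_omega_eq_mk]
    ext <;> simp [QuadraticAlgebra.re_one, QuadraticAlgebra.im_one]⟩
  have hσ0 : σ0 QuadraticAlgebra.omega = - QuadraticAlgebra.omega := by
    simp [σ0, QuadraticAlgebra.lift]
  have hσσ : σ0.comp σ0 = AlgHom.id E (QuadraticAlgebra E u 0) := by
    apply QuadraticAlgebra.algHom_ext
    rw [AlgHom.comp_apply, hσ0, map_neg, hσ0, neg_neg]; rfl
  refine ⟨(QuadraticAlgebra E u 0), inferInstance, hnf, inferInstance, ⟨⟨QuadraticAlgebra.omega, AlgEquiv.ofAlgHom σ0 σ0 hσσ hσσ, hα, hσ0, ?_, hu⟩⟩⟩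
  intro x
  refine ⟨x.re, x.im, ?_⟩
  ext <;> simp [QuadraticAlgebra.algebraMap_eq, QuadraticAlgebra.re_mul]

variable {E M : Type*} [Field E] [NumberField E] [Field M] [NumberField M] [Algebra E M] {u : E}

namespace QExt

lemma u_ne (q : QExt E M u) : u ≠ 0 := by rintro rfl; exact q.hu ⟨0, by simp⟩

lemma α_ne (q : QExt E M u) : q.α ≠ 0 := by
  intro h
  have := q.hα
  rw [h, zero_pow two_ne_zero, eq_comm, map_eq_zero] at this
  exact q.u_ne this

lemma σ_mk (q : QExt E M u) (s t : E) : q.σ (algebraMap E M s + algebraMap E M t * q.α) =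
    algebraMap E M s - algebraMap E M t * q.α := by
  rw [map_add, map_mul, AlgEquiv.commutes, AlgEquiv.commutes, q.hσ]; ring

lemma σσ (q : QExt E M u) (x : M) : q.σ (q.σ x) = x := by
  obtain ⟨s, t, rfl⟩ := q.span x
  rw [q.σ_mk, map_sub, map_mul, AlgEquiv.commutes, AlgEquiv.commutes, q.hσ]; ring

lemma nm (q : QExt E M u) (s t : E) : (algebraMap E M s + algebraMap E M t * q.α) *
    q.σ (algebraMap E M s + algebraMap E M t * q.α) = algebraMap E M (s ^ 2 - u * t ^ 2) := by
  rw [q.σ_mk, map_sub, map_mul, map_pow, map_pow, ← q.hα]; ring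

lemma fix (q : QExt E M u) {x : M} (h : q.σ x = x) : ∃ s : E, algebraMap E M s = x := by
  obtain ⟨s, t, rfl⟩ := q.span x
  rw [q.σ_mk] at h
  have h2 : 2 * (algebraMap E M t * q.α) = 0 := by linear_combination -h
  refine ⟨s, ?_⟩
  rcases mul_eq_zero.1 h2 with h | h
  · norm_num at h
  · rw [h, add_zero]

/-- squares of M lying in E -/
lemma sq_down (q : QExt E M u) {x : E} (h : IsSquare (algebraMap E M x)) : IsSquare x ∨ IsSquare (x * u) := by
  obtain ⟨y, hy⟩ := h
  obtain ⟨s, t, rfl⟩ := q.span y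
  have hinj := (algebraMap E M).injective
  have h1 : (algebraMap E M (x - s ^ 2 - u * t ^ 2)) = algebraMap E M (2 * s * t) * q.α := by
    simp only [map_sub, map_mul, map_pow, map_ofNat, ← q.hα, hy]; ring
  have h2 : 2 * (algebraMap E M (2 * s * t) * q.α) = 0 := by
    have h3 := congrArg q.σ h1
    rw [map_mul, AlgEquiv.commutes, AlgEquiv.commutes, q.hσ] at h3
    linear_combination h3 - h1
  have h3 : (2 * s * t) = 0 := by
    rcases mul_eq_zero.1 h2 with h | h
    · norm_num at h
    · rcases mul_eq_zero.1 h with h | h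
      · simpa using h
      · exact absurd h q.α_ne
  have h4 : x - s ^ 2 - u * t ^ 2 = 0 := by
    apply hinj; rw [h1, h3]; simp
  rcases mul_eq_zero.1 h3 with h | h
  · have hs : s = 0 := by simpa using h
    right
    exact ⟨u * t, by rw [hs] at h4; linear_combination u * h4⟩
  · left
    exact ⟨s, by rw [h] at h4; linear_combination h4⟩

lemma finrank_two (q : QExt E M u) : Module.finrank E M = 2 := by
  have hli : LinearIndependent E ![(1 : M), q.α] := by
    rw [LinearIndependent.pair_iff]
    intro s t h
    rw [Algebra.smul_def, Algebra.smul_def, mul_one] at h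
    have h2 := congrArg q.σ h
    rw [q.σ_mk, map_zero] at h2
    constructor
    · have : 2 * algebraMap E M s = 0 := by linear_combination h + h2
      simpa using this
    · have : 2 * (algebraMap E M t * q.α) = 0 := by linear_combination h - h2
      simpa [q.α_ne] using this
  have hsp : ⊤ ≤ Submodule.span E (Set.range ![(1 : M), q.α]) := by
    rintro x -
    obtain ⟨s, t, rfl⟩ := q.span x
    simp only [Matrix.range_cons, Matrix.range_empty, Set.union_empty, Set.union_singleton]
    rw [Submodule.mem_span_pair]
    exact ⟨t, s, by rw [Algebra.smul_def, Algebra.smul_def]; ring⟩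
  rw [Module.finrank_eq_card_basis (Module.Basis.mk hli hsp)]; simp

lemma card_inf (q : QExt E M u) [IsTotallyComplex E] :
    Fintype.card (InfinitePlace M) = 2 * Fintype.card (InfinitePlace E) := by
  have hM : IsTotallyComplex M := isTotallyComplex_of_algebra (F := E) (K := M)
  have h : ∀ (L : Type _) [Field L] [NumberField L] [IsTotallyComplex L],
    Module.finrank ℚ L = 2 * Fintype.card (InfinitePlace L) := by
    intro L _ _ _
    rw [IsTotallyComplex.finrank, InfinitePlace.card_eq_nrRealPlaces_add_nrComplexPlaces,
      IsTotallyComplex.nrRealPlaces_eq_zero, zero_add]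
  have h' : Module.finrank ℚ E = 2 * Fintype.card (InfinitePlace E) := by
    rw [IsTotallyComplex.finrank, InfinitePlace.card_eq_nrRealPlaces_add_nrComplexPlaces,
      IsTotallyComplex.nrRealPlaces_eq_zero, zero_add]
  have ht := Module.finrank_mul_finrank ℚ E M
  rw [h M, h', q.finrank_two] at ht
  omega

lemma conj (q : QExt E M u) (P : Pl M) : ∃ P' : Pl M, below E P' = below E P ∧ ∀ x, P'.valuation M x = P.valuation M (q.σ x) := by
  obtain ⟨P', h⟩ := exists_conj q.σ P
  refine ⟨P', ?_, h⟩
  ext a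
  have h1 := below_lt (E := E) P' (a : E) 1
  have h2 := below_lt (E := E) P (a : E) 1
  simp only [map_one, h, AlgEquiv.commutes] at h1 h2
  rw [← valuation_lt_one_iff_mem (K := E), ← valuation_lt_one_iff_mem (K := E)]
  exact h1.symm.trans h2

/-- splitting -/
lemma split (q : QExt E M u) {v : Pl E} (hv : IsQ v u) : ∃ P P' : Pl M, P ≠ P' ∧ below E P = v ∧ below E P' = v := by
  obtain ⟨P, rfl⟩ := below_surj (M := M) v
  obtain ⟨P', hb, hP'⟩ := q.conj P
  refine ⟨P, P', ?_, rfl, hb⟩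
  rintro rfl
  obtain ⟨t, ht⟩ := hv
  set θ : M := (1 + algebraMap E M t * q.α) / 2 with hθ
  have hσθ : q.σ θ = (1 - algebraMap E M t * q.α) / 2 := by
    rw [hθ, map_div₀, map_ofNat, map_add, map_one, map_mul, AlgEquiv.commutes, q.hσ]; ring
  have hsum : θ + q.σ θ = 1 := by rw [hσθ, hθ]; ring
  have hprod : θ * q.σ θ = - algebraMap E M ((u * t ^ 2 - 1)) / 4 := by
    rw [hσθ, hθ]
    simp only [map_sub, map_mul, map_pow, map_one, ← q.hα]; ring
  have h4 : P.valuation M (4 : M) ≠ 0 := by simp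
  have hlt : P.valuation M (θ * q.σ θ) < 1 := by
    rw [hprod, map_div₀, Valuation.map_neg, div_lt_one₀ ((Valuation.pos_iff _).2 (by norm_num))]
    rw [← below_lt, map_ofNat] at ht
    exact ht
  rw [map_mul, ← hP'] at hlt
  have hθ1 : P.valuation M θ < 1 := by
    by_contra hc
    rw [not_lt] at hc
    exact absurd hlt (not_lt.2 (by simpa using mul_le_mul' hc hc))
  have h1 : P.valuation M (θ + q.σ θ) < 1 :=
    Valuation.map_add_lt _ hθ1 (by rw [← hP']; exact hθ1)
  rw [hsum, map_one] at h1
  exact lt_irrefl _ h1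

end QExt

/-- the set of norms -/
def normG (u : E) : Subgroup Eˣ where
  carrier := {x | ∃ s t : E, (x : E) = s ^ 2 - u * t ^ 2}
  mul_mem' := by
    rintro a b ⟨s, t, h⟩ ⟨s', t', h'⟩
    refine ⟨s * s' + u * t * t', s * t' + t * s', ?_⟩
    rw [Units.val_mul, h, h']; ring
  one_mem' := ⟨1, 0, by simp⟩
  inv_mem' := by
    rintro a ⟨s, t, h⟩
    refine ⟨s / a, t / a, ?_⟩
    rw [div_pow, div_pow, ← mul_div_assoc, ← sub_div, ← h, Units.val_inv_eq_inv_val]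
    field_simp

lemma mem_normG {u : E} {x : Eˣ} : x ∈ normG u ↔ ∃ s t : E, (x : E) = s ^ 2 - u * t ^ 2 := Iff.rfl

lemma ClOne.glue {S : Set (Pl E)} (h : ClOne S) (f : Pl E → E) (hf : ∀ v ∉ S, f v ≠ 0)
    (hfin : {v | v ∉ S ∧ v.valuation E (f v) ≠ 1}.Finite) :
    ∃ b : E, b ≠ 0 ∧ ∀ v ∉ S, v.valuation E b = v.valuation E (f v) := by
  classical
  have h' : ∀ v : Pl E, ∃ π : E, v ∉ S → (v.valuation E π = exp (-1 : ℤ) ∧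
      ∀ w : Pl E, w ∉ S → w ≠ v → w.valuation E π = 1) := by
    intro v
    by_cases hv : v ∈ S
    · exact ⟨1, fun h => absurd hv h⟩
    · obtain ⟨π, hπ⟩ := h v hv
      exact ⟨π, fun _ => hπ⟩
  choose π hπ using h'
  refine ⟨∏ w ∈ hfin.toFinset, π w ^ (-log (w.valuation E (f w))), ?_, ?_⟩
  · refine Finset.prod_ne_zero_iff.2 fun w hw => zpow_ne_zero _ ?_
    intro h0
    have := (hπ w (by simpa using ((hfin.mem_toFinset).1 hw).1)).1
    rw [h0, map_zero] at this
    exact WithZero.exp_ne_zero this.symm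
  · intro v hv
    rw [map_prod]
    by_cases h1 : v.valuation E (f v) = 1
    · rw [h1]
      apply Finset.prod_eq_one
      intro w hw
      have hw' := (hfin.mem_toFinset).1 hw
      have hne : v ≠ w := by rintro rfl; exact hw'.2 h1
      rw [map_zpow₀, (hπ w hw'.1).2 v hv hne, _root_.one_zpow]
    · rw [Finset.prod_eq_single v]
      · rw [map_zpow₀, (hπ v hv).1, ← WithZero.exp_zsmul]
        have : v.valuation E (f v) ≠ 0 := by simpa using hf v hv
        conv_rhs => rw [← exp_log this]
        simp
      · intro w hw hne
        have hw' := (hfin.mem_toFinset).1 hw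
        rw [map_zpow₀, (hπ w hw'.1).2 v hv hne.symm, _root_.one_zpow]
      · intro hn
        exact absurd ((hfin.mem_toFinset).2 ⟨hv, h1⟩) hn
end Lh

namespace Lh
set_option linter.unusedSectionVars false
open IsDedekindDomain NumberField HeightOneSpectrum
open scoped WithZero
open WithZero (exp log exp_le_exp exp_inj log_mul exp_log)
variable {E M : Type*} [Field E] [NumberField E] [Field M] [NumberField M] [Algebra E M] {u : E}

lemma QExt.h90 (q : QExt E M u) {S : Set (Pl E)} (hcl : ClOne S)
    (hS : ∀ v ∉ S, v.valuation E 2 = 1 ∧ ∃ t, v.valuation E (u * t ^ 2) = 1)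
    (y : M) (hy : ∀ P : Pl M, below E P ∉ S → P.valuation M y = 1) (hn : y * q.σ y = 1) :
    ∃ x : M, x ≠ 0 ∧ (∀ P : Pl M, below E P ∉ S → P.valuation M x = 1) ∧ y = x * (q.σ x)⁻¹ := by
  classical
  obtain ⟨z, hz0, hz⟩ : ∃ z : M, z ≠ 0 ∧ y * q.σ z = z := by
    by_cases h : y = -1
    · exact ⟨q.α, q.α_ne, by rw [h, q.hσ]; ring⟩
    · refine ⟨1 + y, fun h' => h (by linear_combination h'), ?_⟩
      rw [map_add, map_one, mul_add, hn]; ring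
  obtain ⟨s, t, rfl⟩ := q.span z
  have hσz := q.σ_mk s t
  set z := algebraMap E M s + algebraMap E M t * q.α with hzdef
  have hPσ : ∀ P : Pl M, below E P ∉ S → P.valuation M (q.σ z) = P.valuation M z := by
    intro P hP
    conv_rhs => rw [← hz, map_mul, hy P hP, one_mul]
  have hc' : ∀ v : Pl E, ∃ c : E, v ∉ S → v.valuation E (u * c ^ 2) = 1 := by
    intro v
    by_cases hv : v ∈ S
    · exact ⟨0, fun h => absurd hv h⟩
    · obtain ⟨c, hc⟩ := (hS v hv).2
      exact ⟨c, fun _ => hc⟩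
  choose c hc using hc'
  have hc0 : ∀ v ∉ S, c v ≠ 0 := by
    intro v hv h0
    have := hc v hv
    rw [h0] at this; simp at this
  let b : Pl E → E := fun v => if v.valuation E (t / c v) ≤ v.valuation E s then s else t / c v
  have hb : ∀ P : Pl M, below E P ∉ S → P.valuation M (algebraMap E M (b (below E P))) = P.valuation M z := by
    intro P hP
    have h2 : P.valuation M 2 = 1 := by
      have := (below_eq_one P (2 : E)).2 (hS _ hP).1
      rwa [map_ofNat] at this
    have hα : P.valuation M (algebraMap E M (c (below E P)) * q.α) = 1 := by
      have h1 := (below_eq_one P _).2 (hc _ hP)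
      have h3 : (algebraMap E M (u * c (below E P) ^ 2)) = (algebraMap E M (c (below E P)) * q.α) ^ 2 := by
        rw [map_mul, map_pow, ← q.hα]; ring
      rw [h3, map_pow] at h1
      exact (pow_eq_one_iff_of_nonneg zero_le two_ne_zero).1 h1
    have hcM : algebraMap E M (c (below E P)) ≠ 0 := by
      rw [Ne, map_eq_zero]; exact hc0 _ hP
    have htα : P.valuation M (algebraMap E M t * q.α) = P.valuation M (algebraMap E M (t / c (below E P))) := by
      have : algebraMap E M t * q.α = algebraMap E M (t / c (below E P)) * (algebraMap E M (c (below E P)) * q.α) := by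
        rw [map_div₀]; field_simp
      rw [this, map_mul, hα, mul_one]
    have hs : P.valuation M (algebraMap E M s) ≤ P.valuation M z := by
      have : 2 * algebraMap E M s = z + q.σ z := by rw [hσz, hzdef]; ring
      have h := congrArg (P.valuation M) this
      rw [map_mul, h2, one_mul] at h
      rw [h]
      exact Valuation.map_add_le _ le_rfl (hPσ P hP).le
    have ht : P.valuation M (algebraMap E M t * q.α) ≤ P.valuation M z := by
      have : 2 * (algebraMap E M t * q.α) = z - q.σ z := by rw [hσz, hzdef]; ring
      have h := congrArg (P.valuation M) this
      rw [map_mul, h2, one_mul] at h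
      rw [h]
      exact (Valuation.map_sub _ _ _).trans (max_le le_rfl (hPσ P hP).le)
    dsimp only [b]
    split_ifs with hif
    · refine le_antisymm hs ?_
      refine Valuation.map_add_le _ le_rfl ?_
      rw [htα]; exact (below_le P _ _).2 hif
    · rw [← htα]
      refine le_antisymm ht (Valuation.map_add_le _ ?_ le_rfl)
      rw [htα]; exact (below_le P _ _).2 (not_le.1 hif).le
  have hb0 : ∀ v ∉ S, b v ≠ 0 := by
    intro v hv h0
    obtain ⟨P, rfl⟩ := below_surj (M := M) v
    have := hb P hv
    rw [h0, map_zero, map_zero, eq_comm, map_eq_zero] at this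
    exact hz0 this
  obtain ⟨β, hβ0, hβ⟩ := hcl.glue b hb0 (by
    refine ((finite_supp hz0).image (below E)).subset ?_
    rintro v ⟨hv, hv1⟩
    obtain ⟨P, rfl⟩ := below_surj (M := M) v
    refine ⟨P, ?_, rfl⟩
    change P.valuation M z ≠ 1
    rw [← hb P hv, Ne, below_eq_one]; exact hv1)
  have hβM : algebraMap E M β ≠ 0 := by rwa [Ne, map_eq_zero]
  refine ⟨z / algebraMap E M β, div_ne_zero hz0 hβM, ?_, ?_⟩
  · intro P hP
    have : P.valuation M (algebraMap E M β) = P.valuation M z := by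
      rw [← hb P hP, below_eq]; exact hβ _ hP
    rw [map_div₀, this, div_self]
    rwa [Ne, map_eq_zero]
  · have hσz0 : q.σ z ≠ 0 := by rwa [Ne, map_eq_zero_iff _ q.σ.injective]
    rw [map_div₀, AlgEquiv.commutes, inv_div]
    field_simp
    exact hz

/-- counting primes above -/
lemma QExt.count (q : QExt E M u) (S : Finset (Pl E)) (SM : Finset (Pl M))
    (hSM : ∀ P, P ∈ SM ↔ below E P ∈ S) [DecidablePred fun v : Pl E => ¬ IsQ v u] :
    2 * S.card ≤ SM.card + (S.filter fun v => ¬ IsQ v u).card := by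
  classical
  rw [Finset.card_eq_sum_card_fiberwise (f := below E) (s := SM) (t := S) (fun P hP => (hSM P).1 hP),
    Finset.card_filter, ← Finset.sum_add_distrib, mul_comm, ← smul_eq_mul, ← Finset.sum_const]
  refine Finset.sum_le_sum fun v hv => ?_
  by_cases h : IsQ v u
  · obtain ⟨P, P', hne, h1, h2⟩ := q.split h
    have : 1 < (SM.filter fun P' => below E P' = v).card :=
      Finset.one_lt_card.2 ⟨P, by simp [hSM, h1, hv], P', by simp [hSM, h2, hv], hne⟩
    exact le_trans this (Nat.le_add_right _ _)
  · obtain ⟨P, rfl⟩ := below_surj (M := M) v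
    have : 0 < (SM.filter fun P' => below E P' = below E P).card :=
      Finset.card_pos.2 ⟨P, by simp [hSM, hv]⟩
    rw [if_pos h]
    exact Nat.succ_le_succ this

theorem thmH [IsTotallyComplex E] (q : QExt E M u) (S : Finset (Pl E)) (hcl : ClOne (S : Set (Pl E)))
    (hS : ∀ v ∉ S, v.valuation E 2 = 1 ∧ ∃ t, v.valuation E (u * t ^ 2) = 1)
    [DecidablePred fun v : Pl E => ¬ IsQ v u] :
    (normG u).relIndex (Us (E := E) S) ≠ 0 ∧
    2 * (normG u).relIndex (Us (E := E) S) ≤ 2 ^ (S.filter fun v => ¬ IsQ v u).card := by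
  classical
  set SM : Finset (Pl M) := (below_preimage_fin (M := M) S.finite_toSet).toFinset with hSMdef
  have hSM : ∀ P, P ∈ SM ↔ below E P ∈ S := by intro P; simp [SM]
  have hcount := q.count S SM hSM
  have memX : ∀ x : Mˣ, x ∈ Us (E := M) (SM : Set (Pl M)) ↔ ∀ P : Pl M, below E P ∉ S → P.valuation M (x : M) = 1 := by
    intro x; rw [mem_Us]
    simp only [Finset.mem_coe, hSM]
  let σu : Mˣ →* Mˣ := Units.map (q.σ : M →* M)
  have hσu : ∀ x ∈ Us (E := M) (SM : Set (Pl M)), σu x ∈ Us (E := M) (SM : Set (Pl M)) := by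
    intro x hx
    rw [memX] at hx ⊢
    intro P hP
    obtain ⟨P', h1, h2⟩ := q.conj P
    have := hx P' (by rwa [h1])
    rwa [h2] at this
  let X := Us (E := M) (SM : Set (Pl M))
  let σ : X →* X := (σu.comp X.subtype).codRestrict X (fun x => hσu x x.2)
  have hσv : ∀ x : X, ((σ x : Mˣ) : M) = q.σ ((x : Mˣ) : M) := fun x => rfl
  have hm1 : (-1 : Mˣ) ∈ X := by rw [memX]; intro P _; simp
  obtain ⟨e, he1, he⟩ := neg_one_us X hm1
  have hσσ : ∀ x, σ (σ x) = x := by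
    intro x; apply Subtype.ext; apply Units.ext; rw [hσv, hσv, q.σσ]
  have hσe : σ e = e := by
    have h1 : (σ e) ^ 2 = 1 := by rw [← map_pow, (he e).2 (Or.inr rfl), map_one]
    rcases (he _).1 h1 with h | h
    · exfalso; apply he1; rw [← hσσ e, h, map_one]
    · exact h
  have key := grp σ hσσ e he1 he hσe (by
    intro y hy
    have hy' : ((y : Mˣ) : M) * q.σ ((y : Mˣ) : M) = 1 := by
      have := congrArg (fun x : X => ((x : Mˣ) : M)) hy
      simpa [hσv] using this
    obtain ⟨x, hx0, hx, hxy⟩ := q.h90 hcl hS _ ((memX _).1 y.2) hy'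
    refine ⟨⟨Units.mk0 x hx0, (memX _).2 hx⟩, ?_⟩
    apply Subtype.ext; apply Units.ext
    rw [hxy]
    simp [hσv])
  -- the fixed group
  let ι : Eˣ →* Mˣ := Units.map (algebraMap E M : E →* M)
  have hι : Function.Injective ι := Units.map_injective (algebraMap E M).injective
  have hιX : ∀ x : Eˣ, ι x ∈ X ↔ x ∈ Us (E := E) S := by
    intro x
    rw [memX, mem_Us]
    constructor
    · intro h v hv
      obtain ⟨P, rfl⟩ := below_surj (M := M) v
      exact (below_eq_one P _).1 (h P hv)
    · intro h P hP
      exact (below_eq_one P _).2 (h _ hP)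
  let f : Us (E := E) (S : Set (Pl E)) →* X := (ι.comp (Us (E := E) (S : Set (Pl E))).subtype).codRestrict X (fun x => (hιX _).2 x.2)
  have hfv : ∀ x, ((f x : Mˣ) : M) = algebraMap E M ((x : Eˣ) : E) := fun x => rfl
  have hfinj : Function.Injective f := by
    intro a b hab
    apply Subtype.ext; apply hι
    exact congrArg Subtype.val hab
  have hfr : f.range = fixG σ := by
    ext x
    constructor
    · rintro ⟨a, rfl⟩
      change σ (f a) = f a
      apply Subtype.ext; apply Units.ext; rw [hσv, hfv, AlgEquiv.commutes]
    · intro hx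
      have hx' : q.σ ((x : Mˣ) : M) = ((x : Mˣ) : M) := by
        rw [← hσv]; exact congrArg (fun x : X => ((x : Mˣ) : M)) hx
      obtain ⟨s, hs⟩ := q.fix hx'
      have hs0 : s ≠ 0 := by
        rintro rfl
        rw [map_zero] at hs
        exact (x : Mˣ).ne_zero hs.symm
      have hι' : ι (Units.mk0 s hs0) = x := Units.ext hs
      refine ⟨⟨Units.mk0 s hs0, (hιX _).1 (by rw [hι']; exact x.2)⟩, ?_⟩
      apply Subtype.ext; exact hι'
  let eq : Us (E := E) (S : Set (Pl E)) ≃* fixG σ :=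
    (MonoidHom.ofInjective hfinj).trans (MulEquiv.subgroupCongr hfr)
  have hrk : Module.finrank ℤ (Additive (fixG σ)) = Module.finrank ℤ (Additive (Us (E := E) (S : Set (Pl E)))) :=
    (LinearEquiv.finrank_eq (MulEquiv.toAdditive eq).toIntLinearEquiv).symm
  have hidx : (sqr (fixG σ)).index = (sqr (Us (E := E) (S : Set (Pl E)))).index := by
    have : (sqr (fixG σ)).comap (eq : _ →* fixG σ) = sqr (Us (E := E) (S : Set (Pl E))) := by
      ext x
      rw [Subgroup.mem_comap, mem_sqr, mem_sqr]
      constructor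
      · rintro ⟨y, hy⟩
        refine ⟨eq.symm y, ?_⟩
        apply eq.injective
        rw [map_pow, MulEquiv.apply_symm_apply]; exact hy
      · rintro ⟨y, rfl⟩
        exact ⟨eq y, by simp⟩
    rw [← this, Subgroup.index_comap_of_surjective _ eq.surjective]
  have hrel : (normG u).relIndex (Us (E := E) S) ∣ (nmG σ).range.relIndex (fixG σ) := by
    have h1 : (nmG σ).range.relIndex (fixG σ) = ((nmG σ).range.comap f).index := by
      rw [Subgroup.index_comap, hfr]
    rw [h1]
    apply Subgroup.index_dvd_of_le
    rintro x ⟨y, hy⟩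
    rw [Subgroup.mem_subgroupOf, mem_normG]
    obtain ⟨s, t, hst⟩ := q.span ((y : Mˣ) : M)
    refine ⟨s, t, ?_⟩
    apply (algebraMap E M).injective
    rw [← q.nm, ← hst]
    have := congrArg (fun x : X => ((x : Mˣ) : M)) hy
    exact this.symm
  have hnz : (nmG σ).range.relIndex (fixG σ) ≠ 0 := by
    intro h0
    have hle : (fixG σ).map (powMonoidHom 2) ≤ (nmG σ).range := by
      rintro _ ⟨x, hx, rfl⟩
      refine ⟨x, ?_⟩
      have hx' : σ x = x := hx
      rw [nmG_apply, hx']; exact (pow_two x).symm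
    have h1 := Subgroup.relIndex_dvd_of_le_left (fixG σ) hle
    rw [h0, relIndex_sq, hidx, index_sqr_us] at h1
    exact absurd (zero_dvd_iff.1 h1) (by positivity)
  have hle := Nat.le_of_dvd (Nat.pos_of_ne_zero hnz) hrel
  refine ⟨fun h0 => hnz (by rw [h0] at hrel; exact zero_dvd_iff.1 hrel), ?_⟩
  rw [hidx, index_sqr_us, hrk, (sunit SM).2, q.card_inf] at key
  have hr := (sunit (E := E) S).2
  set r := Fintype.card (InfinitePlace E)
  set k := Module.finrank ℤ (Additive (Us (E := E) (S : Set (Pl E))))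
  set a := (nmG σ).range.relIndex (fixG σ)
  set n := (S.filter fun v => ¬ IsQ v u).card
  have h1 : a * 2 ^ (2 * r + SM.card) * 2 ≤ 2 ^ (r + S.card + (r + S.card)) := by
    calc a * 2 ^ (2 * r + SM.card) * 2 ≤ 2 ^ (r + S.card) * 2 ^ k * 2 := Nat.mul_le_mul_right 2 key
      _ = 2 ^ (r + S.card + (k + 1)) := by ring
      _ = _ := by rw [hr]
  have h2 : 2 ^ (r + S.card + (r + S.card)) ≤ 2 ^ n * 2 ^ (2 * r + SM.card) := by
    rw [← pow_add]; apply Nat.pow_le_pow_right (by norm_num); omega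
  have h3 : (2 * a) * 2 ^ (2 * r + SM.card) ≤ 2 ^ n * 2 ^ (2 * r + SM.card) := by
    refine le_trans (le_of_eq ?_) (h1.trans h2); ring
  have h4 := Nat.le_of_mul_le_mul_right h3 (by positivity)
  omega
end Lh

namespace Lh
set_option linter.unusedSectionVars false
open IsDedekindDomain NumberField HeightOneSpectrum
open scoped WithZero
open WithZero (exp log exp_le_exp exp_inj log_mul exp_log)
variable {E M : Type*} [Field E] [NumberField E] [Field M] [NumberField M] [Algebra E M] {u : E}

lemma exists_prime_notMem {S : Set (Pl E)} (hS : S.Finite) : ∃ l : Pl E, l ∉ S := by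
  classical
  let N := ∏ v ∈ hS.toFinset, Ideal.absNorm v.asIdeal
  have hN : N ≠ 0 := Finset.prod_ne_zero_iff.2 fun v _ => by
    rw [Ne, Ideal.absNorm_eq_zero_iff]; exact v.ne_bot
  obtain ⟨p, hp, hpp⟩ := Nat.exists_infinite_primes (N + 1)
  have hpN : Nat.Coprime p N := by
    rw [hpp.coprime_iff_not_dvd]
    intro h
    have := Nat.le_of_dvd (Nat.pos_of_ne_zero hN) h
    omega
  have hne : Ideal.span {((p : ℕ) : 𝓞 E)} ≠ ⊤ := by
    intro h
    rw [← Ideal.absNorm_eq_one_iff, Ideal.absNorm_span_natCast] at h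
    have h1 : 0 < Module.finrank ℤ (𝓞 E) := Module.finrank_pos
    exact hpp.one_lt.ne' ((pow_eq_one_iff.1 h).resolve_right h1.ne')
  obtain ⟨m, hm, hle⟩ := Ideal.exists_le_maximal _ hne
  have hpm : ((p : ℕ) : 𝓞 E) ∈ m := hle (Ideal.mem_span_singleton_self _)
  refine ⟨⟨m, hm.isPrime, ?_⟩, ?_⟩
  · rintro rfl
    rw [Ideal.mem_bot, Nat.cast_eq_zero] at hpm
    exact hpp.ne_zero hpm
  · intro h
    have hNm : ((N : ℕ) : 𝓞 E) ∈ m := by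
      obtain ⟨k, hk⟩ := Finset.dvd_prod_of_mem (fun v : Pl E => Ideal.absNorm v.asIdeal) (hS.mem_toFinset.2 h)
      rw [show N = _ from hk, Nat.cast_mul]
      exact m.mul_mem_right _ (Ideal.absNorm_mem m)
    apply hm.ne_top
    rw [Ideal.eq_top_iff_one]
    obtain ⟨a, b, hab⟩ := (Nat.isCoprime_iff_coprime.2 hpN)
    have : (a : 𝓞 E) * (p : ℕ) + (b : 𝓞 E) * (N : ℕ) = 1 := by exact_mod_cast congrArg (Int.cast : ℤ → 𝓞 E) hab
    rw [← this]
    exact m.add_mem (m.mul_mem_left _ hpm) (m.mul_mem_left _ hNm)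

lemma wapprox (T : Finset (Pl E)) (f ε : Pl E → E) (hε : ∀ v ∈ T, ε v ≠ 0) :
    ∃ w : E, ∀ v ∈ T, v.valuation E (w - f v) < v.valuation E (ε v) := by
  classical
  obtain ⟨d, hd⟩ := IsLocalization.exist_integer_multiples (nonZeroDivisors (𝓞 E)) T f
  have hd0 : algebraMap (𝓞 E) E d ≠ 0 := by simp
  choose g hg using hd
  have hn : ∀ v : Pl E, ∃ n : ℕ, v ∈ T → exp (-(n : ℤ)) < v.valuation E (ε v * algebraMap (𝓞 E) E d) := by
    intro v
    by_cases hv : v ∈ T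
    · have h0 : v.valuation E (ε v * algebraMap (𝓞 E) E d) ≠ 0 := by
        rw [Ne, map_eq_zero]; exact mul_ne_zero (hε v hv) hd0
      refine ⟨(1 - log (v.valuation E (ε v * algebraMap (𝓞 E) E d))).toNat, fun _ => ?_⟩
      conv_rhs => rw [← exp_log h0]
      rw [WithZero.exp_lt_exp]
      omega
    · exact ⟨0, fun h => absurd h hv⟩
  choose n hn using hn
  obtain ⟨a, ha⟩ := IsDedekindDomain.exists_forall_sub_mem_ideal (s := T) (fun v : Pl E => v.asIdeal) n
    (fun v _ => v.prime) (fun v _ w _ h h' => h (HeightOneSpectrum.ext h')) (fun v => g v.1 v.2)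
  refine ⟨algebraMap (𝓞 E) E a / algebraMap (𝓞 E) E d, fun v hv => ?_⟩
  have h1 : algebraMap (𝓞 E) E a / algebraMap (𝓞 E) E d - f v = algebraMap (𝓞 E) E (a - g v hv) / algebraMap (𝓞 E) E d := by
    rw [map_sub, hg, Algebra.smul_def]; field_simp
  rw [h1, map_div₀, div_lt_iff₀ ((Valuation.pos_iff _).2 hd0), ← map_mul]
  refine lt_of_le_of_lt ?_ (hn v hv)
  rw [valuation_of_algebraMap]
  exact (v.intValuation_le_pow_iff_mem _ _).2 (ha v hv)

theorem thmI.{w} {E : Type w} [Field E] [NumberField E] [IsTotallyComplex E] {u : E} (hu0 : u ≠ 0) (hu : ¬ IsSquare u) {S0 : Set (Pl E)}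
    (hS0 : S0.Finite) : ∃ v ∉ S0, ¬ IsQ v u := by
  classical
  by_contra! hcon
  obtain ⟨l, hl⟩ := exists_prime_notMem hS0
  obtain ⟨π, hπ⟩ := l.valuation_exists_uniformizer E
  have hπ0 : π ≠ 0 := by rintro rfl; rw [map_zero] at hπ; exact WithZero.exp_ne_zero hπ.symm
  obtain ⟨w, hw⟩ := wapprox (insert l hS0.toFinset) (fun v => if v = l then π else u)
    (fun v => if v = l then π else 4 * u) (by
      intro v _
      split_ifs
      · exact hπ0
      · exact mul_ne_zero (by norm_num) hu0)
  have hwl : l.valuation E w = exp (-1 : ℤ) := by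
    have h := hw l (Finset.mem_insert_self _ _)
    simp only [if_true] at h
    have h2 := Valuation.map_add_eq_of_lt_left _ h
    rw [add_sub_cancel, hπ] at h2
    exact h2
  have hodd : ∀ y : E, l.valuation E w = l.valuation E (y * y) → False := by
    intro y hy
    rw [hwl, map_mul] at hy
    have hy0 : l.valuation E y ≠ 0 := by
      intro h; rw [h, mul_zero] at hy; exact WithZero.exp_ne_zero hy
    rw [← exp_log hy0, ← WithZero.exp_add, exp_inj] at hy
    omega
  have hw0 : w ≠ 0 := by rintro rfl; rw [map_zero] at hwl; exact WithZero.exp_ne_zero hwl.symm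
  have hwsq : ¬ IsSquare w := by
    rintro ⟨y, hy⟩; exact hodd y (by rw [hy])
  have huw : ¬ IsSquare (u * w) := by
    rintro ⟨y, hy⟩
    obtain ⟨t, ht⟩ := hcon l hl
    have h1 := IsQ.eq_one ht
    apply hodd (y * t)
    have : (y * t) * (y * t) = (u * t ^ 2) * w := by linear_combination (-t ^ 2) * hy
    rw [this, map_mul, h1, one_mul]
  obtain ⟨L, _, _, _, ⟨q⟩⟩ := exists_qext w hwsq
  have hL : IsTotallyComplex L := isTotallyComplex_of_algebra (F := E) (K := L)
  have huL : ¬ IsSquare (algebraMap E L u) := fun h => (q.sq_down h).elim hu huw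
  have hQ : ∀ P : Pl L, IsQ P (algebraMap E L u) := by
    intro P
    by_cases hP : below E P ∈ S0
    · have h := hw (below E P) (Finset.mem_insert_of_mem (hS0.mem_toFinset.2 hP))
      have hne : below E P ≠ l := by rintro h; exact hl (h ▸ hP)
      simp only [if_neg hne] at h
      have h2 := (IsQ.of_close hu0 h).up
      rw [map_mul, ← q.hα, mul_comm, IsQ.mul_sq_iff q.α_ne] at h2
      exact h2
    · exact (hcon _ hP).up
  obtain ⟨M, _, _, _, ⟨q'⟩⟩ := exists_qext _ huL
  obtain ⟨S, hSf, hcl⟩ := exists_clOne (E := L)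
  have hf : (S ∪ {v : Pl L | v.valuation L 2 ≠ 1}).Finite := hSf.union finite_dyadic
  have := thmH q' hf.toFinset (by rw [Set.Finite.coe_toFinset]; exact hcl.mono Set.subset_union_left) (by
    intro v hv
    rw [Set.Finite.mem_toFinset, Set.mem_union, not_or, Set.mem_ofPred_eq, not_not] at hv
    obtain ⟨t, ht⟩ := hQ v
    exact ⟨hv.2, t, IsQ.eq_one ht⟩)
  have hemp : (hf.toFinset.filter fun v => ¬ IsQ v (algebraMap E L u)) = ∅ := by
    rw [Finset.filter_eq_empty_iff]; intro v _; exact not_not.2 (hQ v)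
  rw [hemp] at this
  simp only [Finset.card_empty, pow_zero] at this
  omega

theorem thmT.{w} {E : Type w} [Field E] [NumberField E] [IsTotallyComplex E] {u u1 : E} (hu10 : u1 ≠ 0)
    (hu0 : u ≠ 0) (hu : ¬ IsSquare u) (huu : ¬ IsSquare (u * u1)) {S0 : Set (Pl E)}
    (hS0 : S0.Finite) : ∃ v ∉ S0, IsQ v u1 ∧ ¬ IsQ v u := by
  by_cases h1 : IsSquare u1
  · obtain ⟨v, hv, h⟩ := thmI hu0 hu hS0
    obtain ⟨y, rfl⟩ := h1
    refine ⟨v, hv, ?_, h⟩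
    rw [← pow_two]
    exact IsQ.sq (by rintro rfl; simp at hu10)
  obtain ⟨L, _, _, _, ⟨q⟩⟩ := exists_qext u1 h1
  have hL : IsTotallyComplex L := isTotallyComplex_of_algebra (F := E) (K := L)
  have huL : ¬ IsSquare (algebraMap E L u) := fun h => (q.sq_down h).elim hu huu
  have hf : (S0 ∪ {v : Pl E | v.valuation E 2 ≠ 1} ∪ {v : Pl E | v.valuation E u ≠ 1} ∪ {v : Pl E | v.valuation E u1 ≠ 1}).Finite :=
    ((hS0.union finite_dyadic).union (finite_supp hu0)).union (finite_supp hu10)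
  obtain ⟨P, hP, hQ⟩ := thmI (by rwa [Ne, map_eq_zero]) huL (below_preimage_fin (M := L) hf)
  simp only [Set.mem_ofPred_eq, Set.mem_union, not_or, not_not] at hP
  obtain ⟨⟨⟨hP0, hP2⟩, hPu⟩, hPu1⟩ := hP
  have hnQ : ¬ IsQ (below E P) u := fun h => hQ h.up
  refine ⟨below E P, hP0, ?_, hnQ⟩
  by_contra hc
  have := (isQ_mul_of_not hP2 hPu hPu1 hnQ hc).up
  rw [map_mul, ← q.hα, IsQ.mul_sq_iff q.α_ne] at this
  exact hQ this
end Lh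

namespace Lh
set_option linter.unusedSectionVars false
open IsDedekindDomain NumberField HeightOneSpectrum
open scoped WithZero
open WithZero (exp log exp_le_exp exp_inj log_mul exp_log)
variable {E : Type*} [Field E] [NumberField E]

lemma val_exp_neg {v : Pl E} {x : 𝓞 E} {n : ℕ} : v.valuation E (algebraMap _ E x) ≤ exp (-(n : ℤ)) ↔ x ∈ v.asIdeal ^ n := by
  rw [valuation_of_algebraMap]; exact v.intValuation_le_pow_iff_mem _ _

lemma card_quot_pow (v : Pl E) (n : ℕ) : Nat.card (𝓞 E ⧸ v.asIdeal ^ n) = Ideal.absNorm v.asIdeal ^ n := by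
  rw [← map_pow, Ideal.absNorm_apply]; rfl

lemma finite_quot_pow (v : Pl E) (n : ℕ) : Finite (𝓞 E ⧸ v.asIdeal ^ n) := by
  apply Nat.finite_of_card_ne_zero
  rw [card_quot_pow]
  apply pow_ne_zero
  rw [Ne, Ideal.absNorm_eq_zero_iff]; exact v.ne_bot

lemma card_tors (v : Pl E) (e : ℕ) (he : v.valuation E 2 = exp (-(e : ℤ))) :
    Nat.card {y : 𝓞 E ⧸ v.asIdeal ^ (2 * e + 1) // y ^ 2 = 1} ≤ 2 * Ideal.absNorm v.asIdeal ^ e := by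
  classical
  have hfin := finite_quot_pow v (2 * e + 1)
  have hle : v.asIdeal ^ (2 * e + 1) ≤ v.asIdeal ^ (e + 1) := Ideal.pow_le_pow_right (by omega)
  let g := Ideal.Quotient.factor hle
  have hgs : Function.Surjective g := Ideal.Quotient.factor_surjective hle
  let k := g.toAddMonoidHom.ker
  have hk : Nat.card k = Ideal.absNorm v.asIdeal ^ e := by
    have h1 := AddSubgroup.card_mul_index k
    rw [AddSubgroup.index_ker, card_quot_pow] at h1
    have h2 : Nat.card g.toAddMonoidHom.range = Ideal.absNorm v.asIdeal ^ (e + 1) := by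
      rw [← card_quot_pow]
      have h5 : g.toAddMonoidHom.range = ⊤ := AddMonoidHom.range_eq_top.2 hgs
      rw [h5]
      exact Nat.card_congr AddSubgroup.topEquiv.toEquiv
    have h0 : 0 < Ideal.absNorm v.asIdeal := Nat.pos_of_ne_zero (by
      rw [Ne, Ideal.absNorm_eq_zero_iff]; exact v.ne_bot)
    rw [h2] at h1
    apply Nat.eq_of_mul_eq_mul_right (pow_pos h0 (e + 1))
    rw [h1, ← pow_add]; congr 1; omega
  have hdich : ∀ y : 𝓞 E ⧸ v.asIdeal ^ (2 * e + 1), y ^ 2 = 1 → g (y - 1) = 0 ∨ g (y + 1) = 0 := by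
    intro y hy
    obtain ⟨a, rfl⟩ := Ideal.Quotient.mk_surjective y
    have h1 : (a - 1) * (a + 1) ∈ v.asIdeal ^ (2 * e + 1) := by
      rw [← Ideal.Quotient.eq_zero_iff_mem]
      simp only [map_mul, map_sub, map_add, map_one]
      linear_combination hy
    have hg1 : g (Ideal.Quotient.mk _ a - 1) = Ideal.Quotient.mk _ (a - 1) := by simp [g]
    have hg2 : g (Ideal.Quotient.mk _ a + 1) = Ideal.Quotient.mk _ (a + 1) := by simp [g]
    rw [hg1, hg2, Ideal.Quotient.eq_zero_iff_mem, Ideal.Quotient.eq_zero_iff_mem,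
      ← val_exp_neg, ← val_exp_neg]
    rw [← val_exp_neg, map_mul, map_mul] at h1
    by_contra! hc
    set p := v.valuation E (algebraMap _ E (a - 1)) with hp
    set r := v.valuation E (algebraMap _ E (a + 1)) with hr
    have h0p : p ≠ 0 := by intro h; rw [h] at hc; exact absurd hc.1 (not_lt.2 zero_le)
    have h0r : r ≠ 0 := by intro h; rw [h] at hc; exact absurd hc.2 (not_lt.2 zero_le)
    rw [← exp_log h0p, ← exp_log h0r] at hc h1
    rw [WithZero.exp_lt_exp, WithZero.exp_lt_exp] at hc
    rw [← WithZero.exp_add, exp_le_exp] at h1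
    push_cast at hc h1
    omega
  let φ : {y : 𝓞 E ⧸ v.asIdeal ^ (2 * e + 1) // y ^ 2 = 1} → Bool × k := fun y =>
    if h : g (y.1 - 1) = 0 then (true, ⟨y.1 - 1, h⟩) else
      (false, ⟨y.1 + 1, (hdich y.1 y.2).resolve_left h⟩)
  have hφ : Function.Injective φ := by
    intro y z h
    dsimp only [φ] at h
    split_ifs at h with h1 h2 h2
    · have h3 := congrArg Subtype.val (Prod.mk.inj h).2
      exact Subtype.ext (by simpa using h3)
    · simp at h
    · simp at h
    · have h3 := congrArg Subtype.val (Prod.mk.inj h).2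
      exact Subtype.ext (by simpa using h3)
  have := Nat.card_le_card_of_injective φ hφ
  rwa [Nat.card_prod, hk, Nat.card_eq_fintype_card (α := Bool), Fintype.card_bool] at this

lemma index_sqr_fin (G : Type*) [CommGroup G] [Finite G] : (sqr G).index = Nat.card {y : G // y ^ 2 = 1} := by
  have h1 := Subgroup.card_mul_index (sqr G)
  have h2 := Subgroup.card_mul_index (powMonoidHom 2 : G →* G).ker
  rw [Subgroup.index_ker] at h2
  have h3 : Nat.card (powMonoidHom 2 : G →* G).ker = Nat.card {y : G // y ^ 2 = 1} := rfl
  rw [← h3]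
  have h4 : 0 < Nat.card (sqr G) := Nat.card_pos
  apply Nat.eq_of_mul_eq_mul_left h4
  rw [h1, ← h2, mul_comm]; rfl

lemma exists_rep (v : Pl E) {π : E} (hπ : v.valuation E π = exp (-1 : ℤ)) {x : E} (hx : x ≠ 0) :
    ∃ (b : Bool) (a : 𝓞 E) (s : E), s ≠ 0 ∧ a ∉ v.asIdeal ∧
      x = algebraMap _ E a * π ^ (b.toNat) * s ^ 2 := by
  have hπ0 : π ≠ 0 := by rintro rfl; rw [map_zero] at hπ; exact WithZero.exp_ne_zero hπ.symm
  have hx0 : v.valuation E x ≠ 0 := by rwa [Ne, map_eq_zero]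
  obtain ⟨b, j, hbj⟩ : ∃ (b : Bool) (j : ℤ), - log (v.valuation E x) = b.toNat + 2 * j := by
    rcases Int.even_or_odd' (- log (v.valuation E x)) with ⟨j, h | h⟩
    · exact ⟨false, j, by rw [h]; simp⟩
    · exact ⟨true, j, by rw [h]; simp; ring⟩
  have hu : v.valuation E (x * (π ^ b.toNat)⁻¹ * (π ^ (-j)) ^ 2) = 1 := by
    have hp : v.valuation E π ≠ 0 := by rw [hπ]; exact WithZero.exp_ne_zero
    rw [map_mul, map_mul, map_inv₀, map_pow, map_pow, map_zpow₀, ← exp_log hx0, hπ, ← WithZero.exp_nsmul,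
      ← WithZero.exp_zsmul, ← WithZero.exp_nsmul, ← WithZero.exp_neg, ← WithZero.exp_add, ← WithZero.exp_add, ← WithZero.exp_zero, exp_inj]
    simp only [smul_eq_mul, nsmul_eq_mul]
    push_cast
    linarith
  obtain ⟨a, d, ha, hd, had⟩ := exists_frac hu
  have hd0 : algebraMap (𝓞 E) E d ≠ 0 := by
    rw [Ne, map_eq_zero_iff _ (RingOfIntegers.coe_injective)]
    rintro rfl; exact hd (Ideal.zero_mem _)
  refine ⟨b, a * d, (algebraMap _ E d)⁻¹ * π ^ j, mul_ne_zero (inv_ne_zero hd0) (zpow_ne_zero _ hπ0), ?_, ?_⟩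
  · intro h
    exact (v.isPrime.mem_or_mem h).elim ha hd
  · have hj : π ^ j ≠ 0 := zpow_ne_zero _ hπ0
    have hb : π ^ b.toNat ≠ 0 := pow_ne_zero _ hπ0
    rw [_root_.zpow_neg] at had
    field_simp at had
    rw [map_mul]
    field_simp
    rw [had]; ring

theorem F2 (v : Pl E) (e : ℕ) (he : v.valuation E 2 = exp (-(e : ℤ))) :
    (Qs v).index ≠ 0 ∧ (Qs v).index ≤ 4 * Ideal.absNorm v.asIdeal ^ e := by
  classical
  have hfin := finite_quot_pow v (2 * e + 1)
  set R := 𝓞 E ⧸ v.asIdeal ^ (2 * e + 1)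
  have hidx : (sqr Rˣ).index ≤ 2 * Ideal.absNorm v.asIdeal ^ e := by
    rw [index_sqr_fin]
    refine le_trans (Nat.card_le_card_of_injective
      (fun y : {y : Rˣ // y ^ 2 = 1} => (⟨((y : Rˣ) : R), by
        rw [← Units.val_pow_eq_pow_val, y.2, Units.val_one]⟩ : {y : R // y ^ 2 = 1})) ?_) (card_tors v e he)
    intro y z h
    exact Subtype.ext (Units.ext (congrArg Subtype.val h))
  obtain ⟨π, hπ⟩ := v.valuation_exists_uniformizer E
  choose b a s hs ha hx using fun x : Eˣ => exists_rep v hπ x.ne_zero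
  have hunit : ∀ c : 𝓞 E, c ∉ v.asIdeal ↔ IsUnit (Ideal.Quotient.mk (v.asIdeal ^ (2 * e + 1)) c) := by
    intro c
    constructor
    · intro hc
      have hmax := v.isMaximal
      have h1 : v.asIdeal ⊔ Ideal.span {c} = ⊤ := by
        by_contra hne
        have := hmax.eq_of_le hne le_sup_left
        apply hc
        rw [this]
        exact Ideal.mem_sup_right (Ideal.mem_span_singleton_self c)
      have h2 : v.asIdeal ^ (2 * e + 1) ⊔ Ideal.span {c} = ⊤ := Ideal.pow_sup_eq_top h1
      rw [Ideal.eq_top_iff_one, Submodule.mem_sup] at h2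
      obtain ⟨x, hx, y, hy, hxy⟩ := h2
      obtain ⟨z, rfl⟩ := Ideal.mem_span_singleton'.1 hy
      refine IsUnit.of_mul_eq_one (Ideal.Quotient.mk _ z) ?_
      rw [← map_mul, ← map_one (Ideal.Quotient.mk _), eq_comm, Ideal.Quotient.eq]
      rw [← hxy]
      convert hx using 1; ring
    · intro hu hc
      obtain ⟨z, hz⟩ := hu.exists_right_inv
      obtain ⟨z, rfl⟩ := Ideal.Quotient.mk_surjective z
      rw [← map_mul, ← map_one (Ideal.Quotient.mk _), Ideal.Quotient.eq] at hz
      apply v.isPrime.ne_top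
      rw [Ideal.eq_top_iff_one]
      have h1 := Ideal.pow_le_self (by omega : 2 * e + 1 ≠ 0) hz
      have := v.asIdeal.sub_mem (v.asIdeal.mul_mem_right z hc) h1
      simpa using this
  let A : Eˣ → Rˣ := fun x => ((hunit _).1 (ha x)).unit
  have hA : ∀ x, (A x : R) = Ideal.Quotient.mk _ (a x) := fun x => IsUnit.unit_spec _
  let f : Eˣ → Bool × (Rˣ ⧸ sqr Rˣ) := fun x => (b x, QuotientGroup.mk (A x))
  have hf : ∀ x y, f x = f y → x⁻¹ * y ∈ Qs v := by
    intro x y h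
    obtain ⟨h1, h2⟩ := Prod.mk.inj h
    rw [QuotientGroup.eq, mem_sqr] at h2
    obtain ⟨c, hc⟩ := h2
    have hc' : (A x) * c ^ 2 = A y := by rw [hc]; group
    obtain ⟨c0, hc0⟩ := Ideal.Quotient.mk_surjective (c : R)
    have hcu : c0 ∉ v.asIdeal := by rw [hunit, hc0]; exact c.isUnit
    have h3 : Ideal.Quotient.mk (v.asIdeal ^ (2 * e + 1)) (a y) = Ideal.Quotient.mk _ (a x * c0 ^ 2) := by
      rw [← hA, ← hc', Units.val_mul, hA, map_mul, map_pow, hc0]; simp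
    rw [Ideal.Quotient.eq, ← val_exp_neg (E := E)] at h3
    have hcv := (valuation_eq_one_iff_notMem (K := E) (v := v)).2 hcu
    have hxv := (valuation_eq_one_iff_notMem (K := E) (v := v)).2 (ha x)
    have hne : algebraMap (𝓞 E) E (a x * c0 ^ 2) ≠ 0 := by
      intro h
      have := congrArg (v.valuation E) h
      rw [map_mul, map_pow, map_mul, map_pow, hcv, hxv, map_zero] at this
      simp at this
    have hclose : IsQ v (algebraMap (𝓞 E) E (a y) * algebraMap (𝓞 E) E (a x * c0 ^ 2)) := by
      apply IsQ.of_close hne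
      rw [← map_sub]
      refine lt_of_le_of_lt h3 ?_
      rw [map_mul, map_mul, map_pow, map_mul, map_pow, hcv, hxv, one_pow, mul_one, mul_one, four_eq, he,
        ← WithZero.exp_nsmul, WithZero.exp_lt_exp]
      simp only [nsmul_eq_mul]
      push_cast
      omega
    have hcE : algebraMap (𝓞 E) E c0 ≠ 0 := by intro h; rw [h, map_zero] at hcv; simp at hcv
    rw [map_mul, map_pow, ← mul_assoc, IsQ.mul_sq_iff hcE] at hclose
    rw [mem_Qs]
    have hπ0 : π ≠ 0 := by rintro rfl; rw [map_zero] at hπ; exact WithZero.exp_ne_zero hπ.symm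
    have hxx := hx x
    have hyy := hx y
    have hxne : (x : E) ≠ 0 := x.ne_zero
    have heq : ((x⁻¹ * y : Eˣ) : E) = (algebraMap (𝓞 E) E (a y) * algebraMap (𝓞 E) E (a x)) * (π ^ (b x).toNat * s x * s y / x) ^ 2 := by
      rw [Units.val_mul, Units.val_inv_eq_inv_val]
      have h5 : (x : E) * y = (algebraMap (𝓞 E) E (a y) * algebraMap (𝓞 E) E (a x)) * (π ^ (b x).toNat * s x * s y) ^ 2 := by
        rw [hxx, hyy, ← h1]; ring
      rw [div_pow, ← mul_div_assoc, ← h5]; field_simp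
    rw [heq, IsQ.mul_sq_iff]
    · exact hclose
    · have := hs x; have := hs y
      positivity
  let φ : Eˣ ⧸ Qs v → Bool × (Rˣ ⧸ sqr Rˣ) := fun x => f x.out
  have hφ : Function.Injective φ := by
    intro x y h
    have := hf _ _ h
    rw [← QuotientGroup.eq] at this
    rwa [QuotientGroup.out_eq', QuotientGroup.out_eq'] at this
  have hfinq : Finite (Eˣ ⧸ Qs v) := Finite.of_injective φ hφ
  constructor
  · exact Nat.card_pos.ne'
  · have := Nat.card_le_card_of_injective φ hφ
    rw [Nat.card_prod, Nat.card_eq_fintype_card (α := Bool), Fintype.card_bool] at this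
    change (Qs v).index ≤ 2 * (sqr Rˣ).index at this
    linarith
end Lh

namespace Lh
set_option linter.unusedSectionVars false
open IsDedekindDomain NumberField HeightOneSpectrum
open scoped WithZero
open WithZero (exp log exp_le_exp exp_inj log_mul exp_log)

section grp2
variable {G : Type*} [CommGroup G]

lemma relIndex_le_two (V U : Subgroup G) (h : ∀ a ∈ U, ∀ b ∈ U, a ∉ V → b ∉ V → a * b ∈ V) :
    V.relIndex U ≠ 0 ∧ V.relIndex U ≤ 2 := by
  by_cases hUV : U ≤ V
  · rw [Subgroup.relIndex_eq_one.2 hUV]; norm_num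
  · obtain ⟨a, haU, haV⟩ := SetLike.not_le_iff_exists.1 hUV
    have : V.relIndex U = 2 := by
      unfold Subgroup.relIndex
      rw [Subgroup.index_eq_two_iff]
      refine ⟨⟨a, haU⟩, fun b => ?_⟩
      rw [Subgroup.mem_subgroupOf, Subgroup.mem_subgroupOf]
      change Xor ((b : G) * a ∈ V) ((b : G) ∈ V)
      by_cases hb : (b : G) ∈ V
      · right
        exact ⟨hb, fun h' => haV ((V.mul_mem_cancel_left hb).1 h')⟩
      · left
        exact ⟨h b b.2 a haU hb haV, hb⟩
    rw [this]; norm_num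

lemma relIndex_ge_two (V U : Subgroup G) (h0 : V.relIndex U ≠ 0) {a : G} (ha : a ∈ U) (haV : a ∉ V) :
    2 ≤ V.relIndex U := by
  have h1 : V.relIndex U ≠ 1 := fun h => haV (Subgroup.relIndex_eq_one.1 h ha)
  omega

lemma relIndex_eq_case (A B U : Subgroup G) (h0 : A.relIndex U ≠ 0) (hle : A.relIndex U ≤ B.relIndex U)
    (hAB : A ⊓ U ≤ B) : B ⊓ U ≤ A := by
  have h1 := Subgroup.relIndex_mul_relIndex (A ⊓ U) (B ⊓ U) U (le_inf hAB inf_le_right) inf_le_right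
  rw [Subgroup.inf_relIndex_right, Subgroup.inf_relIndex_right] at h1
  have h2 : (A ⊓ U).relIndex (B ⊓ U) ≠ 0 := by intro h; rw [h, zero_mul] at h1; exact h0 h1.symm
  have h3 : B.relIndex U ≠ 0 := by intro h; rw [h, mul_zero] at h1; exact h0 h1.symm
  have h4 : (A ⊓ U).relIndex (B ⊓ U) = 1 := by
    by_contra hne
    have : 2 ≤ (A ⊓ U).relIndex (B ⊓ U) := by omega
    have := Nat.mul_le_mul_right (B.relIndex U) this
    omega
  exact (Subgroup.relIndex_eq_one.1 h4).trans inf_le_left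

lemma index_count (U Q P : Subgroup G) (hQP : Q ≤ P) (h0 : Q.index ≠ 0) (h : Q.index ≤ 2 * Q.relIndex U) :
    P.index ≤ 2 * P.relIndex U := by
  have h1 := Subgroup.relIndex_mul_index (H := Q) (K := U ⊔ Q) le_sup_right
  have h2 := Subgroup.relIndex_mul_index (H := P) (K := U ⊔ P) le_sup_right
  rw [Subgroup.relIndex_sup_right] at h1 h2
  have h3 : (U ⊔ P).index ∣ (U ⊔ Q).index := Subgroup.index_dvd_of_le (sup_le_sup_left hQP U)
  have ha : 0 < Q.relIndex U := Nat.pos_of_ne_zero (by intro h; rw [h, zero_mul] at h1; exact h0 h1.symm)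
  have hj : (U ⊔ Q).index ≠ 0 := by intro h; rw [h, mul_zero] at h1; exact h0 h1.symm
  have h4 : (U ⊔ Q).index ≤ 2 := by
    by_contra! hc
    have := Nat.mul_le_mul_left (Q.relIndex U) hc
    rw [h1] at this
    simp at this
    omega
  have h5 := (Nat.le_of_dvd (Nat.pos_of_ne_zero hj) h3).trans h4
  rw [← h2, mul_comm]
  exact Nat.mul_le_mul_right _ h5
end grp2

variable {E : Type*} [Field E] [NumberField E]

def QT (T : Finset (Pl E)) : Subgroup Eˣ := ⨅ v : T, Qs v.1

lemma mem_QT {T : Finset (Pl E)} {x : Eˣ} : x ∈ QT T ↔ ∀ v ∈ T, IsQ v (x : E) := by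
  simp only [QT, Subgroup.mem_iInf, mem_Qs]
  exact ⟨fun h v hv => h ⟨v, hv⟩, fun h v => h v.1 v.2⟩

lemma QT_insert [DecidableEq (Pl E)] (T : Finset (Pl E)) (q : Pl E) : QT (insert q T) = Qs q ⊓ QT T := by
  ext x
  rw [Subgroup.mem_inf, mem_QT, mem_QT, mem_Qs]
  simp

lemma two_val (v : Pl E) : ∃ e : ℕ, v.valuation E 2 = exp (-(e : ℤ)) := by
  have h0 : v.valuation E 2 ≠ 0 := by simp
  have h1 := two_le_one v
  refine ⟨(-log (v.valuation E 2)).toNat, ?_⟩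
  rw [← exp_log h0, ← WithZero.exp_zero, exp_le_exp] at h1
  conv_lhs => rw [← exp_log h0]
  rw [exp_inj]; omega

lemma index_QT [IsTotallyComplex E] (S : Finset (Pl E)) : (QT S).index ≠ 0 ∧
    (QT S).index ≤ 2 ^ (2 * S.card + 2 * Fintype.card (InfinitePlace E)) := by
  classical
  choose e he using two_val (E := E)
  have hF := fun v : Pl E => F2 v (e v) (he v)
  refine ⟨Subgroup.index_iInf_ne_zero fun v => (hF v).1, ?_⟩
  refine (Subgroup.index_iInf_le _).trans ?_
  have h1 : ∏ v : S, (Qs v.1).index ≤ ∏ v : S, (4 * Ideal.absNorm v.1.asIdeal ^ e v.1) :=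
    Finset.prod_le_prod' fun v _ => (hF v.1).2
  refine h1.trans ?_
  rw [Finset.prod_coe_sort S (fun v => 4 * Ideal.absNorm v.asIdeal ^ e v), Finset.prod_mul_distrib,
    Finset.prod_const]
  have h2 : ∏ v ∈ S, v.asIdeal ^ e v ∣ Ideal.span {((2 : ℕ) : 𝓞 E)} := by
    apply Finset.prod_dvd_of_coprime
    · intro v _ w _ hvw
      apply IsCoprime.pow
      rw [Ideal.isCoprime_iff_sup_eq]
      have := v.isMaximal
      exact Ideal.IsMaximal.coprime_of_ne v.isMaximal w.isMaximal (fun h => hvw (HeightOneSpectrum.ext h))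
    · intro v _
      rw [Ideal.dvd_span_singleton, ← val_exp_neg (E := E), ← he]
      rw [Nat.cast_ofNat, map_ofNat]
  have h3 := map_dvd Ideal.absNorm h2
  rw [Ideal.absNorm_span_natCast, map_prod] at h3
  simp only [map_pow] at h3
  have h4 := Nat.le_of_dvd (by positivity) h3
  have h5 : Module.finrank ℤ (𝓞 E) = 2 * Fintype.card (InfinitePlace E) := by
    rw [RingOfIntegers.rank, IsTotallyComplex.finrank, InfinitePlace.card_eq_nrRealPlaces_add_nrComplexPlaces,
      IsTotallyComplex.nrRealPlaces_eq_zero, zero_add]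
  rw [h5] at h4
  rw [pow_add, pow_mul]
  exact Nat.mul_le_mul_left _ h4

/-- odd valuations : norms from ramified extension are local squares -/
lemma norm_ram {v : Pl E} (h2 : v.valuation E 2 = 1) {u x y z : E} (hx : v.valuation E x = 1)
    (hxy : x = y ^ 2 - u * z ^ 2) (hu : ¬ ∃ t, v.valuation E (u * t ^ 2) = 1) : IsQ v x := by
  have h4 : v.valuation E 4 = 1 := by rw [four_eq, h2, one_pow]
  have hlt : v.valuation E (u * z ^ 2) < v.valuation E (y ^ 2) := by
    by_contra! hc
    rcases hc.lt_or_eq with h | h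
    · have := Valuation.map_sub_eq_of_lt_right _ h
      rw [← hxy, hx] at this
      exact hu ⟨z, this.symm⟩
    · by_cases hy : y = 0
      · rw [hy] at h
        have h0 : u * z ^ 2 = 0 := by simpa using h.symm
        rw [hy, h0] at hxy
        rw [hxy] at hx; simp at hx
      · apply hu
        refine ⟨z / y, ?_⟩
        rw [div_pow, ← mul_div_assoc, map_div₀, ← h, div_self]
        simpa using hy
  have hy1 := Valuation.map_sub_eq_of_lt_left _ hlt
  rw [← hxy, hx] at hy1
  have hy0 : y ≠ 0 := by rintro rfl; simp at hy1
  have : IsQ v (x * y ^ 2) := by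
    apply IsQ.of_close (pow_ne_zero 2 hy0)
    rw [map_mul, h4, one_mul]
    rw [show x - y ^ 2 = -(u * z ^ 2) by rw [hxy]; ring, Valuation.map_neg]
    exact hlt
  rwa [IsQ.mul_sq_iff hy0] at this

/-- norms from unramified inert extension have even valuation -/
lemma norm_unr {v : Pl E} (h2 : v.valuation E 2 = 1) {u x y z : E} (hu : v.valuation E u = 1)
    (hx : x ≠ 0) (hxy : x = y ^ 2 - u * z ^ 2) (hQ : ¬ IsQ v u) : ∃ t, v.valuation E (x * t ^ 2) = 1 := by
  have h4 : v.valuation E 4 = 1 := by rw [four_eq, h2, one_pow]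
  suffices h : ∃ t, v.valuation E x = v.valuation E (t ^ 2) by
    obtain ⟨t, ht⟩ := h
    have ht0 : t ≠ 0 := by rintro rfl; simp at ht; exact hx ht
    refine ⟨t⁻¹, ?_⟩
    rw [map_mul, ht, ← map_mul, ← mul_pow, mul_inv_cancel₀ ht0]; simp
  have hu' : v.valuation E (u * z ^ 2) = v.valuation E (z ^ 2) := by rw [map_mul, hu, one_mul]
  rcases lt_trichotomy (v.valuation E (u * z ^ 2)) (v.valuation E (y ^ 2)) with h | h | h
  · exact ⟨y, by rw [hxy, Valuation.map_sub_eq_of_lt_left _ h]⟩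
  · refine ⟨z, ?_⟩
    have hle : v.valuation E x ≤ v.valuation E (z ^ 2) := by
      rw [hxy]
      refine (Valuation.map_sub _ _ _).trans (max_le ?_ ?_)
      · rw [← h, hu']
      · rw [hu']
    refine hle.eq_of_not_lt fun hlt => hQ ?_
    have hz0 : z ≠ 0 := by
      rintro rfl
      have : y = 0 := by simpa using h.symm
      rw [this] at hxy; simp at hxy; exact hx hxy
    have hy0 : y ≠ 0 := by
      rintro rfl
      rw [hu'] at h; simp at h; exact hz0 h
    have h5 : IsQ v (u * z ^ 2 * y ^ 2) := by
      apply IsQ.of_close (pow_ne_zero 2 hy0)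
      rw [map_mul, h4, one_mul, ← h, hu', show u * z ^ 2 - y ^ 2 = -x by rw [hxy]; ring, Valuation.map_neg]
      exact hlt
    rwa [IsQ.mul_sq_iff hy0, IsQ.mul_sq_iff hz0] at h5
  · exact ⟨z, by rw [hxy, Valuation.map_sub_eq_of_lt_right _ h, hu']⟩

lemma sq_mem_Us {S : Set (Pl E)} {x : Eˣ} (hx : x ^ 2 ∈ Us S) : x ∈ Us S := by
  intro v hv
  have := hx v hv
  rw [Units.val_pow_eq_pow_val, map_pow] at this
  exact (pow_eq_one_iff_of_nonneg zero_le two_ne_zero).1 this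

lemma sq_mem_QT (T : Finset (Pl E)) (x : Eˣ) : x ^ 2 ∈ QT T := by
  rw [mem_QT]
  intro v _
  rw [Units.val_pow_eq_pow_val]
  exact IsQ.sq x.ne_zero

lemma sqr_relIndex (S : Finset (Pl E)) : ((sqr Eˣ)).relIndex (Us (E := E) S) =
    2 ^ (Fintype.card (InfinitePlace E) + S.card) := by
  rw [← index_sqr_us]
  unfold Subgroup.relIndex
  congr 1
  ext x
  rw [Subgroup.mem_subgroupOf, mem_sqr, mem_sqr]
  constructor
  · rintro ⟨y, hy⟩
    exact ⟨⟨y, sq_mem_Us (by rw [hy]; exact x.2)⟩, Subtype.ext hy⟩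
  · rintro ⟨y, rfl⟩
    exact ⟨y, rfl⟩

lemma sqr_le_QT (T : Finset (Pl E)) : sqr Eˣ ≤ QT T := by
  rintro _ ⟨y, rfl⟩; exact sq_mem_QT T y

lemma isSquare_iff_sqr {x : Eˣ} : IsSquare (x : E) ↔ x ∈ sqr Eˣ := by
  rw [mem_sqr]
  constructor
  · rintro ⟨y, hy⟩
    have hy0 : y ≠ 0 := by rintro rfl; simp at hy
    exact ⟨Units.mk0 y hy0, Units.ext (by simp [hy, pow_two])⟩
  · rintro ⟨y, rfl⟩
    exact ⟨y, by simp [pow_two]⟩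
end Lh

namespace Lh
set_option linter.unusedSectionVars false
open IsDedekindDomain NumberField HeightOneSpectrum
open scoped WithZero
open WithZero (exp log exp_le_exp exp_inj log_mul exp_log)

universe w
variable {E : Type w} [Field E] [NumberField E]

lemma Qs_relIndex {S : Set (Pl E)} {q : Pl E} (h2 : q.valuation E 2 = 1) (hq : q ∉ S) :
    (Qs q).relIndex (Us S) ≠ 0 ∧ (Qs q).relIndex (Us S) ≤ 2 := by
  apply relIndex_le_two
  intro a ha b hb haQ hbQ
  rw [mem_Qs] at *
  rw [Units.val_mul]
  exact isQ_mul_of_not h2 (ha q hq) (hb q hq) haQ hbQ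

lemma QT_relIndex_ne (S T : Finset (Pl E)) : (QT T).relIndex (Us (E := E) S) ≠ 0 := by
  intro h
  have := Subgroup.relIndex_dvd_of_le_left (Us (E := E) S) (sqr_le_QT T)
  rw [h, sqr_relIndex, zero_dvd_iff] at this
  exact absurd this (by positivity)

theorem greedy [IsTotallyComplex E] (S : Finset (Pl E)) (hS2 : ∀ v ∉ S, v.valuation E 2 = 1)
    (u1 : Eˣ) (hu1 : u1 ∈ Us (E := E) S) (k : ℕ)
    (hk : k + 1 ≤ Fintype.card (InfinitePlace E) + S.card) :
    ∃ T : Finset (Pl E), T.card = k ∧ (∀ q ∈ T, q ∉ S) ∧ (∀ q ∈ T, IsQ q (u1 : E)) ∧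
      (QT T).relIndex (Us (E := E) S) ≤ 2 ^ k ∧
      ∀ T' ⊆ T, 2 ^ T'.card ≤ (QT T').relIndex (Us (E := E) S) := by
  classical
  induction k with
  | zero =>
    refine ⟨∅, rfl, by simp, by simp, ?_, ?_⟩
    · have : QT (∅ : Finset (Pl E)) = ⊤ := by ext x; rw [mem_QT]; simp
      rw [this]; simp
    · intro T' hT'
      rw [Finset.subset_empty.1 hT']
      simpa using Nat.one_le_iff_ne_zero.2 (QT_relIndex_ne S ∅)
  | succ k ih =>
    obtain ⟨T, hTc, hTS, hTQ, hle, hge⟩ := ih (by omega)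
    set U := Us (E := E) S with hU
    obtain ⟨u, huU, huT, hus, huu⟩ : ∃ u ∈ U, u ∈ QT T ∧ u ∉ sqr Eˣ ∧ u * u1 ∉ sqr Eˣ := by
      by_contra! hc
      have h1 : (sqr Eˣ).relIndex (QT T ⊓ U) ≠ 0 ∧ (sqr Eˣ).relIndex (QT T ⊓ U) ≤ 2 := by
        apply relIndex_le_two
        intro a ha b hb has hbs
        have h3 := hc a ha.2 ha.1 has
        have h4 := hc b hb.2 hb.1 hbs
        have h5 : u1 ^ 2 ∈ sqr Eˣ := ⟨u1, rfl⟩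
        have h6 := (sqr Eˣ).mul_mem h3 h4
        have h7 : a * u1 * (b * u1) = a * b * u1 ^ 2 := by rw [mul_mul_mul_comm, pow_two]
        rw [h7] at h6
        exact ((sqr Eˣ).mul_mem_cancel_right h5).1 h6
      have h2 := Subgroup.relIndex_inf_mul_relIndex (sqr Eˣ) (QT T) U
      rw [inf_eq_left.2 (sqr_le_QT T), sqr_relIndex] at h2
      have h3 := Nat.mul_le_mul h1.2 hle
      rw [h2, ← pow_succ'] at h3
      have := (Nat.pow_le_pow_iff_right (by norm_num : 1 < 2)).1 h3
      omega
    obtain ⟨q, hq, hq1, hqu⟩ := thmT (u := (u : E)) (u1 := (u1 : E)) u1.ne_zero u.ne_zero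
      (by rwa [isSquare_iff_sqr]) (by rwa [← Units.val_mul, isSquare_iff_sqr]) (S0 := ((S ∪ T : Finset _) : Set (Pl E)))
      (Finset.finite_toSet _)
    simp only [Finset.coe_union, Set.mem_union, Finset.mem_coe, not_or] at hq
    refine ⟨insert q T, by rw [Finset.card_insert_of_notMem hq.2, hTc], ?_, ?_, ?_, ?_⟩
    · intro q' hq'
      rcases Finset.mem_insert.1 hq' with rfl | h
      · exact hq.1
      · exact hTS _ h
    · intro q' hq'
      rcases Finset.mem_insert.1 hq' with rfl | h
      · exact hq1
      · exact hTQ _ h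
    · rw [QT_insert]
      refine (Subgroup.relIndex_inf_le).trans ?_
      rw [pow_succ']
      exact Nat.mul_le_mul (Qs_relIndex (hS2 q hq.1) hq.1).2 hle
    · intro T' hT'
      by_cases hqT : q ∈ T'
      · obtain ⟨T'', hqT'', rfl⟩ : ∃ T'', q ∉ T'' ∧ insert q T'' = T' := ⟨T'.erase q, by simp, Finset.insert_erase hqT⟩
        have hsub : T'' ⊆ T := by
          intro x hx
          rcases Finset.mem_insert.1 (hT' (Finset.mem_insert_of_mem hx)) with rfl | h
          · exact absurd hx hqT''
          · exact h
        rw [Finset.card_insert_of_notMem hqT'', QT_insert, pow_succ',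
          ← Subgroup.relIndex_inf_mul_relIndex]
        refine Nat.mul_le_mul ?_ (hge T'' hsub)
        refine relIndex_ge_two _ _ ?_ (a := u) ⟨?_, huU⟩ hqu
        · intro h0
          have := Subgroup.relIndex_inf_mul_relIndex (Qs q) (QT T'') U
          rw [h0, zero_mul, ← QT_insert] at this
          exact QT_relIndex_ne S _ this.symm
        · rw [mem_QT] at huT
          change u ∈ QT T''
          rw [mem_QT]
          exact fun v hv => huT v (hsub hv)
      · apply hge
        intro x hx
        rcases Finset.mem_insert.1 (hT' hx) with rfl | h
        · exact absurd hx hqT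
        · exact h

/-- even valuations at a finite set -/
noncomputable def parG (B : Finset (Pl E)) : Eˣ →* Multiplicative (B → ZMod 2) where
  toFun x := Multiplicative.ofAdd fun v => ((log (v.1.valuation E (x : E)) : ℤ) : ZMod 2)
  map_one' := by
    apply Multiplicative.toAdd.injective
    funext v; simp
  map_mul' x y := by
    apply Multiplicative.toAdd.injective
    funext v
    have h1 : v.1.valuation E (x : E) ≠ 0 := by simp
    have h2 : v.1.valuation E (y : E) ≠ 0 := by simp
    simp [log_mul h1 h2]

lemma mem_parG {B : Finset (Pl E)} {x : Eˣ} : x ∈ (parG B).ker ↔ ∀ v ∈ B, ∃ t, v.valuation E ((x : E) * t ^ 2) = 1 := by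
  rw [MonoidHom.mem_ker]
  constructor
  · intro h v hv
    have h1 : ((log (v.valuation E (x : E)) : ℤ) : ZMod 2) = 0 := congrFun (congrArg Multiplicative.toAdd h) ⟨v, hv⟩
    rw [ZMod.intCast_zmod_eq_zero_iff_dvd] at h1
    obtain ⟨j, hj⟩ := h1
    obtain ⟨π, hπ⟩ := v.valuation_exists_uniformizer E
    refine ⟨π ^ j, ?_⟩
    have hx0 : v.valuation E (x : E) ≠ 0 := by simp
    rw [map_mul, map_pow, map_zpow₀, hπ, ← exp_log hx0, hj, ← WithZero.exp_zsmul, ← WithZero.exp_nsmul,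
      ← WithZero.exp_add, ← WithZero.exp_zero, exp_inj]
    simp
  · intro h
    apply Multiplicative.toAdd.injective
    funext v
    obtain ⟨t, ht⟩ := h v.1 v.2
    change ((log (v.1.valuation E (x : E)) : ℤ) : ZMod 2) = 0
    rw [ZMod.intCast_zmod_eq_zero_iff_dvd]
    have h1 : v.1.valuation E (x : E) ≠ 0 := by simp
    have h2 : v.1.valuation E t ≠ 0 := by
      intro h0
      rw [map_mul, map_pow, h0] at ht; simp at ht
    have h3 := congrArg log ht
    rw [map_mul, map_pow, log_mul h1 (pow_ne_zero 2 h2), WithZero.log_pow, WithZero.log_one] at h3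
    refine ⟨-log (v.1.valuation E t), ?_⟩
    simp only [nsmul_eq_mul] at h3
    push_cast at h3 ⊢
    linarith

lemma index_parG (B : Finset (Pl E)) : (parG B).ker.index = 2 ^ B.card := by
  classical
  have hs : Function.Surjective (parG B) := by
    intro g
    choose π hπ using fun v : Pl E => v.valuation_exists_uniformizer E
    let a : Pl E → E := fun v => if h : v ∈ B then (if Multiplicative.toAdd g ⟨v, h⟩ = 0 then 1 else π v) else 1
    have ha : ∀ v ∈ B, a v ≠ 0 := by
      intro v hv
      have : π v ≠ 0 := by intro h; have := hπ v; rw [h, map_zero] at this; exact WithZero.exp_ne_zero this.symm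
      dsimp only [a]
      split_ifs <;> simp [this]
    obtain ⟨w, hw⟩ := wapprox (insert (Classical.choose (exists_prime_notMem B.finite_toSet)) B) (fun v => if v ∈ B then a v else 1) (fun v => if v ∈ B then a v else 1) (by
      intro v _
      split_ifs with h
      · exact ha v h
      · exact one_ne_zero)
    have hw' : ∀ v ∈ insert (Classical.choose (exists_prime_notMem B.finite_toSet)) B, v.valuation E w = v.valuation E (if v ∈ B then a v else 1) := by
      intro v hv
      have := Valuation.map_add_eq_of_lt_left _ (hw v hv)
      rwa [add_sub_cancel] at this
    have hw0 : w ≠ 0 := by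
      rintro rfl
      have := hw' _ (Finset.mem_insert_self _ _)
      rw [if_neg (by simpa using Classical.choose_spec (exists_prime_notMem B.finite_toSet))] at this
      simp at this
    refine ⟨Units.mk0 w hw0, ?_⟩
    apply Multiplicative.toAdd.injective
    funext v
    change ((log (v.1.valuation E w) : ℤ) : ZMod 2) = _
    rw [hw' v.1 (Finset.mem_insert_of_mem v.2), if_pos v.2]
    dsimp only [a]
    rw [dif_pos v.2]
    split_ifs with h0
    · rw [h0]; simp
    · rw [hπ]
      have : ∀ z : ZMod 2, z ≠ 0 → z = 1 := by decide
      rw [this _ h0]; simp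
  rw [Subgroup.index_ker, MonoidHom.range_eq_top.2 hs]
  rw [Nat.card_congr Subgroup.topEquiv.toEquiv, Nat.card_congr Multiplicative.toAdd, Nat.card_fun]
  simp

theorem thmN [IsTotallyComplex E] {u1 b : E} (hu1 : u1 ≠ 0) (hb : b ≠ 0) {bad : Set (Pl E)} (hbad : bad.Finite)
    (h1 : ∀ v ∈ bad, IsQ v u1)
    (h2 : ∀ v ∉ bad, v.valuation E 2 = 1 ∧ v.valuation E u1 = 1 ∧ v.valuation E b = 1) :
    ∃ x y : E, b = x ^ 2 - u1 * y ^ 2 := by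
  classical
  by_cases hsq : IsSquare u1
  · obtain ⟨c, rfl⟩ := hsq
    have hc : c ≠ 0 := by rintro rfl; simp at hu1
    refine ⟨(b + 1) / 2, (b - 1) / (2 * c), ?_⟩
    field_simp; ring
  obtain ⟨S0, hS0f, hcl0⟩ := exists_clOne (E := E)
  let S := (hS0f.union hbad).toFinset
  have hScl : ClOne (S : Set (Pl E)) := by
    rw [Set.Finite.coe_toFinset]; exact hcl0.mono Set.subset_union_left
  have hSbad : ∀ v ∉ S, v ∉ bad := by
    intro v hv h; apply hv; simp [S, h]
  set U1 := Units.mk0 u1 hu1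
  have hU1 : U1 ∈ Us (E := E) S := fun v hv => (h2 v (hSbad v hv)).2.1
  have hr : 0 < Fintype.card (InfinitePlace E) := Fintype.card_pos
  set r := Fintype.card (InfinitePlace E) with hrdef
  obtain ⟨T, hTc, hTS, hTQ, -, hge⟩ := greedy S (fun v hv => (h2 v (hSbad v hv)).1) U1 hU1 (r + S.card - 1) (by omega)
  have hdisj : Disjoint S T := by
    rw [Finset.disjoint_right]; exact fun q hq => hTS q hq
  set S' := S ∪ T with hS'
  have hS'bad : ∀ v ∉ S', v ∉ bad := fun v hv => hSbad v (fun h => hv (Finset.mem_union_left _ h))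
  have hS'c : S'.card = 2 * S.card + r - 1 := by
    rw [hS', Finset.card_union_of_disjoint hdisj, hTc]; omega
  set U' := Us (E := E) S' with hU'
  -- injectivity
  have hinj : QT S ⊓ U' ≤ sqr Eˣ := by
    rintro u ⟨huQ, huU⟩
    by_contra hus
    rw [← isSquare_iff_sqr] at hus
    replace huQ := mem_QT.1 (show u ∈ QT S from huQ)
    obtain ⟨M, _, _, _, ⟨q⟩⟩ := exists_qext _ hus
    let Tr := T.filter fun v => ¬ ∃ t, v.valuation E ((u : E) * t ^ 2) = 1
    have hH := thmH q (S ∪ Tr) (hScl.mono (by intro x hx; simp at hx ⊢; exact Or.inl hx)) (by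
      intro v hv
      rw [Finset.mem_union, not_or] at hv
      refine ⟨(h2 v (hSbad v hv.1)).1, ?_⟩
      by_cases hvT : v ∈ T
      · by_contra hc
        exact hv.2 (Finset.mem_filter.2 ⟨hvT, hc⟩)
      · refine ⟨1, ?_⟩
        rw [one_pow, mul_one]
        refine huU v ?_
        simp [hS', hv.1, hvT])
    have hn : ((S ∪ Tr).filter fun v => ¬ IsQ v (u : E)).card ≤ Tr.card := by
      apply Finset.card_le_card
      intro v hv
      rw [Finset.mem_filter, Finset.mem_union] at hv
      rcases hv.1 with h | h
      · exact absurd (huQ v h) hv.2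
      · exact h
    have hle1 : (normG (u : E)).relIndex (Us (E := E) S) ≤ (normG (u : E)).relIndex (Us (E := E) ((S ∪ Tr : Finset _) : Set (Pl E))) :=
      Subgroup.relIndex_le_of_le_right (Us_mono (by intro x hx; simp at hx ⊢; exact Or.inl hx)) hH.1
    have hsub : normG (u : E) ⊓ Us (E := E) S ≤ QT Tr := by
      rintro x ⟨⟨y, z, hx⟩, hxU⟩
      rw [mem_QT]
      intro v hv
      obtain ⟨hvT, hv'⟩ := Finset.mem_filter.1 hv
      exact norm_ram (h2 v (hSbad v (hTS v hvT))).1 (hxU v (hTS v hvT)) hx hv'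
    have hnz : (normG (u : E) ⊓ Us (E := E) S).relIndex (Us (E := E) S) ≠ 0 := by
      rw [Subgroup.inf_relIndex_right]
      intro h0
      have hle : sqr Eˣ ≤ normG (u : E) := by
        rintro _ ⟨y, rfl⟩
        exact ⟨y, 0, by simp⟩
      have := Subgroup.relIndex_dvd_of_le_left (Us (E := E) S) hle
      rw [h0, sqr_relIndex, zero_dvd_iff] at this
      exact absurd this (by positivity)
    have h5 := Subgroup.relIndex_le_of_le_left hsub hnz
    rw [Subgroup.inf_relIndex_right] at h5
    have h6 := hge Tr (Finset.filter_subset _ _)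
    have h7 : 2 ^ ((S ∪ Tr).filter fun v => ¬ IsQ v (u : E)).card ≤ 2 ^ Tr.card := Nat.pow_le_pow_right (by norm_num) hn
    have h8 : 0 < 2 ^ Tr.card := by positivity
    have := hH.2
    omega
  have hrel : (QT S).relIndex U' = 2 ^ (r + S'.card) := by
    rw [← sqr_relIndex]
    have e1 : QT S ⊓ U' = sqr Eˣ ⊓ U' := le_antisymm (le_inf hinj inf_le_right) (inf_le_inf_right _ (sqr_le_QT S))
    rw [← Subgroup.inf_relIndex_right, e1, Subgroup.inf_relIndex_right]
  -- parity
  let B := S.filter fun v => ¬ IsQ v u1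
  have hBbad : ∀ v ∈ B, v ∉ bad := fun v hv h => (Finset.mem_filter.1 hv).2 (h1 v h)
  have hQP : QT S ≤ (parG B).ker := by
    intro x hx
    rw [mem_QT] at hx
    rw [mem_parG]
    intro v hv
    obtain ⟨t, ht⟩ := hx v (Finset.mem_filter.1 hv).1
    exact ⟨t, IsQ.eq_one ht⟩
  have hiQ := index_QT S
  have hcnt := index_count U' (QT S) (parG B).ker hQP hiQ.1 (by
    rw [hrel, ← pow_succ']
    refine hiQ.2.trans (Nat.pow_le_pow_right (by norm_num) ?_)
    omega)
  rw [index_parG] at hcnt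
  obtain ⟨M, _, _, _, ⟨q⟩⟩ := exists_qext _ hsq
  have hH := thmH q S' (hScl.mono (by intro x hx; simp [hS'] at hx ⊢; exact Or.inl hx)) (by
    intro v hv
    have := h2 v (hS'bad v hv)
    exact ⟨this.1, 1, by rw [one_pow, mul_one]; exact this.2.1⟩)
  have hBc : (S'.filter fun v => ¬ IsQ v u1) = B := by
    rw [hS', Finset.filter_union]
    have : T.filter (fun v => ¬ IsQ v u1) = ∅ := by
      rw [Finset.filter_eq_empty_iff]; exact fun v hv => not_not.2 (hTQ v hv)
    rw [this, Finset.union_empty]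
  have hH2 := hH.2
  rw [hBc] at hH2
  have hfin := relIndex_eq_case (normG u1) (parG B).ker U' hH.1 (by
    change (normG u1).relIndex (Us (E := E) S') ≤ _
    omega) (by
    rintro x ⟨⟨y, z, hx⟩, hxU⟩
    rw [mem_parG]
    intro v hv
    have h3 := h2 v (hBbad v hv)
    exact norm_unr h3.1 h3.2.1 x.ne_zero hx (Finset.mem_filter.1 hv).2)
  have hbm : Units.mk0 b hb ∈ (parG B).ker ⊓ U' := by
    refine ⟨?_, ?_⟩
    · change Units.mk0 b hb ∈ (parG B).ker
      rw [mem_parG]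
      intro v hv
      exact ⟨1, by rw [one_pow, mul_one]; exact (h2 v (hBbad v hv)).2.2⟩
    · intro v hv
      exact (h2 v (hS'bad v hv)).2.2
  exact hfin hbm
end Lh

namespace Lh
set_option linter.unusedSectionVars false
open IsDedekindDomain NumberField HeightOneSpectrum
open scoped WithZero
open WithZero (exp log exp_le_exp exp_inj log_mul exp_log)

variable {F : Type*} [Field F] [NumberField F]

/-- every complex embedding is real -/
def TR (F : Type*) [Field F] : Prop := ∀ φ : F →+* ℂ, ∀ x, (φ x).im = 0

lemma TR.real (h : TR F) (φ : F →+* ℂ) : ∃ ψ : F →+* ℝ, ∀ x, φ x = (ψ x : ℂ) := by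
  have hr : ComplexEmbedding.IsReal φ := by
    rw [ComplexEmbedding.isReal_iff]
    ext x
    rw [ComplexEmbedding.conjugate_coe_eq]
    exact Complex.conj_eq_iff_im.2 (h φ x)
  exact ⟨hr.embedding, fun x => (hr.coe_embedding_apply x).symm⟩

lemma TR.exists_real (h : TR F) : ∃ _ : F →+* ℝ, True := by
  obtain ⟨φ⟩ : Nonempty (F →+* ℂ) := inferInstance
  obtain ⟨ψ, -⟩ := h.real φ
  exact ⟨ψ, trivial⟩

/-- total positivity -/
def TPos (x : F) : Prop := ∀ ψ : F →+* ℝ, 0 < ψ x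

lemma TPos.ne (h : TR F) {x : F} (hx : TPos x) : x ≠ 0 := by
  obtain ⟨ψ, -⟩ := h.exists_real
  rintro rfl
  simpa using hx ψ

lemma qext_complex {M : Type*} [Field M] [NumberField M] [Algebra F M] (h : TR F) {e : F} (q : QExt F M e)
    (he : TPos (-e)) : IsTotallyComplex M := by
  refine ⟨fun w => ?_⟩
  rw [InfinitePlace.isComplex_iff]
  intro hr
  set φ := w.embedding
  obtain ⟨ψ, hψ⟩ := h.real (φ.comp (algebraMap F M))
  have h1 : φ q.α ^ 2 = (ψ e : ℂ) := by
    rw [← map_pow, q.hα]; exact hψ e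
  have h2 := hr.coe_embedding_apply q.α
  rw [← h2] at h1
  have h3 : (hr.embedding q.α) ^ 2 = ψ e := by exact_mod_cast h1
  have := he ψ
  rw [map_neg] at this
  nlinarith [sq_nonneg (hr.embedding q.α)]

/-- values of the form `<1,d,-a,-ad>` -/
def DD (d a c : F) : Prop := ∃ x1 x2 y1 y2 : F, c = x1 ^ 2 + d * x2 ^ 2 - a * (y1 ^ 2 + d * y2 ^ 2)

lemma DD.mul {d a c c' : F} (h : DD d a c) (h' : DD d a c') : DD d a (c * c') := by
  obtain ⟨x1, x2, y1, y2, rfl⟩ := h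
  obtain ⟨z1, z2, w1, w2, rfl⟩ := h'
  -- quaternion multiplication: (x + y j)(z + w j) = (x z + a y wb) + (x w + y zb) j
  refine ⟨x1 * z1 - d * x2 * z2 + a * (y1 * w1 + d * y2 * w2),
    x1 * z2 + x2 * z1 + a * (y2 * w1 - y1 * w2),
    x1 * w1 - d * x2 * w2 + (y1 * z1 + d * y2 * z2),
    x1 * w2 + x2 * w1 + (y2 * z1 - y1 * z2), by ring⟩

lemma DD.sq_mul {d a c t : F} (ht : t ≠ 0) (h : DD d a (c * t ^ 2)) : DD d a c := by
  obtain ⟨x1, x2, y1, y2, h⟩ := h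
  refine ⟨x1 / t, x2 / t, y1 / t, y2 / t, ?_⟩
  have : c = (c * t ^ 2) / t ^ 2 := by field_simp
  rw [this, h]; field_simp

lemma nrm_ne (hF : TR F) {d : F} (hd : TPos d) {x y : F} (h : x ^ 2 + d * y ^ 2 = 0) : x = 0 ∧ y = 0 := by
  obtain ⟨ψ, -⟩ := hF.exists_real
  have h1 : ψ x ^ 2 + ψ d * ψ y ^ 2 = 0 := by rw [← map_pow, ← map_pow, ← map_mul, ← map_add, h, map_zero]
  have h2 := hd ψ
  have hy : ψ y = 0 := by
    by_contra hy
    have : 0 < ψ y ^ 2 := by positivity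
    nlinarith [sq_nonneg (ψ x), mul_pos h2 this]
  have hx : ψ x = 0 := by rw [hy] at h1; simpa using h1
  exact ⟨(map_eq_zero ψ).1 hx, (map_eq_zero ψ).1 hy⟩

theorem thmG1 (hF : TR F) {d a c : F} (hd : TPos d) (ha : TPos a) {bad : Set (Pl F)} (hbad : bad.Finite)
    (h2 : ∀ v ∉ bad, v.valuation F 2 = 1 ∧ v.valuation F d = 1 ∧ v.valuation F a = 1)
    (hc : ∀ ψ : F →+* ℝ, 1 ≤ ψ c)
    (hc1 : ∀ v ∈ bad, v.valuation F ((c - 1) * ((1 + d) / 2) ^ 2) < v.valuation F (4 * d)) :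
    DD d a c := by
  have hd0 := hd.ne hF
  have ha0 := ha.ne hF
  set y := (1 + d) / 2 with hy
  have hy0 : y ≠ 0 := by
    have : TPos (1 + d) := fun ψ => by rw [map_add, map_one]; linarith [hd ψ]
    have := this.ne hF
    exact div_ne_zero this two_ne_zero
  set e := -d - (c - 1) * y ^ 2 with he
  have hex : e = ((1 - d) / 2) ^ 2 - c * y ^ 2 := by rw [he, hy]; ring
  have hepos : TPos (-e) := by
    intro ψ
    have h1 := hd ψ
    have h2 := hc ψ
    rw [he]
    simp only [map_neg, map_sub, map_mul, map_pow, map_one]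
    nlinarith [mul_nonneg (sub_nonneg.2 h2) (sq_nonneg (ψ y))]
  have hesq : ¬ IsSquare e := by
    rintro ⟨r, hr⟩
    obtain ⟨ψ, -⟩ := hF.exists_real
    have := hepos ψ
    rw [hr] at this
    simp only [map_neg, map_mul] at this
    nlinarith [mul_self_nonneg (ψ r)]
  obtain ⟨M, _, _, _, ⟨q⟩⟩ := exists_qext e hesq
  have := qext_complex hF q hepos
  have hinj := (algebraMap F M).injective
  obtain ⟨p, s, hps⟩ := thmN (E := M) (u1 := algebraMap F M (-d)) (b := algebraMap F M a)
    (by simpa using hd0) (by simpa using ha0) (below_preimage_fin (M := M) hbad) (by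
      intro P hP
      have hb := hc1 _ hP
      refine ⟨1 / q.α, ?_⟩
      rw [div_pow, q.hα, one_pow, one_div, ← map_inv₀, ← map_mul, ← map_one (algebraMap F M), ← map_sub,
        ← map_ofNat (algebraMap F M), below_lt]
      set v := below F P
      have he0 : e ≠ 0 := q.u_ne
      have h4 : v.valuation F 4 ≤ 1 := four_le_one v
      have hlt : v.valuation F ((c - 1) * y ^ 2) < v.valuation F (-d) := by
        rw [Valuation.map_neg]
        refine lt_of_lt_of_le hb ?_
        rw [map_mul]
        exact mul_le_of_le_one_left zero_le h4
      have hve : v.valuation F e = v.valuation F d := by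
        rw [he, Valuation.map_sub_eq_of_lt_left _ hlt, Valuation.map_neg]
      have hrw : -d * e⁻¹ - 1 = ((c - 1) * y ^ 2) / e := by
        field_simp; rw [he]; ring
      rw [hrw, map_div₀, hve]
      rw [div_lt_iff₀ (by rw [zero_lt_iff]; simpa using hd0), ← map_mul]
      exact hb) (by
      intro P hP
      obtain ⟨h2, h3, h4⟩ := h2 (below F P) hP
      refine ⟨?_, ?_, ?_⟩
      · rw [← map_ofNat (algebraMap F M), below_eq_one]; exact h2
      · rw [below_eq_one, Valuation.map_neg]; exact h3
      · rw [below_eq_one]; exact h4)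
  obtain ⟨p0, p1, rfl⟩ := q.span p
  obtain ⟨q0, q1, rfl⟩ := q.span s
  have key : algebraMap F M (p0 ^ 2 + e * p1 ^ 2 + d * (q0 ^ 2 + e * q1 ^ 2) - a) +
      algebraMap F M (2 * (p0 * p1 + d * (q0 * q1))) * q.α = 0 := by
    have h := q.hα
    simp only [map_add, map_sub, map_mul, map_pow, map_neg, map_ofNat] at hps ⊢
    linear_combination -hps - ((algebraMap F M p1)^2 + algebraMap F M d * (algebraMap F M q1)^2) * h
  have hind : ∀ s t : F, algebraMap F M s + algebraMap F M t * q.α = 0 → s = 0 ∧ t = 0 := by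
    intro s t h
    have h' := congrArg q.σ h
    rw [q.σ_mk, map_zero] at h'
    have h1 : algebraMap F M s = 0 := by linear_combination (h + h') / 2
    have h2 : algebraMap F M t * q.α = 0 := by linear_combination (h - h') / 2
    exact ⟨by simpa using h1, by simpa [q.α_ne] using h2⟩
  obtain ⟨k1, k2⟩ := hind _ _ key
  have k2' : p0 * p1 + d * (q0 * q1) = 0 := by simpa using k2
  by_cases hk : p1 = 0 ∧ q1 = 0
  · obtain ⟨rfl, rfl⟩ := hk
    have haN : p0 ^ 2 + d * q0 ^ 2 = a := by linear_combination k1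
    -- c = ((c+1)/2)^2 - ((c-1)/2)^2, (c-1)/2 = k0 * y
    refine ⟨(c + 1) / 2, 0, (c - 1) / 2 * p0 / a, -(c - 1) / 2 * q0 / a, ?_⟩
    field_simp
    linear_combination (c - 1) ^ 2 * haN
  · set n := p1 ^ 2 + d * q1 ^ 2 with hn
    have hn0 : n ≠ 0 := fun h => hk (nrm_ne hF hd h)
    set r := p0 * q1 - p1 * q0 with hr
    have h1 : e * n ^ 2 = a * n - d * r ^ 2 := by
      rw [hn, hr]
      linear_combination (p1 ^ 2 + d * q1 ^ 2) * k1 - (p0 * p1 + d * (q0 * q1)) * k2'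
    have h3 : c * y ^ 2 = ((1 - d) / 2) ^ 2 + d * (r / n) ^ 2 - a * ((p1 / n) ^ 2 + d * (q1 / n) ^ 2) := by
      have h4 : c * y ^ 2 = ((1 - d) / 2) ^ 2 - e := by rw [hex]; ring
      have h5 : (p1 / n) ^ 2 + d * (q1 / n) ^ 2 = 1 / n := by
        rw [div_pow, div_pow, eq_div_iff hn0]; field_simp; rw [hn]
      have h6 : e = a / n - d * (r / n) ^ 2 := by
        field_simp; linear_combination h1
      rw [h4, h5, h6]; ring
    exact DD.sq_mul hy0 ⟨_, _, _, _, h3⟩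
end Lh

namespace Lh
set_option linter.unusedSectionVars false
open IsDedekindDomain NumberField HeightOneSpectrum
open scoped WithZero
open WithZero (exp log exp_le_exp exp_inj log_mul exp_log)

variable {F : Type*} [Field F] [NumberField F]

lemma chev3 {k : Type*} [Field k] [Finite k] (a b c d e f : k) :
    ∃ x : Fin 3 → k, x ≠ 0 ∧ a * x 0 ^ 2 + b * x 1 ^ 2 + c * x 2 ^ 2 + d * (x 0 * x 1) + e * (x 0 * x 2)
      + f * (x 1 * x 2) = 0 := by
  classical
  have := Fintype.ofFinite k
  obtain ⟨p, hp⟩ := CharP.exists k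
  have hpp : p.Prime := CharP.char_is_prime k p
  open MvPolynomial in
  let g : MvPolynomial (Fin 3) k := C a * X 0 ^ 2 + C b * X 1 ^ 2 + C c * X 2 ^ 2 + C d * (X 0 * X 1)
    + C e * (X 0 * X 2) + C f * (X 1 * X 2)
  have hX : ∀ i : Fin 3, ∀ a : k, (MvPolynomial.C a * MvPolynomial.X i ^ 2 : MvPolynomial (Fin 3) k).totalDegree ≤ 2 := by
    intro i a
    refine (MvPolynomial.totalDegree_mul _ _).trans ?_
    simp [MvPolynomial.totalDegree_X_pow]
  have hXX : ∀ i j : Fin 3, ∀ a : k, (MvPolynomial.C a * (MvPolynomial.X i * MvPolynomial.X j) : MvPolynomial (Fin 3) k).totalDegree ≤ 2 := by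
    intro i j a
    refine (MvPolynomial.totalDegree_mul _ _).trans ?_
    have := MvPolynomial.totalDegree_mul (MvPolynomial.X i) (MvPolynomial.X j : MvPolynomial (Fin 3) k)
    simp at this ⊢
    exact this
  have hadd : ∀ p q : MvPolynomial (Fin 3) k, p.totalDegree ≤ 2 → q.totalDegree ≤ 2 → (p + q).totalDegree ≤ 2 :=
    fun p q hp hq => (MvPolynomial.totalDegree_add _ _).trans (max_le hp hq)
  have hg : g.totalDegree < Fintype.card (Fin 3) := by
    refine lt_of_le_of_lt (b := 2) ?_ (by simp)
    exact hadd _ _ (hadd _ _ (hadd _ _ (hadd _ _ (hadd _ _ (hX _ _) (hX _ _)) (hX _ _)) (hXX _ _ _)) (hXX _ _ _)) (hXX _ _ _)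
  have hdvd := char_dvd_card_solutions p hg
  have hev : ∀ x : Fin 3 → k, MvPolynomial.eval x g = a * x 0 ^ 2 + b * x 1 ^ 2 + c * x 2 ^ 2 + d * (x 0 * x 1) + e * (x 0 * x 2)
      + f * (x 1 * x 2) := by intro x; simp [g]
  by_contra! hcon
  have huniq : Fintype.card {x : Fin 3 → k // MvPolynomial.eval x g = 0} = 1 := by
    rw [Fintype.card_eq_one_iff]
    refine ⟨⟨0, by rw [hev]; simp⟩, ?_⟩
    rintro ⟨y, hy⟩
    by_contra hne
    exact hcon y (fun h => hne (Subtype.ext h)) (by rw [← hev]; exact hy)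
  rw [huniq] at hdvd
  exact hpp.one_lt.ne' (Nat.dvd_one.1 hdvd)

lemma mlt {a b : ℤᵐ⁰} (ha : a ≤ 1) (hb : b < 1) : a * b < 1 :=
  lt_of_le_of_lt (mul_le_of_le_one_left zero_le ha) hb

lemma lt_one_iff_exp {z : ℤᵐ⁰} : z < 1 ↔ z ≤ exp (-1 : ℤ) := by
  rcases eq_or_ne z 0 with rfl | h
  · simp
  · rw [← exp_log h, ← WithZero.exp_zero, WithZero.exp_lt_exp, exp_le_exp]; omega

lemma res_rep (v : Pl F) {x : F} (hx : v.valuation F x ≤ 1) :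
    ∃ r : 𝓞 F, v.valuation F (x - algebraMap _ F r) < 1 := by
  obtain ⟨n, d, hd⟩ := exists_primeCompl_mul_eq_of_integer v x hx
  have hdm : (d : 𝓞 F) ∉ v.asIdeal := d.2
  have hmax := v.isMaximal
  obtain ⟨e, i, hi, he⟩ := hmax.exists_inv hdm
  refine ⟨n * e, ?_⟩
  have h1 : x - algebraMap _ F (n * e) = x * algebraMap _ F i := by
    have : (algebraMap _ F e) * (algebraMap (𝓞 F) F d) + algebraMap _ F i = 1 := by
      rw [← map_mul, ← map_add, he, map_one]
    rw [map_mul, ← hd]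
    linear_combination (-x) * this
  rw [h1, map_mul]
  have h2 : v.valuation F (algebraMap _ F i) < 1 := (valuation_lt_one_iff_mem v i).2 hi
  exact mlt hx h2

lemma val_lt_iff (v : Pl F) (r : 𝓞 F) : v.valuation F (algebraMap _ F r) < 1 ↔ Ideal.Quotient.mk v.asIdeal r = 0 := by
  rw [valuation_lt_one_iff_mem, Ideal.Quotient.eq_zero_iff_mem]

lemma newton (v : Pl F) {α β δ : F} (hα : v.valuation F α ≤ 1) (hβ : v.valuation F β < 1) (hδ : δ ≠ 0) :
    ∃ s : F, v.valuation F s < 1 ∧ v.valuation F (α * s ^ 2 + s + β) < v.valuation F δ := by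
  have key : ∀ n : ℕ, ∃ s : F, v.valuation F s < 1 ∧ v.valuation F (α * s ^ 2 + s + β) ≤ exp (-(n : ℤ)) := by
    intro n
    induction n with
    | zero => exact ⟨0, by simp, by simpa using hβ.le⟩
    | succ n ih =>
      obtain ⟨s, hs, h⟩ := ih
      have hs' : v.valuation F (-β - α * s ^ 2) < 1 := by
        refine Valuation.map_sub_lt _ (by rwa [Valuation.map_neg]) ?_
        rw [map_mul, map_pow]
        exact mlt hα (pow_lt_one₀ zero_le hs two_ne_zero)
      refine ⟨-β - α * s ^ 2, hs', ?_⟩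
      have e1 : α * (-β - α * s ^ 2) ^ 2 + (-β - α * s ^ 2) + β =
          -(α * ((-β - α * s ^ 2) + s)) * (α * s ^ 2 + s + β) := by ring
      rw [e1, map_mul, Valuation.map_neg]
      have h3 : v.valuation F (α * ((-β - α * s ^ 2) + s)) ≤ exp (-1 : ℤ) := by
        rw [← lt_one_iff_exp, map_mul]
        exact mlt hα (Valuation.map_add_lt _ hs' hs)
      have := mul_le_mul' h3 h
      rw [← WithZero.exp_add] at this
      convert this using 2
      push_cast; ring
  have hδ0 : v.valuation F δ ≠ 0 := by rwa [Ne, map_eq_zero]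
  obtain ⟨s, hs, h⟩ := key ((1 - log (v.valuation F δ)).toNat)
  refine ⟨s, hs, h.trans_lt ?_⟩
  rw [← exp_log hδ0, WithZero.exp_lt_exp, exp_log hδ0]
  omega

lemma small_mult {ι : Type*} [Fintype ι] (v : Pl F) (f : ι → F) {b : F} (hb : b ≠ 0) :
    ∃ w : F, w ≠ 0 ∧ ∀ i, v.valuation F (w * f i) ≤ v.valuation F b := by
  classical
  let g : ι → F := fun i => if v.valuation F (f i) ≤ 1 then 1 else (f i)⁻¹
  have hg : ∀ i, g i ≠ 0 ∧ v.valuation F (g i) ≤ 1 ∧ v.valuation F (g i * f i) ≤ 1 := by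
    intro i
    by_cases h : v.valuation F (f i) ≤ 1
    · simp only [g, if_pos h]; exact ⟨one_ne_zero, by simp, by simpa using h⟩
    · simp only [g, if_neg h]
      have h0 : f i ≠ 0 := by intro h'; rw [h'] at h; simp at h
      refine ⟨inv_ne_zero h0, ?_, by rw [inv_mul_cancel₀ h0, map_one]⟩
      rw [map_inv₀]; exact inv_le_one_of_one_le₀ (not_le.1 h).le
  refine ⟨b * ∏ i, g i, mul_ne_zero hb (Finset.prod_ne_zero_iff.2 fun i _ => (hg i).1), fun i => ?_⟩
  rw [← Finset.mul_prod_erase _ _ (Finset.mem_univ i)]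
  have e1 : b * (g i * ∏ x ∈ Finset.univ.erase i, g x) * f i = b * ((g i * f i) * ∏ x ∈ Finset.univ.erase i, g x) := by ring
  rw [e1, map_mul, map_mul, map_prod]
  refine mul_le_of_le_one_right zero_le (mul_le_one' (hg i).2.2 ?_)
  exact Finset.prod_le_one' fun j _ => (hg j).2.1

section
variable {n : ℕ} (q : Fin n → F)

/-- diagonal form -/
def qq (x : Fin n → F) : F := ∑ i, q i * x i ^ 2
/-- polar form -/
def bb (x y : Fin n → F) : F := ∑ i, 2 * (q i * x i * y i)

lemma qq_add (x y : Fin n → F) : qq q (x + y) = qq q x + qq q y + bb q x y := by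
  simp only [qq, bb, ← Finset.sum_add_distrib]
  exact Finset.sum_congr rfl fun i _ => by simp only [Pi.add_apply]; ring

lemma qq_smul (c : F) (x : Fin n → F) : qq q (c • x) = c ^ 2 * qq q x := by
  simp only [qq, Finset.mul_sum]
  exact Finset.sum_congr rfl fun i _ => by simp only [Pi.smul_apply, smul_eq_mul]; ring

lemma bb_smul_left (c : F) (x y : Fin n → F) : bb q (c • x) y = c * bb q x y := by
  simp only [bb, Finset.mul_sum]
  exact Finset.sum_congr rfl fun i _ => by simp only [Pi.smul_apply, smul_eq_mul]; ring

lemma bb_comm (x y : Fin n → F) : bb q x y = bb q y x := by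
  simp only [bb]
  exact Finset.sum_congr rfl fun i _ => by ring

lemma bb_smul_right (c : F) (x y : Fin n → F) : bb q x (c • y) = c * bb q x y := by
  rw [bb_comm, bb_smul_left, bb_comm]

lemma bb_add_left (x y z : Fin n → F) : bb q (x + y) z = bb q x z + bb q y z := by
  simp only [bb, ← Finset.sum_add_distrib]
  exact Finset.sum_congr rfl fun i _ => by simp only [Pi.add_apply]; ring

lemma bb_add_right (x y z : Fin n → F) : bb q x (y + z) = bb q x y + bb q x z := by
  rw [bb_comm, bb_add_left, bb_comm q y, bb_comm q z]

lemma bb_self (x : Fin n → F) : bb q x x = 2 * qq q x := by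
  simp only [bb, qq, Finset.mul_sum]
  exact Finset.sum_congr rfl fun i _ => by ring

variable {q} {v : Pl F} {ε : F}

lemma noCS (hε0 : ε ≠ 0) (hε : ∀ x : Fin n → F, ∀ i, v.valuation F (ε * x i ^ 2) ≤ v.valuation F (qq q x))
    (x y : Fin n → F) (h1 : v.valuation F (qq q x) ≤ v.valuation F (bb q x y))
    (h2 : v.valuation F (qq q y) < v.valuation F (bb q x y)) : False := by
  set b := bb q x y with hb
  have hvb : 0 < v.valuation F b := lt_of_le_of_lt zero_le h2
  have hb0 : b ≠ 0 := by intro h; rw [h, map_zero] at hvb; exact lt_irrefl _ hvb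
  obtain ⟨w, hw0, hw⟩ := small_mult v (fun i => 2 * (q i * x i)) hb0
  obtain ⟨s, hs, hse⟩ := newton v (α := qq q x / b) (β := qq q y / b) (δ := ε * w ^ 2 / b)
    (by rw [map_div₀]; exact div_le_one_of_le₀ h1 zero_le) (by rw [map_div₀, div_lt_one₀ hvb]; exact h2)
    (by positivity)
  set z := s • x + y with hz
  have hqz : qq q z = b * (qq q x / b * s ^ 2 + s + qq q y / b) := by
    rw [hz, qq_add, qq_smul, bb_smul_left, ← hb]; field_simp; ring
  have hqz' : v.valuation F (qq q z) < v.valuation F (ε * w ^ 2) := by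
    rw [hqz, map_mul]
    rw [map_div₀, lt_div_iff₀ hvb] at hse
    rwa [mul_comm]
  have hzi : ∀ i, v.valuation F (z i) < v.valuation F w := by
    intro i
    have h := (hε z i).trans_lt hqz'
    rw [map_mul, map_mul, map_pow, map_pow] at h
    have hε' : 0 < v.valuation F ε := by rw [zero_lt_iff]; simpa using hε0
    have := (mul_lt_mul_iff_right₀ hε').1 h
    exact (pow_lt_pow_iff_left₀ zero_le zero_le two_ne_zero).1 this
  have hbz : v.valuation F (bb q x z) < v.valuation F b := by
    refine Valuation.map_sum_lt _ hvb.ne' ?_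
    intro i _
    rw [show 2 * (q i * x i * z i) = (2 * (q i * x i)) * z i by ring, map_mul]
    by_cases h0 : v.valuation F (2 * (q i * x i)) = 0
    · rw [h0, zero_mul]; exact hvb
    · refine lt_of_lt_of_le ((mul_lt_mul_iff_right₀ (zero_lt_iff.2 h0)).2 (hzi i)) ?_
      rw [← map_mul, mul_comm]; exact hw i
  have hexp : b = bb q x z - 2 * s * qq q x := by
    rw [hz, bb_add_right, bb_smul_right, bb_self, ← hb]; ring
  have h3 : v.valuation F (2 * s * qq q x) < v.valuation F b := by
    rw [map_mul, map_mul]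
    refine lt_of_le_of_lt (mul_le_mul_right h1 _) ?_
    refine mul_lt_of_lt_one_left hvb ?_
    exact mlt (two_le_one v) hs
  have := Valuation.map_sub_lt _ hbz h3
  rw [← hexp] at this
  exact lt_irrefl _ this

end
end Lh

namespace Lh
set_option linter.unusedSectionVars false
open IsDedekindDomain NumberField HeightOneSpectrum
open scoped WithZero
open WithZero (exp log exp_le_exp exp_inj log_mul exp_log)

variable {F : Type*} [Field F] [NumberField F]
variable {n : ℕ} {q : Fin n → F} {v : Pl F} {ε : F}

lemma ternary {t : F} (ht : t ≠ 0) (x : Fin 3 → Fin n → F) (hx : ∀ i, v.valuation F (qq q (x i)) ≤ v.valuation F t)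
    (hb : ∀ i j, v.valuation F (bb q (x i) (x j)) ≤ v.valuation F t) :
    ∃ c : Fin 3 → 𝓞 F, (fun i => Ideal.Quotient.mk v.asIdeal (c i)) ≠ 0 ∧
      v.valuation F (qq q (∑ i, algebraMap _ F (c i) • x i)) < v.valuation F t := by
  have hvt : 0 < v.valuation F t := by rw [zero_lt_iff]; simpa using ht
  have hrep : ∀ z : F, v.valuation F z ≤ v.valuation F t → ∃ r : 𝓞 F, v.valuation F (z / t - algebraMap _ F r) < 1 := by
    intro z hz
    apply res_rep
    rw [map_div₀]; exact div_le_one_of_le₀ hz zero_le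
  obtain ⟨r0, h0⟩ := hrep _ (hx 0)
  obtain ⟨r1, h1⟩ := hrep _ (hx 1)
  obtain ⟨r2, h2⟩ := hrep _ (hx 2)
  obtain ⟨r3, h3⟩ := hrep _ (hb 0 1)
  obtain ⟨r4, h4⟩ := hrep _ (hb 0 2)
  obtain ⟨r5, h5⟩ := hrep _ (hb 1 2)
  have hmax := v.isMaximal
  let _ := Ideal.Quotient.field v.asIdeal
  let mk := Ideal.Quotient.mk v.asIdeal
  obtain ⟨y, hy0, hy⟩ := chev3 (mk r0) (mk r1) (mk r2) (mk r3) (mk r4) (mk r5)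
  choose c hc using fun i => Ideal.Quotient.mk_surjective (y i)
  refine ⟨c, by rw [funext hc]; exact hy0, ?_⟩
  simp only [← hc] at hy
  simp only [mk, ← map_pow, ← map_mul, ← map_add] at hy
  rw [← val_lt_iff] at hy
  simp only [map_add, map_mul, map_pow] at hy
  set C : Fin 3 → F := fun i => algebraMap _ F (c i) with hC
  have hCi : ∀ i, algebraMap (𝓞 F) F (c i) = C i := fun i => rfl
  simp only [hCi] at hy ⊢
  have hC1 : ∀ i, v.valuation F (C i) ≤ 1 := fun i => valuation_le_one v _
  have hCC : ∀ i j, v.valuation F (C i * C j) ≤ 1 := fun i j => by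
    rw [map_mul]; exact mul_le_one' (hC1 i) (hC1 j)
  have expand : qq q (∑ i, C i • x i) = qq q (x 0) * C 0 ^ 2 + qq q (x 1) * C 1 ^ 2 + qq q (x 2) * C 2 ^ 2 +
      bb q (x 0) (x 1) * (C 0 * C 1) + bb q (x 0) (x 2) * (C 0 * C 2) + bb q (x 1) (x 2) * (C 1 * C 2) := by
    rw [Fin.sum_univ_three]
    simp only [qq_add, bb_add_left, qq_smul, bb_smul_left, bb_smul_right]
    ring
  have e2 : qq q (∑ i, C i • x i) = t * ((C 0 * C 0) * (qq q (x 0) / t - algebraMap _ F r0) +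
      (C 1 * C 1) * (qq q (x 1) / t - algebraMap _ F r1) + (C 2 * C 2) * (qq q (x 2) / t - algebraMap _ F r2) +
      (C 0 * C 1) * (bb q (x 0) (x 1) / t - algebraMap _ F r3) +
      (C 0 * C 2) * (bb q (x 0) (x 2) / t - algebraMap _ F r4) +
      (C 1 * C 2) * (bb q (x 1) (x 2) / t - algebraMap _ F r5) +
      (algebraMap _ F r0 * C 0 ^ 2 + algebraMap _ F r1 * C 1 ^ 2 + algebraMap _ F r2 * C 2 ^ 2 +
      algebraMap _ F r3 * (C 0 * C 1) + algebraMap _ F r4 * (C 0 * C 2) + algebraMap _ F r5 * (C 1 * C 2))) := by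
    rw [expand]; field_simp; ring
  rw [e2, map_mul]
  have hm : ∀ i j : Fin 3, ∀ z : F, v.valuation F z < 1 → v.valuation F (C i * C j * z) < 1 := by
    intro i j z hz; rw [map_mul]; exact mlt (hCC i j) hz
  refine mul_lt_of_lt_one_right hvt ?_
  exact Valuation.map_add_lt _ (Valuation.map_add_lt _ (Valuation.map_add_lt _ (Valuation.map_add_lt _ (Valuation.map_add_lt _
    (Valuation.map_add_lt _ (hm _ _ _ h0) (hm _ _ _ h1)) (hm _ _ _ h2)) (hm _ _ _ h3)) (hm _ _ _ h4)) (hm _ _ _ h5)) hy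

section

lemma bb_le (hε0 : ε ≠ 0) (hε : ∀ x : Fin n → F, ∀ i, v.valuation F (ε * x i ^ 2) ≤ v.valuation F (qq q x))
    {r : ℤᵐ⁰} {x y : Fin n → F} (hx : v.valuation F (qq q x) ≤ r) (hy : v.valuation F (qq q y) ≤ r) :
    v.valuation F (bb q x y) ≤ r := by
  by_contra! h
  exact noCS hε0 hε x y (hx.trans h.le) (hy.trans_lt h)

lemma qq_add_le (hε0 : ε ≠ 0) (hε : ∀ x : Fin n → F, ∀ i, v.valuation F (ε * x i ^ 2) ≤ v.valuation F (qq q x))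
    {r : ℤᵐ⁰} {x y : Fin n → F} (hx : v.valuation F (qq q x) ≤ r) (hy : v.valuation F (qq q y) ≤ r) :
    v.valuation F (qq q (x + y)) ≤ r := by
  rw [qq_add]
  exact Valuation.map_add_le _ (Valuation.map_add_le _ hx hy) (bb_le hε0 hε hx hy)

lemma qq_add_lt (hε0 : ε ≠ 0) (hε : ∀ x : Fin n → F, ∀ i, v.valuation F (ε * x i ^ 2) ≤ v.valuation F (qq q x))
    {r : ℤᵐ⁰} {x y : Fin n → F} (hx : v.valuation F (qq q x) < r) (hy : v.valuation F (qq q y) < r) :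
    v.valuation F (qq q (x + y)) < r := by
  rw [qq_add]
  refine Valuation.map_add_lt _ (Valuation.map_add_lt _ hx hy) ?_
  by_contra! h
  exact noCS hε0 hε x y (hx.le.trans h) (hy.trans_le h)

lemma entries_bdd (hε0 : ε ≠ 0) (hε : ∀ x : Fin n → F, ∀ i, v.valuation F (ε * x i ^ 2) ≤ v.valuation F (qq q x))
    : ∃ C : ℤᵐ⁰, ∀ x : Fin n → F, v.valuation F (qq q x) ≤ 1 → ∀ i, v.valuation F (x i) ≤ C := by
  refine ⟨max 1 (v.valuation F ε)⁻¹, fun x hx i => ?_⟩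
  by_cases h : v.valuation F (x i) ≤ 1
  · exact h.trans (le_max_left _ _)
  · refine le_trans ?_ (le_max_right _ _)
    have h1 := (hε x i).trans hx
    have hε' : v.valuation F ε ≠ 0 := by simpa using hε0
    rw [map_mul, map_pow] at h1
    have h2 : v.valuation F (x i) ≤ v.valuation F (x i) ^ 2 := by
      rw [pow_two]; exact le_mul_of_one_le_left zero_le (not_le.1 h).le
    rw [le_inv_comm₀ (lt_of_lt_of_le zero_lt_one (not_le.1 h).le) (zero_lt_iff.2 hε')]
    rw [← one_div, le_div_iff₀ (lt_of_lt_of_le zero_lt_one (not_le.1 h).le)]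
    exact (mul_le_mul_right h2 _).trans h1

lemma det_bdd (hε0 : ε ≠ 0) (hε : ∀ x : Fin n → F, ∀ i, v.valuation F (ε * x i ^ 2) ≤ v.valuation F (qq q x))
    : ∃ C : ℤᵐ⁰, ∀ X : Matrix (Fin n) (Fin n) F, (∀ i, v.valuation F (qq q (X i)) ≤ 1) →
    v.valuation F X.det ≤ C := by
  obtain ⟨C, hC⟩ := entries_bdd hε0 hε
  refine ⟨C ^ n, fun X hX => ?_⟩
  rw [Matrix.det_apply']
  refine Valuation.map_sum_le _ fun σ _ => ?_
  rw [map_mul]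
  have h1 : v.valuation F ((Equiv.Perm.sign σ : ℤ) : F) = 1 := by
    rcases Int.units_eq_one_or (Equiv.Perm.sign σ) with h | h <;> rw [h] <;> simp
  rw [h1, one_mul, map_prod]
  calc ∏ i, v.valuation F (X (σ i) i) ≤ ∏ i : Fin n, C := Finset.prod_le_prod' fun i _ => hC _ (hX _) _
    _ = C ^ n := by simp

lemma exists_max (hε0 : ε ≠ 0) (hε : ∀ x : Fin n → F, ∀ i, v.valuation F (ε * x i ^ 2) ≤ v.valuation F (qq q x))
    : ∃ X : Matrix (Fin n) (Fin n) F, (∀ i, v.valuation F (qq q (X i)) ≤ 1) ∧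
    ∀ c : Fin n → 𝓞 F, v.valuation F (qq q (∑ i, algebraMap _ F (c i) • X i)) < exp (-1 : ℤ) →
      ∀ i, Ideal.Quotient.mk v.asIdeal (c i) = 0 := by
  obtain ⟨C, hC⟩ := det_bdd hε0 hε
  obtain ⟨w, hw0, hw⟩ := small_mult v (fun i : Option (Fin n) => i.elim 1 q) one_ne_zero
  have hw1 : v.valuation F w ≤ 1 := by simpa using hw none
  let P : ℤ → Prop := fun z => ∃ X : Matrix (Fin n) (Fin n) F, X.det ≠ 0 ∧ (∀ i, v.valuation F (qq q (X i)) ≤ 1) ∧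
    log (v.valuation F X.det) = z
  obtain ⟨z, ⟨X, hX0, hX1, rfl⟩, hmax⟩ := Int.exists_greatest_of_bdd (P := P) (by
      refine ⟨log C, ?_⟩
      rintro z ⟨X, hX0, hX1, rfl⟩
      have h1 := hC X hX1
      have h2 : v.valuation F X.det ≠ 0 := by simpa using hX0
      have h3 : C ≠ 0 := (lt_of_lt_of_le (zero_lt_iff.2 h2) h1).ne'
      rwa [← exp_le_exp, exp_log h2, exp_log h3]) (by
      refine ⟨_, Matrix.diagonal (fun _ => w), by simp [hw0], fun i => ?_, rfl⟩
      have : qq q (Matrix.diagonal (fun _ => w) i) = w * (w * q i) := by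
        rw [qq, Finset.sum_eq_single i]
        · simp; ring
        · intro j _ hj; simp [Matrix.diagonal_apply_ne' _ hj]
        · simp
      rw [this, map_mul]
      exact mul_le_one' hw1 (by simpa using hw (some i)))
  refine ⟨X, hX1, fun c hc i => ?_⟩
  by_contra hci
  have hci1 : v.valuation F (algebraMap _ F (c i)) = 1 := by
    rw [valuation_eq_one_iff_notMem]
    rwa [Ideal.Quotient.eq_zero_iff_mem] at hci
  obtain ⟨π, hπ⟩ := v.valuation_exists_uniformizer F
  have hπ0 : π ≠ 0 := by rintro rfl; rw [map_zero] at hπ; exact WithZero.exp_ne_zero hπ.symm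
  have hdet := Matrix.det_updateRow_sum X i (fun k => π⁻¹ * algebraMap _ F (c k))
  set X' := X.updateRow i (∑ k, (π⁻¹ * algebraMap _ F (c k)) • X k) with hX'
  have hvdet : v.valuation F X.det ≠ 0 := by simpa using hX0
  have hv' : v.valuation F X'.det = exp (1 : ℤ) * v.valuation F X.det := by
    rw [hdet, smul_eq_mul, map_mul, map_mul, hci1, map_inv₀, hπ, mul_one, ← WithZero.exp_neg, neg_neg]
  have hX'0 : X'.det ≠ 0 := by
    rw [← (v.valuation F).ne_zero_iff, hv']
    exact mul_ne_zero WithZero.exp_ne_zero hvdet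
  have := hmax _ ⟨X', hX'0, fun j => ?_, rfl⟩
  · rw [hv', log_mul WithZero.exp_ne_zero hvdet, WithZero.log_exp] at this
    omega
  · by_cases hj : j = i
    · subst hj
      rw [hX', Matrix.updateRow_self]
      simp only [mul_smul]
      rw [← Finset.smul_sum, qq_smul, map_mul, map_pow, map_inv₀, hπ]
      set y := v.valuation F (qq q (∑ i, algebraMap _ F (c i) • X i))
      rcases eq_or_ne y 0 with h0 | h0
      · rw [h0]; simp
      · rw [← exp_log h0, WithZero.exp_lt_exp] at hc
        rw [← exp_log h0, ← WithZero.exp_neg, pow_two, ← WithZero.exp_add, ← WithZero.exp_add, ← WithZero.exp_zero, exp_le_exp]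
        omega
    · rw [hX', Matrix.updateRow_ne hj]; exact hX1 j
end

theorem loc (q : Fin 5 → F) (v : Pl F) {ε : F} (hε0 : ε ≠ 0) :
    ∃ (x : Fin 5 → F) (i : Fin 5), v.valuation F (qq q x) < v.valuation F (ε * x i ^ 2) := by
  classical
  by_contra! hε
  obtain ⟨X, hX, hind⟩ := exists_max hε0 hε
  obtain ⟨π, hπ⟩ := v.valuation_exists_uniformizer F
  have hπ0 : π ≠ 0 := by rintro rfl; rw [map_zero] at hπ; exact WithZero.exp_ne_zero hπ.symm
  have hmax := v.isMaximal
  let _ := Ideal.Quotient.field v.asIdeal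
  let mk := Ideal.Quotient.mk v.asIdeal
  let T : (Fin 5 → 𝓞 F) → (Fin 5 → F) := fun c => ∑ i, algebraMap _ F (c i) • X i
  have Tadd : ∀ c d, T (c + d) = T c + T d := by
    intro c d; simp only [T, Pi.add_apply, map_add, add_smul, Finset.sum_add_distrib]
  have Tsmul : ∀ (r : 𝓞 F) c, T (r • c) = algebraMap _ F r • T c := by
    intro r c; simp only [T, Pi.smul_apply, smul_eq_mul, map_mul, mul_smul, Finset.smul_sum]
  have T3 : ∀ (d : Fin 3 → 𝓞 F) (c : Fin 3 → Fin 5 → 𝓞 F), T (∑ i, d i • c i) = ∑ i, algebraMap _ F (d i) • T (c i) := by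
    intro d c
    rw [Fin.sum_univ_three, Fin.sum_univ_three, Tadd, Tadd, Tsmul, Tsmul, Tsmul]
  have hqs : ∀ (r : 𝓞 F) x, v.valuation F (qq q (algebraMap _ F r • x)) ≤ v.valuation F (qq q x) := by
    intro r x
    rw [qq_smul, map_mul, map_pow]
    exact mul_le_of_le_one_left zero_le (pow_le_one₀ zero_le (valuation_le_one v r))
  have TΛ : ∀ c, v.valuation F (qq q (T c)) ≤ 1 := by
    intro c
    have : ∀ s : Finset (Fin 5), v.valuation F (qq q (∑ i ∈ s, algebraMap _ F (c i) • X i)) ≤ 1 := by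
      intro s
      induction s using Finset.induction_on with
      | empty => simp [qq]
      | insert a s ha ih =>
        rw [Finset.sum_insert ha]
        exact qq_add_le hε0 hε ((hqs _ _).trans (hX _)) ih
    exact this _
  let Z : Submodule (𝓞 F ⧸ v.asIdeal) (Fin 5 → 𝓞 F ⧸ v.asIdeal) :=
    { carrier := {a | ∃ c : Fin 5 → 𝓞 F, (fun i => mk (c i)) = a ∧ v.valuation F (qq q (T c)) < 1}
      add_mem' := by
        rintro _ _ ⟨c, rfl, hc⟩ ⟨d, rfl, hd⟩
        refine ⟨c + d, by funext i; simp [mk], ?_⟩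
        rw [Tadd]; exact qq_add_lt hε0 hε hc hd
      zero_mem' := ⟨0, by funext i; simp [mk], by simp [T, qq]⟩
      smul_mem' := by
        rintro r _ ⟨c, rfl, hc⟩
        obtain ⟨r, rfl⟩ := Ideal.Quotient.mk_surjective r
        refine ⟨r • c, by funext i; simp [mk], ?_⟩
        rw [Tsmul]; exact (hqs _ _).trans_lt hc }
  have hsum := Submodule.finrank_quotient_add_finrank Z
  rw [Module.finrank_fin_fun] at hsum
  have hmks : ∀ (d : Fin 3 → 𝓞 F) (c : Fin 3 → Fin 5 → 𝓞 F),
      (fun j => mk ((∑ i, d i • c i) j)) = ∑ i, mk (d i) • (fun j => mk (c i j)) := by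
    intro d c; funext j; simp [mk, Finset.sum_apply]
  by_cases hlt : 3 ≤ Module.finrank (𝓞 F ⧸ v.asIdeal) ((Fin 5 → 𝓞 F ⧸ v.asIdeal) ⧸ Z)
  · obtain ⟨f, hf⟩ := exists_linearIndependent_of_le_finrank hlt
    choose g hg using fun i => Z.mkQ_surjective (f i)
    choose c hc using fun i j => Ideal.Quotient.mk_surjective (g i j)
    obtain ⟨d, hd0, hd⟩ := ternary (v := v) (q := q) one_ne_zero (fun i => T (c i)) (fun i => by simpa using TΛ _)
      (fun i j => by rw [map_one]; exact bb_le hε0 hε (TΛ _) (TΛ _))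
    apply hd0
    rw [Fintype.linearIndependent_iff] at hf
    funext i
    refine hf (fun i => mk (d i)) ?_ i
    rw [← T3, map_one] at hd
    have hmem : (∑ i, mk (d i) • g i) ∈ Z := by
      refine ⟨_, ?_, hd⟩
      rw [hmks]
      exact Finset.sum_congr rfl fun i _ => by rw [funext (hc i)]
    rw [← Submodule.Quotient.mk_eq_zero, ← Submodule.mkQ_apply, map_sum] at hmem
    simpa [map_smul, hg] using hmem
  · have hlt' : 3 ≤ Module.finrank (𝓞 F ⧸ v.asIdeal) Z := by omega
    obtain ⟨f, hf⟩ := exists_linearIndependent_of_le_finrank hlt'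
    choose c hc1 hc2 using fun i => (f i).2
    have hc3 : ∀ i, v.valuation F (qq q (T (c i))) ≤ v.valuation F π := by
      intro i; rw [hπ, ← lt_one_iff_exp]; exact hc2 i
    obtain ⟨d, hd0, hd⟩ := ternary (v := v) (q := q) hπ0 (fun i => T (c i)) hc3
      (fun i j => bb_le hε0 hε (hc3 _) (hc3 _))
    apply hd0
    rw [Fintype.linearIndependent_iff] at hf
    funext i
    refine hf (fun i => mk (d i)) ?_ i
    rw [← T3, hπ] at hd
    have h0 := hind _ hd
    apply Subtype.ext
    have := hmks d c
    rw [show (fun j => mk ((∑ i, d i • c i) j)) = 0 from funext h0] at this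
    rw [Submodule.coe_sum]
    simp only [Submodule.coe_smul]
    rw [Submodule.coe_zero, this]
    exact Finset.sum_congr rfl fun i _ => by rw [hc1 i]
end Lh

namespace Lh
set_option linter.unusedSectionVars false
open IsDedekindDomain NumberField HeightOneSpectrum
open scoped WithZero
open WithZero (exp log exp_le_exp exp_inj log_mul exp_log)

variable {F : Type*} [Field F] [NumberField F]

lemma locA {q : Fin 4 → F} (hq : ∀ i, q i ≠ 0) (v : Pl F) (c : F) {δ : F} (hδ : δ ≠ 0) :
    ∃ x : Fin 4 → F, v.valuation F (qq q x - c) < v.valuation F δ := by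
  obtain ⟨π, hπ⟩ := v.valuation_exists_uniformizer F
  have hπ0 : π ≠ 0 := by rintro rfl; rw [map_zero] at hπ; exact WithZero.exp_ne_zero hπ.symm
  set δ' := δ * π with hδ'
  have hδ'0 : δ' ≠ 0 := mul_ne_zero hδ hπ0
  have hδlt : v.valuation F δ' < v.valuation F δ := by
    rw [hδ', map_mul]
    have : 0 < v.valuation F δ := by rw [zero_lt_iff]; simpa using hδ
    refine mul_lt_of_lt_one_right this ?_
    rw [hπ, lt_one_iff_exp]
  let g : Fin 4 → F := fun i => ((c - q i) / (2 * q i)) ^ 2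
  obtain ⟨η, hη0, hη⟩ := small_mult v (fun i : Option (Fin 4) => i.elim δ' (fun i => c * g i)) hδ'0
  obtain ⟨κ, hκ0, hκ⟩ := small_mult v (fun i : Option (Fin 4) => i.elim 1 g) (one_ne_zero (α := F))
  have hvδ' : 0 < v.valuation F δ' := by rw [zero_lt_iff]; simpa using hδ'0
  have hη1 : v.valuation F η ≤ 1 := by
    have h := hη none
    simp only [Option.elim_none, map_mul] at h
    exact (mul_le_iff_le_one_left hvδ').1 h
  have hκ1 : v.valuation F κ ≤ 1 := by simpa using hκ none
  set ε := δ' * η ^ 2 * κ with hε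
  have hε0 : ε ≠ 0 := by positivity
  obtain ⟨x, i, hx⟩ := loc (Fin.snoc q (-c) : Fin 5 → F) v hε0
  obtain ⟨j, -, hj⟩ := Finset.exists_max_image Finset.univ (fun i => v.valuation F (x i)) ⟨0, Finset.mem_univ _⟩
  have hxi : x i ≠ 0 := by
    intro h; rw [h] at hx; simp at hx
  have hxj : x j ≠ 0 := by
    intro h
    have := hj i (Finset.mem_univ _)
    rw [h, map_zero, le_zero_iff, map_eq_zero] at this
    exact hxi this
  have hx2 : v.valuation F (qq (Fin.snoc q (-c) : Fin 5 → F) x) < v.valuation F (ε * x j ^ 2) := by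
    refine hx.trans_le ?_
    rw [map_mul _ ε, map_mul _ ε, map_pow, map_pow]
    exact mul_le_mul_right (pow_le_pow_left₀ zero_le (hj i (Finset.mem_univ _)) 2) _
  set z : Fin 5 → F := (x j)⁻¹ • x with hz
  have hzj : z j = 1 := by simp [hz, hxj]
  have hzε : v.valuation F (qq (Fin.snoc q (-c) : Fin 5 → F) z) < v.valuation F ε := by
    rw [hz, qq_smul]
    have e1 : ε = (x j)⁻¹ ^ 2 * (ε * x j ^ 2) := by field_simp
    rw [e1, map_mul, map_mul _ ((x j)⁻¹ ^ 2)]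
    exact (mul_lt_mul_iff_right₀ (by rw [zero_lt_iff]; simpa using hxj)).2 hx2
  have hsplit : qq (Fin.snoc q (-c) : Fin 5 → F) z = qq q (fun i => z i.castSucc) - c * z (Fin.last 4) ^ 2 := by
    rw [qq, Fin.sum_univ_castSucc]
    simp only [Fin.snoc_castSucc, Fin.snoc_last, qq]
    ring
  set y : Fin 4 → F := fun i => z i.castSucc with hy
  set l := z (Fin.last 4) with hl
  rw [hsplit] at hzε
  by_cases hcase : v.valuation F η ≤ v.valuation F l
  · have hl0 : l ≠ 0 := by
      intro h; rw [h, map_zero, le_zero_iff, map_eq_zero] at hcase; exact hη0 hcase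
    refine ⟨l⁻¹ • y, ?_⟩
    have e1 : qq q (l⁻¹ • y) - c = (qq q y - c * l ^ 2) / l ^ 2 := by
      rw [qq_smul]; field_simp
    have hl2 : 0 < v.valuation F (l ^ 2) := by rw [zero_lt_iff]; simpa using hl0
    rw [e1, map_div₀, div_lt_iff₀ hl2]
    refine hzε.trans_le ?_
    rw [hε, map_mul, map_mul, map_pow, map_pow]
    calc _ ≤ v.valuation F δ' * v.valuation F η ^ 2 := mul_le_of_le_one_right zero_le hκ1
      _ ≤ _ := mul_le_mul' hδlt.le (pow_le_pow_left₀ zero_le hcase 2)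
  · push Not at hcase
    have hjl : j ≠ Fin.last 4 := by
      rintro rfl
      rw [hl, hzj, map_one] at hcase
      exact absurd hη1 (not_le.2 hcase)
    obtain ⟨i, rfl⟩ := Fin.exists_castSucc_eq.2 hjl
    set m := (c - q i) / (2 * q i) with hm
    have hyi : y i = 1 := hzj
    refine ⟨m • y + Pi.single i 1, ?_⟩
    have hs1 : qq q (Pi.single i 1) = q i := by
      rw [qq, Finset.sum_eq_single i] <;> simp +contextual
    have hs2 : bb q y (Pi.single i 1) = 2 * q i := by
      rw [bb, Finset.sum_eq_single i]
      · simp [hyi]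
      · intro k _ hk; simp [hk]
      · simp
    have e1 : qq q (m • y + Pi.single i 1) - c = m ^ 2 * (qq q y - c * l ^ 2) + (c * m ^ 2) * l ^ 2 := by
      rw [qq_add, qq_smul, bb_smul_left, hs1, hs2, hm]
      have := hq i
      field_simp; ring
    rw [e1]
    refine lt_of_le_of_lt (Valuation.map_add_le _ ?_ ?_) hδlt
    · rw [map_mul]
      refine (mul_le_mul_right hzε.le _).trans ?_
      rw [← map_mul, show m ^ 2 * ε = δ' * (η ^ 2 * (κ * g i)) by rw [hε]; simp only [g, hm]; ring, map_mul]
      refine mul_le_of_le_one_right zero_le ?_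
      rw [map_mul, map_pow]
      exact mul_le_one' (pow_le_one₀ zero_le hη1) (by simpa using hκ (some i))
    · have h1 : v.valuation F (η * (c * m ^ 2)) ≤ v.valuation F δ' := hη (some i)
      refine le_trans ?_ h1
      rw [map_mul _ η, mul_comm (v.valuation F η), map_mul]
      refine mul_le_mul_right ?_ _
      rw [map_pow, pow_two]
      exact (mul_le_mul' hcase.le (hcase.le.trans hη1)).trans (mul_one _).le

lemma finite_real : Finite (F →+* ℝ) := by
  refine Finite.of_injective (fun ψ : F →+* ℝ => Complex.ofRealHom.comp ψ) ?_
  intro a b h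
  ext x
  have := RingHom.congr_fun h x
  simpa using this

lemma real_dense (r : (F →+* ℝ) → ℝ) {ρ : ℝ} (hρ : 0 < ρ) : ∃ w : F, ∀ ψ : F →+* ℝ, |ψ w - r ψ| < ρ := by
  classical
  have hrat : ∀ ψ, ∃ a : ℚ, |(a : ℝ) - r ψ| < ρ / 2 := by
    intro ψ
    obtain ⟨a, ha1, ha2⟩ := exists_rat_btwn (show r ψ - ρ / 2 < r ψ + ρ / 2 by linarith)
    exact ⟨a, by rw [abs_lt]; constructor <;> linarith⟩
  choose a ha using hrat
  let pl : (F →+* ℝ) → InfinitePlace F := fun ψ => InfinitePlace.mk (Complex.ofRealHom.comp ψ)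
  have hpl : Function.Injective pl := by
    intro ψ ψ' h
    have : ∀ x, ψ x = ψ' x := by
      rcases InfinitePlace.mk_eq_iff.1 h with h | h
      · intro x; simpa using RingHom.congr_fun h x
      · intro x; simpa [ComplexEmbedding.conjugate_coe_eq] using RingHom.congr_fun h x
    exact RingHom.ext this
  let f : InfinitePlace F → F := fun v => if h : ∃ ψ, pl ψ = v then (a h.choose : F) else 0
  have hf : ∀ ψ, f (pl ψ) = (a ψ : F) := by
    intro ψ
    have h : ∃ ψ', pl ψ' = pl ψ := ⟨ψ, rfl⟩
    simp only [f, dif_pos h]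
    rw [hpl h.choose_spec]
  have hd := InfinitePlace.denseRange_algebraMap_pi F
  rw [Metric.denseRange_iff] at hd
  obtain ⟨w, hw⟩ := hd (fun v => (WithAbs.equiv v.1).symm (f v)) (ρ / 2) (by positivity)
  refine ⟨w, fun ψ => ?_⟩
  rw [dist_pi_lt_iff (by positivity)] at hw
  have h1 := hw (pl ψ)
  rw [dist_eq_norm] at h1
  have h2 : (pl ψ) (f (pl ψ) - w) < ρ / 2 := h1
  rw [hf, InfinitePlace.apply] at h2
  have h3 : |(a ψ : ℝ) - ψ w| < ρ / 2 := by
    simp only [RingHom.comp_apply, map_sub, map_ratCast] at h2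
    rw [← Real.norm_eq_abs, ← Complex.norm_real, Complex.ofReal_sub]
    simpa using h2
  have := ha ψ
  rw [abs_lt] at *
  constructor <;> linarith

end Lh

namespace Lh
set_option linter.unusedSectionVars false
open IsDedekindDomain NumberField HeightOneSpectrum
open scoped WithZero
open WithZero (exp log exp_le_exp exp_inj log_mul exp_log)

variable {F : Type*} [Field F] [NumberField F]

lemma exp_small (A : ℤᵐ⁰) {B : ℤᵐ⁰} (hB : B ≠ 0) : ∀ᶠ k : ℕ in Filter.atTop, A * exp (-(k : ℤ)) < B := by
  rcases eq_or_ne A 0 with rfl | hA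
  · refine Filter.Eventually.of_forall fun k => ?_
    rw [zero_mul]; exact zero_lt_iff.2 hB
  · filter_upwards [Filter.eventually_gt_atTop (log A - log B).toNat] with k hk
    rw [← exp_log hA, ← exp_log hB, ← WithZero.exp_add, WithZero.exp_lt_exp]
    omega

theorem sapprox (T : Finset (Pl F)) (f ε : Pl F → F) (hε : ∀ v ∈ T, ε v ≠ 0) (r : (F →+* ℝ) → ℝ) {ρ : ℝ} (hρ : 0 < ρ) :
    ∃ w : F, (∀ v ∈ T, v.valuation F (w - f v) < v.valuation F (ε v)) ∧ ∀ ψ : F →+* ℝ, |ψ w - r ψ| < ρ := by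
  classical
  obtain ⟨wf, hwf⟩ := wapprox T f ε hε
  obtain ⟨wi, hwi⟩ := real_dense r (half_pos hρ)
  have := finite_real (F := F)
  let M : ℕ := 2 * ∏ v ∈ T, Ideal.absNorm v.asIdeal
  have hM2 : 2 ≤ M := by
    have : 0 < ∏ v ∈ T, Ideal.absNorm v.asIdeal := by
      apply Finset.prod_pos
      intro v _
      rw [Nat.pos_iff_ne_zero, Ne, Ideal.absNorm_eq_zero_iff]; exact v.ne_bot
    simp only [M]; omega
  have hMv : ∀ v ∈ T, v.valuation F (M : F) ≤ exp (-1 : ℤ) := by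
    intro v hv
    rw [← lt_one_iff_exp]
    have : (M : F) = algebraMap (𝓞 F) F (M : 𝓞 F) := by simp
    rw [this, valuation_lt_one_iff_mem]
    have h1 : ((Ideal.absNorm v.asIdeal : ℕ) : 𝓞 F) ∈ v.asIdeal := Ideal.absNorm_mem _
    refine Ideal.mem_of_dvd _ ?_ h1
    apply Nat.cast_dvd_cast
    exact (Finset.dvd_prod_of_mem (fun v : Pl F => Ideal.absNorm v.asIdeal) hv).trans (dvd_mul_left _ 2)
  have hfin : ∀ᶠ k : ℕ in Filter.atTop, ∀ v ∈ T, v.valuation F (wi - wf) * exp (-(k : ℤ)) < v.valuation F (ε v) := by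
    rw [Filter.eventually_all_finset]
    intro v hv
    exact exp_small _ (by simpa using hε v hv)
  have hinf : ∀ᶠ k : ℕ in Filter.atTop, ∀ ψ : F →+* ℝ, |ψ (wf - wi)| * (1 / 2) ^ k < ρ / 2 := by
    rw [Filter.eventually_all]
    intro ψ
    have h := (tendsto_pow_atTop_nhds_zero_of_lt_one (r := (1 / 2 : ℝ)) (by norm_num) (by norm_num)).const_mul |ψ (wf - wi)|
    rw [mul_zero] at h
    exact h.eventually_lt_const (half_pos hρ)
  obtain ⟨k, hk1, hk2, hk0⟩ := (hfin.and (hinf.and (Filter.eventually_ge_atTop 1))).exists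
  have hden : (1 + (M : F) ^ k) ≠ 0 := by
    have : ((1 + M ^ k : ℕ) : F) ≠ 0 := by
      rw [Nat.cast_ne_zero]; positivity
    simpa using this
  refine ⟨wf + (wi - wf) * ((M : F) ^ k / (1 + (M : F) ^ k)), fun v hv => ?_, fun ψ => ?_⟩
  · have h1 : v.valuation F ((M : F) ^ k) ≤ exp (-(k : ℤ)) := by
      rw [map_pow]
      refine (pow_le_pow_left₀ zero_le (hMv v hv) k).trans ?_
      rw [← WithZero.exp_nsmul]; simp
    have h2 : v.valuation F ((M : F) ^ k) < 1 := by
      refine lt_of_le_of_lt h1 ?_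
      rw [← WithZero.exp_zero, WithZero.exp_lt_exp]; omega
    have h3 : v.valuation F (1 + (M : F) ^ k) = 1 := by
      rw [Valuation.map_add_eq_of_lt_left _ (by rwa [map_one]), map_one]
    have e : wf + (wi - wf) * ((M : F) ^ k / (1 + (M : F) ^ k)) - f v =
      (wf - f v) + (wi - wf) * ((M : F) ^ k / (1 + (M : F) ^ k)) := by ring
    rw [e]
    refine Valuation.map_add_lt _ (hwf v hv) ?_
    rw [map_mul, map_div₀, h3, div_one]
    exact (mul_le_mul_right h1 _).trans_lt (hk1 v hv)
  · have e : wf + (wi - wf) * ((M : F) ^ k / (1 + (M : F) ^ k)) = wi + (wf - wi) * (1 / (1 + (M : F) ^ k)) := by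
      field_simp; ring
    have h1 : |ψ ((wf - wi) * (1 / (1 + (M : F) ^ k)))| < ρ / 2 := by
      refine lt_of_le_of_lt ?_ (hk2 ψ)
      rw [map_mul, abs_mul]
      refine mul_le_mul_of_nonneg_left ?_ (abs_nonneg _)
      rw [map_div₀, map_add, map_pow, map_one, map_natCast]
      have hM : (2 : ℝ) ^ k ≤ (M : ℝ) ^ k := pow_le_pow_left₀ (by norm_num) (by exact_mod_cast hM2) k
      rw [abs_of_pos (by positivity), div_pow, one_pow]
      exact one_div_le_one_div_of_le (by positivity) (by linarith)
    rw [e, map_add]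
    have h2 := hwi ψ
    rw [abs_lt] at *
    constructor <;> linarith

lemma qq_cont {n : ℕ} (q : Fin n → F) (v : Pl F) (y : Fin n → F) {δ : F} (hδ : δ ≠ 0) :
    ∃ γ : F, γ ≠ 0 ∧ ∀ x : Fin n → F, (∀ i, v.valuation F (x i - y i) < v.valuation F γ) →
      v.valuation F (qq q x - qq q y) < v.valuation F δ := by
  obtain ⟨π, hπ⟩ := v.valuation_exists_uniformizer F
  have hπ0 : π ≠ 0 := by rintro rfl; rw [map_zero] at hπ; exact WithZero.exp_ne_zero hπ.symm
  set δ' := δ * π with hδ'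
  have hδ'0 : δ' ≠ 0 := mul_ne_zero hδ hπ0
  have hδlt : v.valuation F δ' < v.valuation F δ := by
    rw [hδ', map_mul]
    have : 0 < v.valuation F δ := by rw [zero_lt_iff]; simpa using hδ
    refine mul_lt_of_lt_one_right this ?_
    rw [hπ, lt_one_iff_exp]
  obtain ⟨γ, hγ0, hγ⟩ := small_mult v (fun i : Option (Fin n ⊕ Fin n) =>
    i.elim δ' (Sum.elim (fun i => q i) (fun i => 2 * q i * y i))) hδ'0
  have hγ1 : v.valuation F γ ≤ 1 := by
    have h := hγ none
    simp only [Option.elim_none, map_mul] at h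
    exact (mul_le_iff_le_one_left (by rw [zero_lt_iff]; simpa using hδ'0)).1 h
  refine ⟨γ, hγ0, fun x hx => lt_of_le_of_lt ?_ hδlt⟩
  have e : qq q x - qq q y = ∑ i, ((x i - y i) * (q i) * (x i - y i) + (x i - y i) * (2 * q i * y i)) := by
    rw [qq, qq, ← Finset.sum_sub_distrib]
    exact Finset.sum_congr rfl fun i _ => by ring
  rw [e]
  refine Valuation.map_sum_le _ fun i _ => Valuation.map_add_le _ ?_ ?_
  · rw [map_mul]
    refine mul_le_of_le_of_le_one ?_ ((hx i).le.trans hγ1)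
    refine le_trans ?_ (hγ (some (Sum.inl i)))
    simp only [Option.elim_some, Sum.elim_inl, map_mul]
    exact mul_le_mul_left (hx i).le _
  · refine le_trans ?_ (hγ (some (Sum.inr i)))
    simp only [Option.elim_some, Sum.elim_inr]
    rw [map_mul, map_mul _ γ]
    exact mul_le_mul_left (hx i).le _

theorem thmG (hF : TR F) {d a c : F} (hd : TPos d) (ha : TPos a) (hc : c ≠ 0) : DD d a c := by
  classical
  have hd0 := hd.ne hF
  have ha0 := ha.ne hF
  have hfinR := finite_real (F := F)
  have hbfin := ((finite_dyadic (E := F)).union (finite_supp hd0)).union (finite_supp ha0)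
  set S := hbfin.toFinset with hS
  have hSn : ∀ v ∉ (S : Set (Pl F)), v.valuation F 2 = 1 ∧ v.valuation F d = 1 ∧ v.valuation F a = 1 := by
    intro v hv
    simp only [hS, Set.Finite.coe_toFinset, Set.mem_union, not_or, Set.mem_ofPred_eq, not_not] at hv
    exact ⟨hv.1.1, hv.1.2, hv.2⟩
  set y := (1 + d) / 2 with hy
  let q : Fin 4 → F := ![1, d, -a, -(a * d)]
  have hq : ∀ i, q i ≠ 0 := by
    intro i; fin_cases i <;> simp [q, hd0, ha0]
  have hqq : ∀ x : Fin 4 → F, qq q x = x 0 ^ 2 + d * x 1 ^ 2 - a * (x 2 ^ 2 + d * x 3 ^ 2) := by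
    intro x; simp [qq, q, Fin.sum_univ_four]; ring
  have h4d : (4 * d : F) ≠ 0 := mul_ne_zero (by norm_num) hd0
  have hκ : ∀ v : Pl F, ∃ κ : F, κ ≠ 0 ∧ v.valuation F κ ≤ 1 ∧ v.valuation F (κ * y ^ 2) ≤ v.valuation F (4 * d) := by
    intro v
    obtain ⟨κ, hκ0, hκ⟩ := small_mult v ![y ^ 2, 4 * d] h4d
    refine ⟨κ, hκ0, ?_, hκ 0⟩
    have h := hκ 1
    simp only [Matrix.cons_val_one, Matrix.cons_val_zero] at h
    rw [map_mul] at h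
    exact (mul_le_iff_le_one_left (by rw [zero_lt_iff]; simpa using hd0)).1 h
  choose κ hκ0 hκ1 hκy using hκ
  have hcκ : ∀ v, c * κ v ≠ 0 := fun v => mul_ne_zero hc (hκ0 v)
  choose z hz using fun v => locA hq v c (hcκ v)
  choose γ hγ0 hγ using fun v => qq_cont q v (z v) (hcκ v)
  -- real tolerance
  have htol : ∃ ρ : ℝ, 0 < ρ ∧ ∀ ψ : F →+* ℝ, ρ < 1 / 2 ∧ (1 + ψ d) * ρ ^ 2 < ψ a / 4 ∧ ψ a * (1 + ψ d) * ρ ^ 2 < 1 / 4 := by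
    have hev : ∀ᶠ ρ : ℝ in nhds 0, ∀ ψ : F →+* ℝ, ρ < 1 / 2 ∧ (1 + ψ d) * ρ ^ 2 < ψ a / 4 ∧ ψ a * (1 + ψ d) * ρ ^ 2 < 1 / 4 := by
      rw [Filter.eventually_all]
      intro ψ
      have hc1 : Continuous fun ρ : ℝ => (1 + ψ d) * ρ ^ 2 := by fun_prop
      have hc2 : Continuous fun ρ : ℝ => ψ a * (1 + ψ d) * ρ ^ 2 := by fun_prop
      refine (gt_mem_nhds (by norm_num)).and ((?_ : ∀ᶠ _ in _, _).and ?_)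
      · exact hc1.continuousAt.eventually_lt continuousAt_const (by simpa using ha ψ)
      · exact hc2.continuousAt.eventually_lt continuousAt_const (by simp)
    obtain ⟨ρ, h1, h2⟩ := ((hev.filter_mono nhdsWithin_le_nhds).and (self_mem_nhdsWithin (s := Set.Ioi (0:ℝ)))).exists
    exact ⟨ρ, h2, h1⟩
  obtain ⟨ρ, hρ, hρψ⟩ := htol
  let tgt : (F →+* ℝ) → Fin 4 → ℝ := fun ψ => if 0 < ψ c then ![1, 0, 0, 0] else ![0, 0, 1, 0]
  choose x hx1 hx2 using fun i : Fin 4 => sapprox S (fun v => z v i) γ (fun v _ => hγ0 v) (fun ψ => tgt ψ i) hρ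
  set n := qq q x with hn
  have hnv : ∀ v ∈ S, v.valuation F (n - c) < v.valuation F (c * κ v) := by
    intro v hv
    have h1 := hγ v x (fun i => hx1 i v hv)
    have := Valuation.map_add_lt _ h1 (hz v)
    rwa [sub_add_sub_cancel] at this
  have hsgn : ∀ ψ : F →+* ℝ, 0 < ψ n / ψ c := by
    intro ψ
    obtain ⟨t1, t2, t3⟩ := hρψ ψ
    have hdψ := hd ψ
    have haψ := ha ψ
    have hn' : ψ n = ψ (x 0) ^ 2 + ψ d * ψ (x 1) ^ 2 - ψ a * (ψ (x 2) ^ 2 + ψ d * ψ (x 3) ^ 2) := by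
      rw [hn, hqq]; simp
    have sqle : ∀ s : ℝ, |s| < ρ → s ^ 2 ≤ ρ ^ 2 := by
      intro s hs
      rw [← sq_abs]; exact pow_le_pow_left₀ (abs_nonneg _) hs.le 2
    have hcψ : ψ c ≠ 0 := by simpa using hc
    have g0 := hx2 0 ψ
    have g1 := hx2 1 ψ
    have g2 := hx2 2 ψ
    have g3 := hx2 3 ψ
    by_cases hpos : 0 < ψ c
    · simp [tgt, hpos] at g0 g1 g2 g3
      apply div_pos _ hpos
      have s2 := sqle _ g2
      have s3 := sqle _ g3
      rw [abs_lt] at g0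
      have s0 : 1 / 4 < ψ (x 0) ^ 2 := by nlinarith
      rw [hn']
      have m1 : ψ a * (ψ (x 2) ^ 2 + ψ d * ψ (x 3) ^ 2) ≤ ψ a * (1 + ψ d) * ρ ^ 2 := by
        have : ψ (x 2) ^ 2 + ψ d * ψ (x 3) ^ 2 ≤ ρ ^ 2 + ψ d * ρ ^ 2 := by gcongr
        nlinarith
      have := mul_nonneg hdψ.le (sq_nonneg (ψ (x 1)))
      linarith
    · simp [tgt, hpos] at g0 g1 g2 g3
      have hneg : ψ c < 0 := lt_of_le_of_ne (not_lt.1 hpos) hcψ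
      apply div_pos_of_neg_of_neg _ hneg
      have s0 := sqle _ g0
      have s1 := sqle _ g1
      rw [abs_lt] at g2
      have s2 : 1 / 4 < ψ (x 2) ^ 2 := by nlinarith
      rw [hn']
      have m1 : ψ (x 0) ^ 2 + ψ d * ψ (x 1) ^ 2 ≤ ρ ^ 2 + ψ d * ρ ^ 2 := by gcongr
      have m2 : ψ a / 4 < ψ a * ψ (x 2) ^ 2 := by nlinarith
      have := mul_nonneg haψ.le (mul_nonneg hdψ.le (sq_nonneg (ψ (x 3))))
      nlinarith
  have hn0 : n ≠ 0 := by
    obtain ⟨ψ, -⟩ := hF.exists_real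
    intro h
    have := hsgn ψ
    rw [h] at this; simp at this
  obtain ⟨t, ht1, ht2⟩ := sapprox S (fun _ => 1) κ (fun v _ => hκ0 v) (fun ψ => 2 + ψ n / ψ c) one_pos
  have htψ : ∀ ψ : F →+* ℝ, 1 ≤ ψ (c * t ^ 2 / n) := by
    intro ψ
    have h1 := hsgn ψ
    have h2 := ht2 ψ
    rw [abs_lt] at h2
    set s := ψ n / ψ c with hs
    have e : ψ (c * t ^ 2 / n) = ψ t ^ 2 / s := by
      rw [hs]; simp; field_simp
    rw [e, le_div_iff₀ h1]
    nlinarith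
  have ht0 : t ≠ 0 := by
    obtain ⟨ψ, -⟩ := hF.exists_real
    rintro rfl
    have := htψ ψ
    simp at this
    linarith
  apply DD.sq_mul ht0
  have hDn : DD d a n := ⟨x 0, x 1, x 2, x 3, by rw [hn, hqq]⟩
  have hD1 : DD d a (c * t ^ 2 / n) := by
    refine thmG1 hF hd ha S.finite_toSet hSn htψ ?_
    intro v hv
    have hvc : 0 < v.valuation F c := by rw [zero_lt_iff]; simpa using hc
    have k1 := hnv v hv
    have hnc : v.valuation F n = v.valuation F c := by
      have : v.valuation F (n - c) < v.valuation F c := by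
        refine k1.trans_le ?_
        rw [map_mul]; exact mul_le_of_le_one_right zero_le (hκ1 v)
      have := Valuation.map_add_eq_of_lt_left _ this
      rwa [add_sub_cancel] at this
    have k2 : v.valuation F (c * t ^ 2 - c) < v.valuation F (c * κ v) := by
      have e : c * t ^ 2 - c = c * ((t - 1) * (t - 1 + 2)) := by ring
      have h1 := ht1 v hv
      have h2 : v.valuation F (t - 1 + 2) ≤ 1 := Valuation.map_add_le _ (h1.le.trans (hκ1 v)) (two_le_one v)
      rw [e, map_mul, map_mul, map_mul]
      refine (mul_lt_mul_iff_right₀ hvc).2 (lt_of_le_of_lt (mul_le_of_le_one_right zero_le h2) h1)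
    have k3 : v.valuation F (c * t ^ 2 - n) < v.valuation F (c * κ v) := by
      have := Valuation.map_sub_lt _ k2 k1
      rwa [sub_sub_sub_cancel_right] at this
    have e : (c * t ^ 2 / n - 1) * y ^ 2 = (c * t ^ 2 - n) / n * y ^ 2 := by field_simp
    have hy0 : y ≠ 0 := by
      have : TPos (1 + d) := fun ψ => by rw [map_add, map_one]; linarith [hd ψ]
      exact div_ne_zero (this.ne hF) two_ne_zero
    rw [e, map_mul, map_div₀, hnc]
    refine lt_of_lt_of_le ?_ (hκy v)
    rw [map_mul]
    refine (mul_lt_mul_iff_left₀ (by rw [zero_lt_iff]; simpa using hy0)).2 ?_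
    rw [div_lt_iff₀ hvc, ← map_mul, mul_comm (κ v) c]
    exact k3
  have := hDn.mul hD1
  rwa [mul_div_cancel₀ _ hn0] at this

end Lh

set_option linter.unusedSectionVars false
namespace Lh
open NumberField
variable {F : Type*} [Field F] [NumberField F]

lemma two_elem (hF : TR F) {a b c : F} (ha : a ≠ 0) (hb : b ≠ 0) (hc : c ≠ 0) :
    ∃ y : F, a * y ^ 2 + b ≠ 0 ∧ ∀ ψ : F →+* ℝ, (0 < ψ (a * c) ∨ 0 < ψ (b * c)) → 0 < ψ ((a * y ^ 2 + b) * c) := by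
  classical
  have := finite_real (F := F)
  obtain ⟨ψ₁, -⟩ := hF.exists_real
  have : Nonempty (F →+* ℝ) := ⟨ψ₁⟩
  let B : (F →+* ℝ) → ℝ := fun ψ => |ψ (b / a)|
  have hB : ∀ ψ, 0 < B ψ := fun ψ => by
    simp only [B, abs_pos]; exact (map_ne_zero ψ).2 (div_ne_zero hb ha)
  obtain ⟨ψ₀, h0⟩ := Finite.exists_min B
  obtain ⟨y, hy⟩ := real_dense (fun ψ => if 0 < ψ (a * c) then B ψ + 2 else 0) (lt_min one_pos (hB ψ₀))
  have key : ∀ ψ : F →+* ℝ, ψ ((a * y ^ 2 + b) * c) ≠ 0 ∧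
     ((0 < ψ (a * c) ∨ 0 < ψ (b * c)) → 0 < ψ ((a * y ^ 2 + b) * c)) := by
    intro ψ
    have h1 := hy ψ
    have h2 := h0 ψ
    have hBp := hB ψ
    have e : ψ ((a * y ^ 2 + b) * c) = ψ (a * c) * ψ y ^ 2 + ψ (b * c) := by
      simp only [map_mul, map_add, map_pow]; ring
    have hac : ψ (a * c) ≠ 0 := (map_ne_zero ψ).2 (mul_ne_zero ha hc)
    have hbc : ψ (b * c) ≠ 0 := (map_ne_zero ψ).2 (mul_ne_zero hb hc)
    have e2 : |ψ (b * c)| = B ψ * |ψ (a * c)| := by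
      simp only [B]; rw [← abs_mul, ← map_mul]; congr 2; field_simp
    have hm1 := min_le_left 1 (B ψ₀)
    have hm2 := min_le_right 1 (B ψ₀)
    rw [e]
    split_ifs at h1 with h
    · have : 0 < ψ (a * c) * ψ y ^ 2 + ψ (b * c) := by
        have h3 := (abs_lt.1 h1).1
        have h4 : B ψ + 1 < ψ y := by linarith
        have h5 : B ψ < ψ y ^ 2 := by nlinarith
        rw [abs_of_pos h] at e2
        have := neg_abs_le (ψ (b * c))
        nlinarith
      exact ⟨this.ne', fun _ => this⟩
    · have hn : ψ (a * c) < 0 := lt_of_le_of_ne (not_lt.1 h) hac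
      rw [sub_zero] at h1
      have h5 : ψ y ^ 2 < B ψ := by
        rw [← sq_abs]; nlinarith [abs_nonneg (ψ y)]
      rw [abs_of_neg hn] at e2
      rcases lt_or_gt_of_ne hbc with hb' | hb'
      · refine ⟨ne_of_lt (by nlinarith [sq_nonneg (ψ y)]), fun h' => ?_⟩
        rcases h' with h' | h' <;> linarith
      · rw [abs_of_pos hb'] at e2
        have : 0 < ψ (a * c) * ψ y ^ 2 + ψ (b * c) := by nlinarith
        exact ⟨this.ne', fun _ => this⟩
  refine ⟨y, fun h => (key ψ₁).1 (by rw [h]; simp), fun ψ => (key ψ).2⟩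

lemma DD_one (d c a1 a2 : F) (h : a1 ^ 2 + d * a2 ^ 2 ≠ 0) : DD d (a1 ^ 2 + d * a2 ^ 2) c := by
  -- c = ((c+1)/2)^2 - ((c-1)/2)^2 and division by the norm
  refine ⟨(c + 1) / 2, 0, (c - 1) / 2 * a1 / (a1 ^ 2 + d * a2 ^ 2), (c - 1) / 2 * a2 / (a1 ^ 2 + d * a2 ^ 2), ?_⟩
  field_simp
  ring

lemma DD_div {d a c x1 x2 y1 y2 z1 z2 : F} (hz : z1 ^ 2 + d * z2 ^ 2 ≠ 0)
    (key : x1 ^ 2 + d * x2 ^ 2 = a * (y1 ^ 2 + d * y2 ^ 2) + c * (z1 ^ 2 + d * z2 ^ 2)) : DD d a c := by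
  obtain ⟨Z, hZ⟩ : ∃ Z, Z = z1 ^ 2 + d * z2 ^ 2 := ⟨_, rfl⟩
  rw [← hZ] at hz
  refine ⟨(x1 * z1 + d * x2 * z2) / Z, (x2 * z1 - x1 * z2) / Z, (y1 * z1 + d * y2 * z2) / Z, (y2 * z1 - y1 * z2) / Z, ?_⟩
  field_simp
  rw [hZ]
  linear_combination (-(z1 ^ 2 + d * z2 ^ 2)) * key

theorem thmG' (hF : TR F) {d a c : F} (hd : TPos d) (ha : a ≠ 0) (hc : c ≠ 0)
    (h : ∀ ψ : F →+* ℝ, 0 < ψ a ∨ 0 < ψ c) : DD d a c := by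
  obtain ⟨y, hn0, hy⟩ := two_elem hF ha hc (one_ne_zero (α := F))
  set n := a * y ^ 2 + c with hn
  have hnp : TPos n := fun ψ => by
    have := hy ψ (by simpa using h ψ)
    simpa using this
  obtain ⟨x1, x2, s1, s2, hx⟩ := thmG hF hd hnp (mul_ne_zero (mul_ne_zero ha hc) hn0)
  -- N(x) = a N(Y) + c N(Z), Y = y s - c, Z = s + a y
  have key : x1 ^ 2 + d * x2 ^ 2 = a * ((y * s1 - c) ^ 2 + d * (y * s2) ^ 2) + c * ((s1 + a * y) ^ 2 + d * s2 ^ 2) := by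
    have : x1 ^ 2 + d * x2 ^ 2 = a * c * n + n * (s1 ^ 2 + d * s2 ^ 2) := by rw [hx]; ring
    rw [this, hn]; ring
  by_cases hz : (s1 + a * y) ^ 2 + d * s2 ^ 2 = 0
  · obtain ⟨z1, z2⟩ := nrm_ne hF hd hz
    rw [hz, z2] at key
    have hs : s1 = - (a * y) := by linear_combination z1
    rw [hs] at key
    have k2 : x1 ^ 2 + d * x2 ^ 2 = a * n ^ 2 := by rw [key, hn]; ring
    have : a = (x1 / n) ^ 2 + d * (x2 / n) ^ 2 := by
      field_simp; rw [← k2]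
    rw [this]
    apply DD_one
    rw [← this]; exact ha
  · exact DD_div hz key

inductive Cg (d : F) : List F → List F → Prop
  | refl (l : List F) : Cg d l l
  | trans {l l' l'' : List F} : Cg d l l' → Cg d l' l'' → Cg d l l''
  | cons (a : F) {l l' : List F} : Cg d l l' → Cg d (a :: l) (a :: l')
  | bin (a b c x1 x2 y1 y2 : F) (l : List F) (hc : c = a * (x1 ^ 2 + d * x2 ^ 2) + b * (y1 ^ 2 + d * y2 ^ 2)) (h0 : c ≠ 0) :
      Cg d (a :: b :: l) (c :: (a * b * c) :: l)
  | scale (a x1 x2 : F) (l : List F) (h0 : x1 ^ 2 + d * x2 ^ 2 ≠ 0) : Cg d (a :: l) (a * (x1 ^ 2 + d * x2 ^ 2) :: l)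

lemma Cg.len {d : F} {l l' : List F} (h : Cg d l l') : l.length = l'.length := by
  induction h <;> simp_all

lemma Cg.nz {d : F} {l l' : List F} (h : Cg d l l') : (0 : F) ∉ l → (0 : F) ∉ l' := by
  induction h with
  | refl => exact id
  | trans _ _ h1 h2 => exact h2 ∘ h1
  | cons a _ ih => simp only [List.mem_cons, not_or]; exact fun h => ⟨h.1, ih h.2⟩
  | bin a b c x1 x2 y1 y2 l hc h0 =>
    simp only [List.mem_cons, not_or]
    rintro ⟨h1, h2, h3⟩
    exact ⟨h0.symm, (mul_ne_zero (mul_ne_zero (Ne.symm h1) (Ne.symm h2)) h0).symm, h3⟩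
  | scale a x1 x2 l h0 =>
    simp only [List.mem_cons, not_or]
    rintro ⟨h1, h2⟩
    exact ⟨(mul_ne_zero (Ne.symm h1) h0).symm, h2⟩

def NmN (d u : F) : Prop := u ≠ 0 ∧ ∃ x1 x2 : F, u = x1 ^ 2 + d * x2 ^ 2
lemma NmN.mul {d u v : F} : NmN d u → NmN d v → NmN d (u * v) := by
  rintro ⟨h, x1, x2, rfl⟩ ⟨h', y1, y2, rfl⟩
  exact ⟨mul_ne_zero h h', x1 * y1 - d * x2 * y2, x1 * y2 + x2 * y1, by ring⟩
lemma NmN.inv {d u : F} : NmN d u → NmN d u⁻¹ := by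
  rintro ⟨h, x1, x2, rfl⟩
  exact ⟨inv_ne_zero h, x1 / (x1 ^ 2 + d * x2 ^ 2), x2 / (x1 ^ 2 + d * x2 ^ 2), by field_simp⟩
lemma NmN.sq {d u : F} (h : u ≠ 0) : NmN d (u * u) := ⟨mul_ne_zero h h, u, 0, by ring⟩
lemma NmN.one {d : F} : NmN d 1 := ⟨one_ne_zero, 1, 0, by ring⟩

lemma Cg.prod {d : F} {l l' : List F} (h : Cg d l l') : ∃ u, NmN d u ∧ l'.prod = l.prod * u := by
  induction h with
  | refl => exact ⟨1, .one, by simp⟩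
  | trans _ _ h1 h2 =>
    obtain ⟨u, hu, e⟩ := h1
    obtain ⟨v, hv, e'⟩ := h2
    exact ⟨u * v, hu.mul hv, by rw [e', e]; ring⟩
  | cons a _ ih =>
    obtain ⟨u, hu, e⟩ := ih
    exact ⟨u, hu, by simp only [List.prod_cons, e]; ring⟩
  | bin a b c x1 x2 y1 y2 l hc h0 => exact ⟨c * c, .sq h0, by simp only [List.prod_cons]; ring⟩
  | scale a x1 x2 l h0 => exact ⟨_, ⟨h0, x1, x2, rfl⟩, by simp only [List.prod_cons]; ring⟩

noncomputable def pc (ψ : F →+* ℝ) (l : List F) : ℕ := by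
  classical exact l.countP (fun x => decide (0 < ψ x))
lemma pc_cons (ψ : F →+* ℝ) (a : F) (l : List F) : pc ψ (a :: l) = pc ψ l + (by classical exact if 0 < ψ a then 1 else 0) := by
  classical
  simp only [pc, List.countP_cons, decide_eq_true_eq]
lemma Cg.pc {d : F} (hd : TPos d) {l l' : List F} (h : Cg d l l') (ψ : F →+* ℝ) : (0 : F) ∉ l → Lh.pc ψ l = Lh.pc ψ l' := by
  induction h with
  | refl => intro _; rfl
  | trans h _ h1 h2 => intro h0; exact (h1 h0).trans (h2 (h.nz h0))
  | cons a _ ih => simp only [List.mem_cons, not_or]; exact fun h => by rw [pc_cons, pc_cons, ih h.2]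
  | bin a b c x1 x2 y1 y2 l hc h0 =>
    simp only [List.mem_cons, not_or]
    rintro ⟨h1, h2, h3⟩
    have ha : ψ a ≠ 0 := (map_ne_zero ψ).2 (Ne.symm h1)
    have hb : ψ b ≠ 0 := (map_ne_zero ψ).2 (Ne.symm h2)
    have hcc : ψ c ≠ 0 := (map_ne_zero ψ).2 h0
    have e : ψ c = ψ a * (ψ x1 ^ 2 + ψ d * ψ x2 ^ 2) + ψ b * (ψ y1 ^ 2 + ψ d * ψ y2 ^ 2) := by rw [hc]; simp
    have hX : 0 ≤ ψ x1 ^ 2 + ψ d * ψ x2 ^ 2 := by have := hd ψ; positivity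
    have hY : 0 ≤ ψ y1 ^ 2 + ψ d * ψ y2 ^ 2 := by have := hd ψ; positivity
    simp only [pc_cons, map_mul, add_assoc]
    congr 1
    rcases lt_or_gt_of_ne ha with ha | ha <;> rcases lt_or_gt_of_ne hb with hb | hb
    · have hab := mul_pos_of_neg_of_neg ha hb
      have : ψ c < 0 := lt_of_le_of_ne (by nlinarith) hcc
      have h4 := mul_neg_of_pos_of_neg hab this
      simp [ha.not_gt, hb.not_gt, this.not_gt, h4.not_gt]
    · have hab := mul_neg_of_neg_of_pos ha hb
      rcases lt_or_gt_of_ne hcc with this | this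
      · have h4 := mul_pos_of_neg_of_neg hab this
        simp [ha.not_gt, hb, this.not_gt, h4]
      · have h4 := mul_neg_of_neg_of_pos hab this
        simp [ha.not_gt, hb, this, h4.not_gt]
    · have hab := mul_neg_of_pos_of_neg ha hb
      rcases lt_or_gt_of_ne hcc with this | this
      · have h4 := mul_pos_of_neg_of_neg hab this
        simp [hb.not_gt, ha, this.not_gt, h4]
      · have h4 := mul_neg_of_neg_of_pos hab this
        simp [hb.not_gt, ha, this, h4.not_gt]
    · have hab := mul_pos ha hb
      have : 0 < ψ c := lt_of_le_of_ne (by nlinarith) (Ne.symm hcc)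
      have h4 := mul_pos hab this
      simp [ha, hb, this, h4]
  | scale a x1 x2 l h0 =>
    intro _
    have hX : 0 < ψ x1 ^ 2 + ψ d * ψ x2 ^ 2 := by
      have h1 := hd ψ
      refine lt_of_le_of_ne (by positivity) ?_
      intro h; apply (map_ne_zero ψ).2 h0; simp [← h]
    rw [pc_cons, pc_cons]
    congr 1
    have : 0 < ψ (a * (x1 ^ 2 + d * x2 ^ 2)) ↔ 0 < ψ a := by
      rw [map_mul, map_add, map_mul, map_pow, map_pow]
      exact mul_pos_iff_of_pos_right hX
    simp only [this]

lemma splitsum (hF : TR F) {d c : F} (hc : c ≠ 0) (b : F) (l : List F) (h0 : (0 : F) ∉ b :: l) :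
    ∃ e r, Cg d (b :: l) (e :: r) ∧ e ≠ 0 ∧ ∀ ψ : F →+* ℝ, (∃ j ∈ b :: l, 0 < ψ (j * c)) → 0 < ψ (e * c) := by
  induction l generalizing b with
  | nil =>
    refine ⟨b, [], .refl _, ?_, ?_⟩
    · simpa [eq_comm] using h0
    · rintro ψ ⟨j, hj, h⟩
      simp only [List.mem_cons, List.not_mem_nil, or_false] at hj
      rwa [← hj]
  | cons b' l ih =>
    rw [List.mem_cons, not_or] at h0
    obtain ⟨e, r, h1, he, h2⟩ := ih b' h0.2
    obtain ⟨y, hy0, hy⟩ := two_elem hF (Ne.symm h0.1) he hc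
    refine ⟨b * y ^ 2 + e, _, (h1.cons b).trans (.bin b e _ y 0 1 0 r (by ring) hy0), hy0, ?_⟩
    rintro ψ ⟨j, hj, h⟩
    apply hy
    rw [List.mem_cons] at hj
    rcases hj with rfl | hj
    · exact Or.inl h
    · exact Or.inr (h2 ψ ⟨j, hj, h⟩)

lemma rep (hF : TR F) {d c : F} (hd : TPos d) (hc : c ≠ 0) (a b : F) (l : List F) (h0 : (0 : F) ∉ a :: b :: l)
    (h : ∀ ψ : F →+* ℝ, ∃ j ∈ a :: b :: l, 0 < ψ (j * c)) : ∃ r, Cg d (a :: b :: l) (c :: r) := by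
  rw [List.mem_cons, not_or] at h0
  have ha : a ≠ 0 := Ne.symm h0.1
  obtain ⟨e, r, h1, he, h2⟩ := splitsum hF (d := d) hc b l h0.2
  have : DD d (-e / a) (c / a) := by
    refine thmG' hF hd (div_ne_zero (neg_ne_zero.2 he) ha) (div_ne_zero hc ha) fun ψ => ?_
    have haψ : ψ a ≠ 0 := (map_ne_zero ψ).2 ha
    have hcψ : ψ c ≠ 0 := (map_ne_zero ψ).2 hc
    have h3 : 0 < ψ (a * c) ∨ 0 < ψ (e * c) := by
      obtain ⟨j, hj, hp⟩ := h ψ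
      rw [List.mem_cons] at hj
      rcases hj with rfl | hj
      · exact Or.inl hp
      · exact Or.inr (h2 ψ ⟨j, hj, hp⟩)
    simp only [map_mul, map_div₀, map_neg] at h3 ⊢
    rcases lt_or_gt_of_ne haψ with h4 | h4 <;> rcases lt_or_gt_of_ne hcψ with h5 | h5
    · exact Or.inr (div_pos_of_neg_of_neg h5 h4)
    · left
      rcases h3 with h3 | h3
      · nlinarith
      · have : 0 < ψ e := pos_of_mul_pos_left h3 h5.le
        exact div_pos_of_neg_of_neg (by linarith) h4
    · left
      rcases h3 with h3 | h3
      · nlinarith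
      · have : ψ e < 0 := by by_contra h; nlinarith
        exact div_pos (by linarith) h4
    · exact Or.inr (div_pos h5 h4)
  obtain ⟨x1, x2, y1, y2, hx⟩ := this
  refine ⟨_, (h1.cons a).trans (.bin a e c x1 x2 y1 y2 r ?_ hc)⟩
  field_simp at hx
  rw [hx]; ring

lemma pc_le (ψ : F →+* ℝ) (l : List F) : pc ψ l ≤ l.length := by
  classical
  exact List.countP_le_length

theorem landherr (hF : TR F) {d : F} (hd : TPos d) (l' : List F) : ∀ l : List F, (0 : F) ∉ l → (0 : F) ∉ l' →
    l.length = l'.length → (∀ ψ, pc ψ l = pc ψ l') → (∃ u, NmN d u ∧ l'.prod = l.prod * u) → Cg d l l' := by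
  classical
  induction l' with
  | nil => intro l _ _ h _ _; rw [List.length_eq_zero_iff.1 h]; exact .refl _
  | cons c l' ih =>
    intro l h0 h0' hlen hpc hprod
    match l, h0, hlen, hpc, hprod with
    | [a], h0, hlen, hpc, hprod =>
      have : l' = [] := by
        simp only [List.length_cons, List.length_nil] at hlen
        exact List.length_eq_zero_iff.1 (by omega)
      subst this
      obtain ⟨u, ⟨hu, x1, x2, rfl⟩, hp⟩ := hprod
      simp only [List.prod_cons, List.prod_nil, mul_one] at hp
      rw [hp]
      exact .scale a x1 x2 [] hu
    | a :: b :: l, h0, hlen, hpc, hprod =>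
      have hc : c ≠ 0 := fun h => h0' (by simp [h])
      obtain ⟨r, hr⟩ := rep hF hd hc a b l h0 (fun ψ => by
        have hcψ : ψ c ≠ 0 := (map_ne_zero ψ).2 hc
        have hh := hpc ψ
        rw [pc_cons ψ c] at hh
        rcases lt_or_gt_of_ne hcψ with h5 | h5
        · rw [if_neg h5.not_gt] at hh
          have h6 := pc_le ψ l'
          have h7 : ¬ (∀ j ∈ a :: b :: l, 0 < ψ j) := by
            intro hall
            have : pc ψ (a :: b :: l) = (a :: b :: l).length := by
              simp only [pc]
              rw [List.countP_eq_length]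
              intro j hj; simpa using hall j hj
            rw [List.length_cons (a := c)] at hlen
            omega
          push Not at h7
          obtain ⟨j, hj, hle⟩ := h7
          refine ⟨j, hj, ?_⟩
          have : ψ j ≠ 0 := (map_ne_zero ψ).2 (fun h => h0 (h ▸ hj))
          rw [map_mul]
          exact mul_pos_of_neg_of_neg (lt_of_le_of_ne hle this) h5
        · rw [if_pos h5] at hh
          have : 0 < pc ψ (a :: b :: l) := by omega
          simp only [pc] at this
          rw [List.countP_pos_iff] at this
          obtain ⟨j, hj, hp⟩ := this
          refine ⟨j, hj, ?_⟩
          rw [map_mul]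
          exact mul_pos (by simpa using hp) h5)
      refine hr.trans (.cons c (ih r ?_ ?_ ?_ ?_ ?_))
      · exact fun h => hr.nz h0 (List.mem_cons_of_mem _ h)
      · exact fun h => h0' (List.mem_cons_of_mem _ h)
      · have := hr.len
        rw [hlen] at this
        simpa using this.symm
      · intro ψ
        have h1 := hr.pc hd ψ h0
        rw [hpc ψ, pc_cons, pc_cons] at h1
        omega
      · obtain ⟨u, hu, e⟩ := hprod
        obtain ⟨v, hv, e'⟩ := hr.prod
        refine ⟨v⁻¹ * u, hv.inv.mul hu, ?_⟩
        have hv0 := hv.1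
        rw [List.prod_cons] at e e'
        apply mul_left_cancel₀ hc
        rw [e, ← mul_assoc, e']
        field_simp

end Lh

set_option linter.unusedSectionVars false
namespace Lh
open NumberField
open scoped Matrix

theorem orth_basis {K : Type*} [Field K] (ι : K ≃+* K) (δ : K) (hδ : ι δ = -δ) (hδ0 : δ ≠ 0) (h2 : (2 : K) ≠ 0) (n : ℕ) :
    ∀ (V : Type*) [AddCommGroup V] [Module K V] [FiniteDimensional K V] (h : V → (V →ₗ[K] K))
      (_ : ∀ x y, h y x = ι (h x y)) (_ : Module.finrank K V = n),
      ∃ b : Module.Basis (Fin n) K V, ∀ i j, i ≠ j → h (b i) (b j) = 0 := by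
  induction n with
  | zero =>
    intro V _ _ _ h hs hn
    exact ⟨Module.finBasisOfFinrankEq K V hn, fun i => i.elim0⟩
  | succ n ih =>
    intro V _ _ _ h hs hn
    by_cases h0 : ∀ x y, h x y = 0
    · exact ⟨Module.finBasisOfFinrankEq K V hn, fun i j _ => h0 _ _⟩
    have hadd : ∀ x y z, h (x + y) z = h x z + h y z := fun x y z => by
      rw [hs z (x + y), map_add, map_add, ← hs, ← hs]
    have hsmul : ∀ (c : K) x z, h (c • x) z = ι c * h x z := fun c x z => by
      rw [hs z (c • x), map_smul, smul_eq_mul, map_mul, ← hs]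
    have hx : ∃ x, h x x ≠ 0 := by
      by_contra hall
      push Not at hall
      apply h0
      intro x y
      have e1 := hall (x + y)
      have e2 := hall (δ • x + y)
      simp only [hadd, map_add, hsmul, map_smul, smul_eq_mul, hall, hδ] at e1 e2
      have e3 : 2 * δ * h x y = 0 := by linear_combination δ * e1 - e2
      simpa [h2, hδ0] using e3
    obtain ⟨x, hx⟩ := hx
    let W := LinearMap.ker (h x)
    have hW : Module.finrank K W = n := by
      have h1 := LinearMap.finrank_range_add_finrank_ker (h x)
      have h3 : LinearMap.range (h x) = ⊤ := by
        rw [LinearMap.range_eq_top]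
        apply LinearMap.surjective
        intro h; apply hx; rw [h]; rfl
      rw [h3, finrank_top, Module.finrank_self, hn] at h1
      have : Module.finrank K W = Module.finrank K (LinearMap.ker (h x)) := rfl
      omega
    obtain ⟨b, hb⟩ := ih W (fun w => (h w).comp W.subtype) (fun w w' => hs _ _) hW
    refine ⟨Module.Basis.mkFinCons x b ?_ ?_, ?_⟩
    · intro c w hw e
      have hw' : h x w = 0 := hw
      have := congrArg (h x) e
      rw [map_add, map_smul, hw', add_zero, map_zero, smul_eq_mul] at this
      exact (mul_eq_zero.1 this).resolve_right hx
    · intro z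
      refine ⟨-(h x z / h x x), ?_⟩
      change h x _ = 0
      rw [map_add, map_smul, smul_eq_mul]; field_simp; ring
    · rw [Module.Basis.coe_mkFinCons]
      have k : ∀ i, h x (b i) = 0 := fun i => (b i).2
      intro i j
      refine Fin.cases ?_ (fun i => ?_) i <;> refine Fin.cases ?_ (fun j => ?_) j
      · intro h; exact absurd rfl h
      · intro _; exact k j
      · intro _
        simp only [Fin.cons_succ, Fin.cons_zero, Function.comp]
        rw [hs x, k, map_zero]
      · intro hij
        exact hb i j (fun h => hij (by rw [h]))

theorem diagz {F K : Type*} [Field F] [Field K] [Algebra F K] (ι : K ≃+* K)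
    (hinv : ∀ x, ι (ι x) = x) (hfix : ∀ x : K, ι x = x ↔ ∃ y : F, algebraMap F K y = x)
    (δ : K) (hδ : ι δ = -δ) (hδ0 : δ ≠ 0) (h2 : (2 : K) ≠ 0) (m : ℕ)
    (M : Matrix (Fin m) (Fin m) K) (hM : Mᵀ = M.map ι) :
    ∃ (P : Matrix (Fin m) (Fin m) K) (a : Fin m → F), IsUnit P.det ∧
      Pᵀ * M * P.map ι = Matrix.diagonal (fun i => algebraMap F K (a i)) := by
  classical
  have hMij : ∀ i j, M j i = ι (M i j) := fun i j => by
    have := congrFun (congrFun hM i) j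
    simpa using this
  let h : (Fin m → K) → ((Fin m → K) →ₗ[K] K) := fun y =>
    (LinearMap.proj (R := K) (φ := fun _ : Unit => K) ()).comp
      ((Matrix.of fun (_ : Unit) i => ∑ j, M i j * ι (y j)) : Matrix Unit (Fin m) K).mulVecLin
  have hh : ∀ x y, h y x = ∑ i, ∑ j, x i * M i j * ι (y j) := by
    intro x y
    simp only [h, LinearMap.comp_apply, LinearMap.proj_apply, Matrix.mulVecLin_apply, Matrix.mulVec, dotProduct, Matrix.of_apply]
    refine Finset.sum_congr rfl fun i _ => ?_
    rw [Finset.sum_mul]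
    refine Finset.sum_congr rfl fun j _ => by ring
  obtain ⟨b, hb⟩ := orth_basis ι δ hδ hδ0 h2 m (Fin m → K) h (fun x y => by
    rw [hh, hh, map_sum, Finset.sum_comm]
    refine Finset.sum_congr rfl fun i _ => ?_
    rw [map_sum]
    refine Finset.sum_congr rfl fun j _ => ?_
    rw [map_mul, map_mul, hinv, ← hMij]; ring) (by simp)
  let P : Matrix (Fin m) (Fin m) K := Matrix.of fun i j => b j i
  have hP : P = (Pi.basisFun K (Fin m)).toMatrix b := by
    ext i j; simp [P, Module.Basis.toMatrix_apply]
  have hent : ∀ i j, (Pᵀ * M * P.map ι) i j = h (b j) (b i) := by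
    intro i j
    rw [hh]
    simp only [Matrix.mul_apply, Matrix.transpose_apply, Matrix.map_apply, P, Matrix.of_apply, Finset.sum_mul]
    rw [Finset.sum_comm]
  have hd : ∀ i, ∃ y : F, algebraMap F K y = h (b i) (b i) := fun i => by
    rw [← hfix, hh, map_sum, Finset.sum_comm]
    refine Finset.sum_congr rfl fun i _ => ?_
    rw [map_sum]
    refine Finset.sum_congr rfl fun j _ => ?_
    rw [map_mul, map_mul, hinv, ← hMij]; ring
  choose a ha using hd
  refine ⟨P, a, ?_, ?_⟩
  · rw [hP, ← Module.Basis.det_apply]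
    exact Module.Basis.isUnit_det _ _
  · ext i j
    rw [hent, Matrix.diagonal_apply]
    split_ifs with hij
    · rw [← hij, ha]
    · exact hb _ _ (Ne.symm hij)

section sound
variable {F K : Type*} [Field F] [NumberField F] [Field K] [Algebra F K] (ι : K ≃+* K)

noncomputable def Dg (K : Type*) [Field K] [Algebra F K] (n : ℕ) (l : List F) : Matrix (Fin n) (Fin n) K :=
  Matrix.diagonal fun i => algebraMap F K (l.getD i 0)

lemma Dg00 (n : ℕ) (a : F) (l : List F) : Dg K (n + 1) (a :: l) 0 0 = algebraMap F K a := by simp [Dg]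
lemma Dg0s (n : ℕ) (l : List F) (j : Fin n) : Dg K (n + 1) l 0 j.succ = 0 := by
  rw [Dg, Matrix.diagonal_apply_ne _ (Fin.succ_ne_zero j).symm]
lemma Dgs0 (n : ℕ) (l : List F) (j : Fin n) : Dg K (n + 1) l j.succ 0 = 0 := by
  rw [Dg, Matrix.diagonal_apply_ne _ (Fin.succ_ne_zero j)]
lemma Dgss (n : ℕ) (a : F) (l : List F) (i j : Fin n) : Dg K (n + 1) (a :: l) i.succ j.succ = Dg K n l i j := by
  simp [Dg, Matrix.diagonal_apply]

theorem Cg.sound (hinv : ∀ x, ι (ι x) = x) (hι : ∀ y : F, ι (algebraMap F K y) = algebraMap F K y) (δ : K) (hδ : ι δ = -δ)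
    {d : F} (hd : δ ^ 2 = - algebraMap F K d) {l l' : List F} (h : Cg d l l') :
    ∀ n, l.length ≤ n → ∃ P : Matrix (Fin n) (Fin n) K, Dg K n l' = Pᵀ * Dg K n l * P.map ι := by
  have hN : ∀ x1 x2 : F, algebraMap F K (x1 ^ 2 + d * x2 ^ 2) =
      (algebraMap F K x1 + algebraMap F K x2 * δ) * ι (algebraMap F K x1 + algebraMap F K x2 * δ) := by
    intro x1 x2
    simp only [map_add, map_mul, map_pow, hι, hδ]
    linear_combination (algebraMap F K x2) ^ 2 * hd
  have hent : ∀ n (P : Matrix (Fin n) (Fin n) K) (l : List F) i j, (Pᵀ * Dg K n l * P.map ι) i j =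
      ∑ k : Fin n, P k i * algebraMap F K (l.getD k 0) * ι (P k j) := by
    intro n P l i j
    rw [Matrix.mul_apply]
    refine Finset.sum_congr rfl fun k _ => ?_
    rw [Dg, Matrix.mul_diagonal, Matrix.transpose_apply, Matrix.map_apply]
  induction h with
  | refl l => intro n _; exact ⟨1, by simp [Matrix.map_one]⟩
  | trans h1 h2 i1 i2 =>
    intro n hn
    obtain ⟨P, hP⟩ := i1 n hn
    obtain ⟨Q, hQ⟩ := i2 n (h1.len ▸ hn)
    refine ⟨P * Q, ?_⟩
    rw [hQ, hP, Matrix.transpose_mul, Matrix.map_mul]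
    simp only [Matrix.mul_assoc]
  | cons a h1 i1 =>
    intro n hn
    obtain ⟨n, rfl⟩ : ∃ k, n = k + 1 := ⟨n - 1, by simp at hn; omega⟩
    obtain ⟨P, hP⟩ := i1 n (by simpa using hn)
    refine ⟨Matrix.of (Fin.cons (Fin.cons 1 0) (fun i => Fin.cons 0 (P i))), ?_⟩
    ext i j
    rw [hent, Fin.sum_univ_succ]
    refine Fin.cases ?_ (fun i => ?_) i <;> refine Fin.cases ?_ (fun j => ?_) j
    · rw [Dg00]; simp
    · rw [Dg0s]; simp
    · rw [Dgs0]; simp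
    · rw [Dgss, hP, hent]; simp
  | bin a b c x1 x2 y1 y2 l hc h0 =>
    intro n hn
    obtain ⟨n, rfl⟩ : ∃ k, n = k + 2 := ⟨n - 2, by simp at hn; omega⟩
    have hx := hN x1 x2
    have hy := hN y1 y2
    have hc' := congrArg (algebraMap F K) hc
    rw [map_add, map_mul, map_mul, hx, hy] at hc'
    generalize algebraMap F K x1 + algebraMap F K x2 * δ = x at hc'
    generalize algebraMap F K y1 + algebraMap F K y2 * δ = y at hc'
    refine ⟨Matrix.of (Fin.cons (Fin.cons x (Fin.cons (- algebraMap F K b * ι y) 0)) (Fin.cons (Fin.cons y (Fin.cons (algebraMap F K a * ι x) 0))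
      (fun i => Fin.cons 0 (Fin.cons 0 ((1 : Matrix (Fin n) (Fin n) K) i))))), ?_⟩
    ext i j
    rw [hent, Fin.sum_univ_succ, Fin.sum_univ_succ]
    refine Fin.cases ?_ (fun i => ?_) i <;> refine Fin.cases ?_ (fun j => ?_) j
    · rw [Dg00, hc']; simp; ring
    · rw [Dg0s]
      refine Fin.cases ?_ (fun j => ?_) j
      · simp [hι, hinv]; ring
      · simp
    · rw [Dgs0]
      refine Fin.cases ?_ (fun j => ?_) i
      · simp [hι, hinv]; ring
      · simp
    · rw [Dgss]
      refine Fin.cases ?_ (fun i => ?_) i <;> refine Fin.cases ?_ (fun j => ?_) j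
      · rw [Dg00, map_mul, map_mul, hc']; simp [hι, hinv]; ring
      · rw [Dg0s]; simp
      · rw [Dgs0]; simp
      · rw [Dgss]; simp only [Dg, Matrix.diagonal_apply]; by_cases hij : i = j <;> simp [Matrix.one_apply, hij, eq_comm]
  | scale a x1 x2 l h0 =>
    intro n hn
    obtain ⟨n, rfl⟩ : ∃ k, n = k + 1 := ⟨n - 1, by simp at hn; omega⟩
    have hx := hN x1 x2
    generalize algebraMap F K x1 + algebraMap F K x2 * δ = x at hx
    refine ⟨Matrix.of (Fin.cons (Fin.cons x 0) (fun i => Fin.cons 0 ((1 : Matrix (Fin n) (Fin n) K) i))), ?_⟩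
    ext i j
    rw [hent, Fin.sum_univ_succ]
    refine Fin.cases ?_ (fun i => ?_) i <;> refine Fin.cases ?_ (fun j => ?_) j
    · rw [Dg00, map_mul, hx]; simp; ring
    · rw [Dg0s]; simp
    · rw [Dgs0]; simp
    · rw [Dgss]; simp only [Dg, Matrix.diagonal_apply]; by_cases hij : i = j <;> simp [Matrix.one_apply, hij, eq_comm]
end sound
end Lh

set_option linter.unusedSectionVars false
namespace Lh
open NumberField
open scoped Matrix

lemma quad_diag {n : ℕ} (e : Fin n → ℝ) (u : Fin n → ℂ) :
    star u ⬝ᵥ ((Matrix.diagonal fun i => (e i : ℂ)) *ᵥ u) = ((∑ i, e i * Complex.normSq (u i) : ℝ) : ℂ) := by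
  simp only [dotProduct, Matrix.mulVec_diagonal, Pi.star_apply, Complex.ofReal_sum, Complex.ofReal_mul, Complex.normSq_eq_conj_mul_self]
  refine Finset.sum_congr rfl fun i _ => ?_
  simp only [Complex.star_def]; ring

lemma syl {n : ℕ} (d e : Fin n → ℝ) (S : Matrix (Fin n) (Fin n) ℂ)
    (h : (Matrix.diagonal fun i => (d i : ℂ)) = S * (Matrix.diagonal fun i => (e i : ℂ)) * Sᴴ) :
    Fintype.card {i // 0 < d i} ≤ Fintype.card {i // 0 < e i} := by
  classical
  let T : ({i // 0 < d i} → ℂ) →ₗ[ℂ] ({i // 0 < e i} → ℂ) :=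
    (LinearMap.funLeft ℂ ℂ (Subtype.val : {i // 0 < e i} → Fin n)).comp
      (Sᴴ.mulVecLin.comp (Function.ExtendByZero.linearMap ℂ (Subtype.val : {i // 0 < d i} → Fin n)))
  have hT : Function.Injective T := by
    rw [← LinearMap.ker_eq_bot, LinearMap.ker_eq_bot']
    intro v hv
    let v' : Fin n → ℂ := Function.extend Subtype.val v 0
    let u := Sᴴ *ᵥ v'
    have hu : ∀ i, 0 < e i → u i = 0 := fun i hi => congrFun hv ⟨i, hi⟩
    have e1 := quad_diag d v'
    have e2 := quad_diag e u
    have e3 : star v' ⬝ᵥ ((Matrix.diagonal fun i => (d i : ℂ)) *ᵥ v') = star u ⬝ᵥ ((Matrix.diagonal fun i => (e i : ℂ)) *ᵥ u) := by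
      rw [h]
      simp only [u]
      rw [Matrix.star_mulVec, Matrix.conjTranspose_conjTranspose, ← Matrix.dotProduct_mulVec]
      simp only [Matrix.mulVec_mulVec, Matrix.mul_assoc]
    rw [e1, e2, Complex.ofReal_inj] at e3
    have e4 : ∑ i, e i * Complex.normSq (u i) ≤ 0 := by
      refine Finset.sum_nonpos fun i _ => ?_
      by_cases hi : 0 < e i
      · rw [hu i hi]; simp
      · exact mul_nonpos_of_nonpos_of_nonneg (not_lt.1 hi) (Complex.normSq_nonneg _)
    have hpos : ∀ i ∈ Finset.univ, 0 ≤ d i * Complex.normSq (v' i) := by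
      intro i _
      by_cases hi : 0 < d i
      · exact mul_nonneg hi.le (Complex.normSq_nonneg _)
      · have : v' i = 0 := by
          simp only [v']
          rw [Function.extend_apply']
          · rfl
          · rintro ⟨j, rfl⟩; exact hi j.2
        rw [this]; simp
    have e5 := (Finset.sum_eq_zero_iff_of_nonneg hpos).1 (le_antisymm (e3 ▸ e4) (Finset.sum_nonneg hpos))
    ext i
    have e6 := e5 i.1 (Finset.mem_univ _)
    have e7 : v' i.1 = v i := Subtype.val_injective.extend_apply _ _ _
    rw [e7, mul_eq_zero, Complex.normSq_eq_zero] at e6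
    exact e6.resolve_left i.2.ne'
  simpa using LinearMap.finrank_le_finrank_of_injective hT

lemma card_pn {n : ℕ} (d : Fin n → ℝ) (hd : ∀ i, d i ≠ 0) :
    Fintype.card {i // 0 < d i} + Fintype.card {i // d i < 0} = n := by
  classical
  rw [Fintype.card_subtype, Fintype.card_subtype, ← Finset.card_union_of_disjoint]
  · conv_rhs => rw [← Fintype.card_fin n, ← Finset.card_univ]
    congr 1
    ext i
    simpa using (lt_or_gt_of_ne (hd i)).symm
  · rw [Finset.disjoint_filter]
    intro i _ h; exact h.not_gt

lemma dneg {n : ℕ} (d : Fin n → ℝ) : (Matrix.diagonal fun i => ((-d i : ℝ) : ℂ)) = - Matrix.diagonal fun i => (d i : ℂ) := by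
  ext i j
  rw [Matrix.neg_apply, Matrix.diagonal_apply, Matrix.diagonal_apply]
  split_ifs <;> simp

theorem sig {n : ℕ} (A : Matrix (Fin n) (Fin n) ℂ) (hA : A.IsHermitian) (hdet : A.det ≠ 0) (d : Fin n → ℝ) (hd : ∀ i, d i ≠ 0)
    (Q : Matrix (Fin n) (Fin n) ℂ) (h : A = Q * (Matrix.diagonal fun i => (d i : ℂ)) * Qᴴ) :
    Fintype.card {i // 0 < hA.eigenvalues i} = Fintype.card {i // 0 < d i} ∧
    Fintype.card {i // hA.eigenvalues i < 0} = Fintype.card {i // d i < 0} := by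
  classical
  have hs := hA.spectral_theorem
  rw [Unitary.conjStarAlgAut_apply] at hs
  set U : Matrix (Fin n) (Fin n) ℂ := (hA.eigenvectorUnitary : Matrix (Fin n) (Fin n) ℂ) with hU
  have hUU : star U * U = 1 := Unitary.coe_star_mul_self _
  have hD : (Matrix.diagonal fun i => (hA.eigenvalues i : ℂ)) = star U * A * U := by
    conv_rhs => rw [hs]
    calc _ = (star U * U) * (Matrix.diagonal fun i => (hA.eigenvalues i : ℂ)) * (star U * U) := by rw [hUU]; simp
      _ = _ := by simp only [Matrix.mul_assoc]; rfl
  have hD2 : (Matrix.diagonal fun i => (hA.eigenvalues i : ℂ)) = (star U * Q) * (Matrix.diagonal fun i => (d i : ℂ)) * (star U * Q)ᴴ := by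
    rw [hD]
    conv_lhs => rw [h]
    rw [Matrix.conjTranspose_mul, Matrix.star_eq_conjTranspose, Matrix.conjTranspose_conjTranspose]
    simp only [Matrix.mul_assoc]
  have h1 := syl _ _ _ hD2
  have h2 := syl (fun i => - hA.eigenvalues i) (fun i => - d i) (star U * Q) (by
    rw [dneg, dneg, hD2, Matrix.mul_neg, Matrix.neg_mul])
  simp only [neg_pos] at h2
  have h3 := card_pn d hd
  have h4 := card_pn hA.eigenvalues (fun i hi => hdet (by
    rw [hA.det_eq_prod_eigenvalues]
    exact Finset.prod_eq_zero (Finset.mem_univ i) (by rw [hi]; simp)))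
  omega

lemma pc_ofFn {F : Type*} [Field F] [NumberField F] (ψ : F →+* ℝ) {n : ℕ} (a : Fin n → F) :
    pc ψ (List.ofFn a) = Fintype.card {i // 0 < ψ (a i)} := by
  classical
  induction n with
  | zero => simp [pc]
  | succ n ih =>
    rw [List.ofFn_succ, pc_cons, ih, Fintype.card_subtype, Fintype.card_subtype, Fin.card_filter_univ_succ]
    split_ifs <;> simp [Function.comp_def]

end Lh

set_option linter.unusedSectionVars false
namespace Lh
open NumberField
open scoped Matrix

lemma csq {z : ℂ} {r : ℝ} (h : z ^ 2 = -(r : ℂ)) : z.re * z.im = 0 ∧ z.re ^ 2 - z.im ^ 2 = -r := by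
  have h1 := congrArg Complex.re h
  have h2 := congrArg Complex.im h
  simp only [sq, Complex.mul_re, Complex.mul_im, Complex.neg_re, Complex.neg_im, Complex.ofReal_re, Complex.ofReal_im] at h1 h2
  constructor <;> nlinarith

section
variable {F K : Type*} [Field F] [Field K] [NumberField F] [NumberField K] [Algebra F K] (ι : K ≃+* K)

lemma ext_real (ψ : F →+* ℝ) : ∃ φ : K →+* ℂ, ∀ y, φ (algebraMap F K y) = (ψ y : ℂ) := by
  let _ : Algebra F ℂ := (Complex.ofRealHom.comp ψ).toAlgebra
  have : Algebra.IsAlgebraic F K := by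
    have : Algebra.IsAlgebraic ℚ K := inferInstance
    exact Algebra.IsAlgebraic.tower_top (K := ℚ) F
  let f : K →ₐ[F] ℂ := IsAlgClosed.lift
  exact ⟨f, fun y => f.commutes y⟩

theorem exists_delta (hF : TR F) (hCM : ∀ φ : K →+* ℂ, ∃ x, (φ x).im ≠ 0)
    (hι : ∀ y : F, ι (algebraMap F K y) = algebraMap F K y)
    (hinv : ∀ x, ι (ι x) = x)
    (hfix : ∀ x : K, ι x = x ↔ ∃ y : F, algebraMap F K y = x) :
    ∃ (δ : K) (d : F), ι δ = -δ ∧ δ ≠ 0 ∧ δ ^ 2 = - algebraMap F K d ∧ TPos d ∧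
      (∀ x : K, ∃ x1 x2 : F, x = algebraMap F K x1 + algebraMap F K x2 * δ) ∧
      ∀ φ : K →+* ℂ, ∀ x, φ (ι x) = (starRingEnd ℂ) (φ x) := by
  obtain ⟨ψ₀, -⟩ := hF.exists_real
  obtain ⟨φ₀, hφ₀⟩ := ext_real (K := K) ψ₀
  obtain ⟨x, hx⟩ := hCM φ₀
  have hx' : ι x ≠ x := by
    rw [Ne, hfix]
    rintro ⟨y, rfl⟩
    rw [hφ₀] at hx; simp at hx
  let δ := x - ι x
  have hδ : ι δ = -δ := by simp [δ, hinv]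
  have hδ0 : δ ≠ 0 := sub_ne_zero.2 (Ne.symm hx')
  obtain ⟨s, hs⟩ := (hfix (δ ^ 2)).1 (by rw [map_pow, hδ]; ring)
  have hd : δ ^ 2 = - algebraMap F K (-s) := by rw [← hs]; simp
  have hdec : ∀ x : K, ∃ x1 x2 : F, x = algebraMap F K x1 + algebraMap F K x2 * δ := by
    intro x
    obtain ⟨x1, h1⟩ := (hfix ((x + ι x) / 2)).1 (by rw [map_div₀, map_add, hinv, map_ofNat]; ring)
    obtain ⟨x2, h2⟩ := (hfix ((x - ι x) / (2 * δ))).1 (by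
      rw [map_div₀, map_sub, hinv, map_mul, map_ofNat, hδ, mul_neg, div_neg, ← neg_div, neg_sub])
    refine ⟨x1, x2, ?_⟩
    rw [h1, h2]; field_simp; ring
  have hψd : ∀ (φ : K →+* ℂ) (ψ : F →+* ℝ), (∀ y, φ (algebraMap F K y) = (ψ y : ℂ)) → 0 < ψ (-s) ∧ (φ δ).re = 0 := by
    intro φ ψ h
    have e : (φ δ) ^ 2 = -((ψ (-s) : ℝ) : ℂ) := by rw [← map_pow, hd, map_neg, h]
    obtain ⟨e1, e2⟩ := csq e
    have him : (φ δ).im ≠ 0 := by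
      intro h0
      obtain ⟨x, hx⟩ := hCM φ
      obtain ⟨x1, x2, rfl⟩ := hdec x
      apply hx
      simp [h, h0]
    have hre := (mul_eq_zero.1 e1).resolve_right him
    refine ⟨?_, hre⟩
    rw [hre] at e2
    have : 0 < (φ δ).im ^ 2 := by positivity
    nlinarith
  refine ⟨δ, -s, hδ, hδ0, hd, ?_, hdec, ?_⟩
  · intro ψ
    obtain ⟨φ, hφ⟩ := ext_real (K := K) ψ
    exact (hψd φ ψ hφ).1
  · intro φ x
    obtain ⟨ψ, hψ⟩ := hF.real (φ.comp (algebraMap F K))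
    have hψ' : ∀ y, φ (algebraMap F K y) = (ψ y : ℂ) := hψ
    have hre := (hψd φ ψ hψ').2
    obtain ⟨x1, x2, rfl⟩ := hdec x
    simp only [map_add, map_mul, hι, hδ, map_neg, hψ', Complex.conj_ofReal]
    have : (starRingEnd ℂ) (φ δ) = - φ δ := by
      apply Complex.ext <;> simp [hre]
    rw [this]

/-- Gram matrices that are congruent. -/
def Co {m : ℕ} (M N : Matrix (Fin m) (Fin m) K) : Prop := ∃ P : Matrix (Fin m) (Fin m) K, M = Pᵀ * N * P.map ι

lemma Co.trans {m : ℕ} {M N L : Matrix (Fin m) (Fin m) K} : Co ι M N → Co ι N L → Co ι M L := by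
  rintro ⟨P, rfl⟩ ⟨Q, rfl⟩
  refine ⟨Q * P, ?_⟩
  rw [Matrix.transpose_mul, Matrix.map_mul]
  simp only [Matrix.mul_assoc]

lemma Co.smul {m : ℕ} {M N : Matrix (Fin m) (Fin m) K} (c : K) : Co ι M N → Co ι (c • M) (c • N) := by
  rintro ⟨P, rfl⟩
  exact ⟨P, by simp⟩

lemma Co.symm_of {m : ℕ} {M N P : Matrix (Fin m) (Fin m) K} (hP : IsUnit P.det) (h : Pᵀ * M * P.map ι = N) : Co ι M N := by
  have h1 : P * P⁻¹ = 1 := Matrix.mul_nonsing_inv _ hP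
  have h2 : P.map ι * P⁻¹.map ι = 1 := by rw [← Matrix.map_mul, h1]; simp
  have h3 : P⁻¹ᵀ * Pᵀ = 1 := by rw [← Matrix.transpose_mul, h1]; simp
  refine ⟨P⁻¹, ?_⟩
  rw [← h]
  calc M = (P⁻¹ᵀ * Pᵀ) * M * (P.map ι * P⁻¹.map ι) := by rw [h2, h3]; simp
    _ = _ := by simp only [Matrix.mul_assoc]

lemma Co.det {m : ℕ} {M N : Matrix (Fin m) (Fin m) K} (h : Co ι M N) : ∃ w, M.det = N.det * (w * ι w) := by
  obtain ⟨P, rfl⟩ := h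
  refine ⟨P.det, ?_⟩
  have : (P.map ι).det = ι P.det := by
    have := RingHom.map_det (ι : K →+* K) P
    exact this.symm
  rw [Matrix.det_mul, Matrix.det_mul, Matrix.det_transpose, this]; ring

/-- The signature of a matrix congruent to a diagonal one. -/
lemma Co.sig {m : ℕ} {M : Matrix (Fin m) (Fin m) K} (hH : Mᵀ = M.map ι) (hnd : M.det ≠ 0) {a : Fin m → F} (ha : ∀ i, a i ≠ 0)
    (h : Co ι M (Matrix.diagonal fun i => algebraMap F K (a i)))
    (φ : K →+* ℂ) (hφ : ∀ x, φ (ι x) = (starRingEnd ℂ) (φ x)) (ψ : F →+* ℝ) (hψ : ∀ y, φ (algebraMap F K y) = (ψ y : ℂ)) :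
    ∃ hA : (M.map φ).IsHermitian,
     Fintype.card {i // 0 < hA.eigenvalues i} = Fintype.card {i // 0 < ψ (a i)} ∧
     Fintype.card {i // hA.eigenvalues i < 0} = Fintype.card {i // ψ (a i) < 0} := by
  have hA : (M.map φ).IsHermitian := by
    ext i j
    have := congrFun (congrFun hH i) j
    simp only [Matrix.transpose_apply, Matrix.map_apply] at this
    rw [Matrix.conjTranspose_apply, Matrix.map_apply, Matrix.map_apply, this, hφ]
    simp
  refine ⟨hA, ?_⟩
  obtain ⟨P, hP⟩ := h
  refine Lh.sig _ hA ?_ (fun i => ψ (a i)) (fun i => (map_ne_zero ψ).2 (ha i)) (P.map φ)ᵀ ?_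
  · have := RingHom.map_det φ M
    rw [RingHom.mapMatrix_apply] at this
    rw [← this]
    exact (map_ne_zero φ).2 hnd
  · rw [hP, Matrix.map_mul, Matrix.map_mul, Matrix.transpose_map, Matrix.diagonal_map (map_zero φ)]
    congr 1
    · congr 2
      ext i; exact hψ _
    · ext i j
      simp [hφ, Matrix.conjTranspose_apply]
end
end Lh


/-- Let K/F be a CM quadratic extension of a totally real number field with Galois
    involution ι, and M₁, M₂ nondegenerate ι-Hermitian Gram matrices of even size m.
    They are F-conformal (M₁ = λ·(Pᵀ M₂ ι(P)), λ ∈ F^×, P invertible) if and only if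
    at every complex embedding of K compatible with ι the signatures agree up to swap
    AND det M₁ = det M₂ in F^×/N_{K/F}(K^×). -/
theorem stmt4 (F K : Type*) [Field F] [Field K] [NumberField F] [NumberField K]
    [Algebra F K] (hrank : Module.finrank F K = 2)
    (htotreal : ∀ φ : F →+* ℂ, ∀ x, (φ x).im = 0)
    (hCM : ∀ φ : K →+* ℂ, ∃ x, (φ x).im ≠ 0)
    (ι : K ≃+* K)
    (hι : ∀ y : F, ι (algebraMap F K y) = algebraMap F K y)
    (hinv : ∀ x, ι (ι x) = x)
    (hfix : ∀ x : K, ι x = x ↔ ∃ y : F, algebraMap F K y = x)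
    (m : ℕ) (hm : Even m) (hm' : 0 < m)
    (M₁ M₂ : Matrix (Fin m) (Fin m) K)
    (hH₁ : M₁ᵀ = M₁.map ι) (hH₂ : M₂ᵀ = M₂.map ι)
    (hnd₁ : M₁.det ≠ 0) (hnd₂ : M₂.det ≠ 0) :
    (∃ (l : F) (P : Matrix (Fin m) (Fin m) K), l ≠ 0 ∧ IsUnit P.det ∧
        M₁ = algebraMap F K l • (Pᵀ * M₂ * P.map ι)) ↔
      ((∀ φ : K →+* ℂ, (∀ x, φ (ι x) = (starRingEnd ℂ) (φ x)) →
          ∃ p q : ℕ, HermSig m (M₁.map φ) p q ∧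
            (HermSig m (M₂.map φ) p q ∨ HermSig m (M₂.map φ) q p)) ∧
        ∃ w : K, w ≠ 0 ∧ M₁.det = M₂.det * (w * ι w)) := by
  classical
  have hF : Lh.TR F := htotreal
  obtain ⟨δ, d, hδ, hδ0, hδd, hd, hdec, hconj⟩ := Lh.exists_delta ι hF hCM hι hinv hfix
  have h2 : (2 : K) ≠ 0 := two_ne_zero
  obtain ⟨P₁, a, hP₁, ha⟩ := Lh.diagz ι hinv hfix δ hδ hδ0 h2 m M₁ hH₁
  obtain ⟨P₂, b, hP₂, hb⟩ := Lh.diagz ι hinv hfix δ hδ hδ0 h2 m M₂ hH₂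
  have hC₁ : Lh.Co ι M₁ _ := Lh.Co.symm_of ι hP₁ ha
  have hC₂ : Lh.Co ι M₂ _ := Lh.Co.symm_of ι hP₂ hb
  have hC₂' : Lh.Co ι (Matrix.diagonal fun i => algebraMap F K (b i)) M₂ := ⟨P₂, hb.symm⟩
  have nz : ∀ (M : Matrix (Fin m) (Fin m) K) (c : Fin m → F), M.det ≠ 0 →
      Lh.Co ι M (Matrix.diagonal fun i => algebraMap F K (c i)) → ∀ i, c i ≠ 0 := by
    intro M c hM hC i hi
    obtain ⟨w, hw⟩ := hC.det
    rw [Matrix.det_diagonal, Finset.prod_eq_zero (Finset.mem_univ i) (by rw [hi, map_zero]), zero_mul] at hw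
    exact hM hw
  have ha0 := nz _ _ hnd₁ hC₁
  have hb0 := nz _ _ hnd₂ hC₂
  have hlb : ∀ l : F, algebraMap F K l • (Matrix.diagonal fun i => algebraMap F K (b i)) =
      (Matrix.diagonal fun i => algebraMap F K (l * b i)) := by
    intro l
    rw [← Matrix.diagonal_smul]
    congr 1
    ext i; simp
  have hs : ∀ (M : Matrix (Fin m) (Fin m) K) (c : Fin m → F), Mᵀ = M.map ι → M.det ≠ 0 → 
      Lh.Co ι M (Matrix.diagonal fun i => algebraMap F K (c i)) → ∀ (φ : K →+* ℂ) (ψ : F →+* ℝ),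
      (∀ y, φ (algebraMap F K y) = (ψ y : ℂ)) → ∀ p q, HermSig m (M.map φ) p q ↔ 
        (p = Fintype.card {i // 0 < ψ (c i)} ∧ q = Fintype.card {i // ψ (c i) < 0}) := by
    intro M c hH hM hC φ ψ hψ p q
    obtain ⟨hA, e1, e2⟩ := hC.sig ι hH hM (nz _ _ hM hC) φ (hconj φ) ψ hψ
    constructor
    · rintro ⟨hA', r1, r2⟩
      exact ⟨r1.trans e1, r2.trans e2⟩
    · rintro ⟨r1, r2⟩
      exact ⟨hA, r1.trans e1.symm, r2.trans e2.symm⟩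
  have hsgn : ∀ (ψ : F →+* ℝ) (l : F), (0 < ψ l →
      Fintype.card {i // 0 < ψ (l * b i)} = Fintype.card {i // 0 < ψ (b i)} ∧
      Fintype.card {i // ψ (l * b i) < 0} = Fintype.card {i // ψ (b i) < 0}) ∧
      (ψ l < 0 → 
      Fintype.card {i // 0 < ψ (l * b i)} = Fintype.card {i // ψ (b i) < 0} ∧
      Fintype.card {i // ψ (l * b i) < 0} = Fintype.card {i // 0 < ψ (b i)}) := by
    intro ψ l
    simp only [map_mul]
    refine ⟨fun h => ?_, fun h => ?_⟩
    · have k2 : ∀ x : ℝ, ψ l * x < 0 ↔ x < 0 := fun x => by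
        constructor
        · intro hx; by_contra h'; nlinarith
        · intro hx; exact mul_neg_of_pos_of_neg h hx
      simp only [mul_pos_iff_of_pos_left h, k2, and_self]
    · have k1 : ∀ x : ℝ, 0 < ψ l * x ↔ x < 0 := fun x => by
        constructor
        · intro hx; by_contra h'; nlinarith
        · intro hx; exact mul_pos_of_neg_of_neg h hx
      have k2 : ∀ x : ℝ, ψ l * x < 0 ↔ 0 < x := fun x => by
        constructor
        · intro hx; by_contra h'; nlinarith
        · intro hx; exact mul_neg_of_neg_of_pos h hx
      simp only [k1, k2, and_self]
  obtain ⟨k, hk⟩ := hm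
  have hpw : ∀ x : K, x ^ m = x ^ k * x ^ k := fun x => by rw [← pow_add, ← hk]
  constructor
  · rintro ⟨l, P, hl, hP, hM⟩
    have hC : Lh.Co ι M₁ (Matrix.diagonal fun i => algebraMap F K (l * b i)) := by
      rw [← hlb]
      refine Lh.Co.trans ι (N := algebraMap F K l • M₂) ⟨P, ?_⟩ (hC₂.smul ι _)
      rw [hM]; simp
    refine ⟨?_, ?_⟩
    · intro φ _
      obtain ⟨ψ, hψ⟩ := hF.real (φ.comp (algebraMap F K))
      have hψ' : ∀ y, φ (algebraMap F K y) = (ψ y : ℂ) := hψ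
      refine ⟨_, _, (hs M₁ _ hH₁ hnd₁ hC φ ψ hψ' _ _).2 ⟨rfl, rfl⟩, ?_⟩
      rw [hs M₂ _ hH₂ hnd₂ hC₂ φ ψ hψ', hs M₂ _ hH₂ hnd₂ hC₂ φ ψ hψ']
      have hl' : ψ l ≠ 0 := (map_ne_zero ψ).2 hl
      rcases lt_or_gt_of_ne hl' with h | h
      · have := (hsgn ψ l).2 h
        exact Or.inr ⟨this.2, this.1⟩
      · exact Or.inl ((hsgn ψ l).1 h)
    · have hι' : (P.map ι).det = ι P.det := (RingHom.map_det (ι : K →+* K) P).symm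
      refine ⟨algebraMap F K l ^ k * P.det, mul_ne_zero (pow_ne_zero _ (by simpa using hl)) hP.ne_zero, ?_⟩
      rw [hM, Matrix.det_smul, Matrix.det_mul, Matrix.det_mul, Matrix.det_transpose, hι', Fintype.card_fin, map_mul, map_pow, hι, hpw]
      ring
  · rintro ⟨hsig, w, hw0, hw⟩
    have hab : ∀ ψ : F →+* ℝ, Fintype.card {i // 0 < ψ (a i)} = Fintype.card {i // 0 < ψ (b i)} ∨
        Fintype.card {i // 0 < ψ (a i)} = Fintype.card {i // ψ (b i) < 0} := by
      intro ψ
      obtain ⟨φ, hφ⟩ := Lh.ext_real (K := K) ψ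
      obtain ⟨p, q, h1, h3⟩ := hsig φ (hconj φ)
      rw [hs M₁ _ hH₁ hnd₁ hC₁ φ ψ hφ] at h1
      rw [hs M₂ _ hH₂ hnd₂ hC₂ φ ψ hφ, hs M₂ _ hH₂ hnd₂ hC₂ φ ψ hφ] at h3
      rcases h3 with h3 | h3
      · exact Or.inl (h1.1.symm.trans h3.1)
      · exact Or.inr (h1.1.symm.trans h3.2)
    obtain ⟨l, hl⟩ := Lh.real_dense (fun ψ : F →+* ℝ =>
      if Fintype.card {i // 0 < ψ (a i)} = Fintype.card {i // 0 < ψ (b i)} then (1 : ℝ) else -1) one_pos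
    have hl2 : ∀ ψ : F →+* ℝ, ψ l ≠ 0 ∧ Fintype.card {i // 0 < ψ (a i)} = Fintype.card {i // 0 < ψ (l * b i)} := by
      intro ψ
      have h1 := hl ψ
      split_ifs at h1 with h
      · have : 0 < ψ l := by have := (abs_lt.1 h1).1; linarith
        exact ⟨this.ne', by rw [((hsgn ψ l).1 this).1, h]⟩
      · have : ψ l < 0 := by have := (abs_lt.1 h1).2; linarith
        exact ⟨this.ne, by rw [((hsgn ψ l).2 this).1, (hab ψ).resolve_left h]⟩
    have hl0 : l ≠ 0 := by
      obtain ⟨ψ, -⟩ := hF.exists_real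
      exact fun h => (hl2 ψ).1 (by rw [h, map_zero])
    -- determinants
    have hprod : ∃ u, Lh.NmN d u ∧ (List.ofFn a).prod = (List.ofFn fun i => l * b i).prod * u := by
      obtain ⟨w₁, e1⟩ := hC₂.det
      have e2 : (Matrix.diagonal fun i => algebraMap F K (a i)).det = M₁.det * (P₁.det * ι P₁.det) := by
        have hι' : (P₁.map ι).det = ι P₁.det := (RingHom.map_det (ι : K →+* K) P₁).symm
        rw [← ha, Matrix.det_mul, Matrix.det_mul, Matrix.det_transpose, hι']; ring
      rw [hw, e1, Matrix.det_diagonal, Matrix.det_diagonal, ← map_prod, ← map_prod] at e2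
      have hlK : algebraMap F K l ≠ 0 := by simpa using hl0
      obtain ⟨z, hz⟩ : ∃ z, z = w₁ * w * P₁.det / algebraMap F K l ^ k := ⟨_, rfl⟩
      have hzz : algebraMap F K (∏ i, a i) = algebraMap F K (l ^ m * ∏ i, b i) * (z * ι z) := by
        rw [e2, hz, map_div₀ ι, map_mul ι, map_mul ι, map_pow ι, hι, map_mul (algebraMap F K), map_pow (algebraMap F K), hpw]
        field_simp
      obtain ⟨x1, x2, hx⟩ := hdec z
      have hN : z * ι z = algebraMap F K (x1 ^ 2 + d * x2 ^ 2) := by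
        rw [hx]
        simp only [map_add, map_mul, map_pow, hι, hδ]
        linear_combination (-(algebraMap F K x2) ^ 2) * hδd
      rw [hN, ← map_mul, (algebraMap F K).injective.eq_iff] at hzz
      refine ⟨_, ⟨?_, x1, x2, rfl⟩, ?_⟩
      · intro h
        rw [h, mul_zero] at hzz
        exact Finset.prod_ne_zero_iff.2 (fun i _ => ha0 i) hzz
      · rw [List.prod_ofFn, List.prod_ofFn, hzz, Finset.prod_mul_distrib]; simp
    have hCg := Lh.landherr hF hd (List.ofFn a) (List.ofFn fun i => l * b i)
      (by rw [List.mem_ofFn]; rintro ⟨i, hi⟩; exact mul_ne_zero hl0 (hb0 i) hi)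
      (by rw [List.mem_ofFn]; rintro ⟨i, hi⟩; exact ha0 i hi)
      (by simp) (fun ψ => by rw [Lh.pc_ofFn, Lh.pc_ofFn, (hl2 ψ).2]) hprod
    obtain ⟨P, hP⟩ := hCg.sound ι hinv hι δ hδ hδd m (by simp)
    have hDg : ∀ c : Fin m → F, Lh.Dg K m (List.ofFn c) = Matrix.diagonal fun i => algebraMap F K (c i) := by
      intro c
      simp [Lh.Dg]
    rw [hDg, hDg] at hP
    have hfin : Lh.Co ι M₁ (algebraMap F K l • M₂) := by
      refine (hC₁.trans ι ⟨P, hP⟩).trans ι ?_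
      rw [← hlb]
      exact hC₂'.smul ι _
    obtain ⟨R, hR⟩ := hfin
    refine ⟨l, R, hl0, ?_, ?_⟩
    · rw [isUnit_iff_ne_zero]
      intro h
      apply hnd₁
      rw [hR, Matrix.det_mul, Matrix.det_mul, Matrix.det_transpose, h]; simp
    · rw [hR]; simp
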